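/- There exists an absolute constant c such that for every primitive homogeneous polynomial f ∈ ℤ[x_0,x_1,x_2] of degree d ≥ 1 that is irreducible over ℚ, and every real B ≥ 1, one has N(f,B) ≤ c·d^4·B^{2/d}. -/

import Mathlib

/-- The number of rational points of `ℙ^{N-1}(ℚ)` of height at most `B` lying on the
projective hypersurface cut out by the homogeneous polynomial `f ∈ ℤ[x_0,…,x_{N-1}]`.
A point is counted via a primitive integer coordinate vector, all of whose entries
have absolute value at most `B`. -/
noncomputable def Nproj {N : ℕ} (f : MvPolynomial (Fin N) ℤ) (B : ℝ) : ℕ :=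
  Set.ncard {P : Projectivization ℚ (Fin N → ℚ) |
    ∃ (v : Fin N → ℤ) (hv : (fun i => (v i : ℚ)) ≠ 0),
      Finset.univ.gcd v = 1 ∧
      MvPolynomial.eval v f = 0 ∧ (∀ i, |(v i : ℝ)| ≤ B) ∧
      P = Projectivization.mk ℚ (fun i => (v i : ℚ)) hv}

-- Module M1

namespace PCB
open MvPolynomial

/-- Pairs `(i,j)` with `i + j ≤ n`. -/
def tri (n : ℕ) : Finset (ℕ × ℕ) :=
  (Finset.range (n + 1) ×ˢ Finset.range (n + 1)).filter (fun q => q.1 + q.2 ≤ n)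

lemma mem_tri {n : ℕ} {q : ℕ × ℕ} : q ∈ tri n ↔ q.1 + q.2 ≤ n := by
  simp only [tri, Finset.mem_filter, Finset.mem_product, Finset.mem_range]; omega

/-- Pairs `(i,j)` with `i + j ≤ L` and `j < d`. -/
def low (d L : ℕ) : Finset (ℕ × ℕ) := (tri L).filter (fun q => q.2 < d)

lemma mem_low {d L : ℕ} {q : ℕ × ℕ} : q ∈ low d L ↔ q.1 + q.2 ≤ L ∧ q.2 < d := by
  simp only [low, Finset.mem_filter, mem_tri]

lemma low_succ (d L : ℕ) : (low (d + 1) L).card = (low d L).card + (L + 1 - d) := by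
  have h : low (d + 1) L = low d L ∪ (Finset.range (L + 1 - d)).image (fun i => (i, d)) := by
    ext ⟨i, j⟩
    simp only [mem_low, Finset.mem_union, Finset.mem_image, Finset.mem_range, Prod.mk.injEq]
    constructor
    · rintro ⟨h1, h2⟩
      by_cases h : j < d
      · left; exact ⟨h1, h⟩
      · right; exact ⟨i, by omega, rfl, by omega⟩
    · rintro (⟨h1, h2⟩ | ⟨a, h1, h2, h3⟩) <;> constructor <;> omega
  rw [h, Finset.card_union_of_disjoint, Finset.card_image_of_injective, Finset.card_range]
  · intro a b h; simpa using h
  · rw [Finset.disjoint_left]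
    rintro ⟨i, j⟩ h1 h2
    simp only [mem_low, Finset.mem_image, Finset.mem_range, Prod.mk.injEq] at h1 h2
    obtain ⟨a, h1, h2, h3⟩ := h2
    omega

lemma card_low_le (d L : ℕ) : (low d L).card ≤ d * (L + 1) := by
  induction d with
  | zero =>
    have : low 0 L = ∅ := by ext q; simp [mem_low]
    simp [this]
  | succ d ih => rw [low_succ, Nat.add_mul]; omega

lemma card_low {d L : ℕ} (h : d ≤ L + 1) : 2 * (low d L).card + d * d = d * (2 * L + 3) := by
  induction d with
  | zero =>
    have : low 0 L = ∅ := by ext q; simp [mem_low]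
    simp [this]
  | succ d ih =>
    rw [low_succ]
    have := ih (by omega)
    obtain ⟨e, rfl⟩ : ∃ e, L = d + e := ⟨L - d, by omega⟩
    have h2 : d + e + 1 - d = e + 1 := by omega
    rw [h2]
    nlinarith

lemma tri_eq_low (n : ℕ) : tri n = low (n + 1) n := by
  ext q; simp only [mem_tri, mem_low]; omega

lemma card_tri (n : ℕ) : 2 * (tri n).card = (n + 1) * (n + 2) := by
  have := card_low (d := n + 1) (L := n) le_rfl
  rw [tri_eq_low]; nlinarith

lemma card_low_add {d M : ℕ} (h : d ≤ M) :
    (low d M).card + (tri (M - d)).card = (tri M).card := by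
  obtain ⟨e, rfl⟩ : ∃ e, M = d + e := ⟨M - d, by omega⟩
  have h1 := card_low (d := d) (L := d + e) (by omega)
  have h2 := card_tri (d + e)
  have h3 := card_tri e
  rw [show d + e - d = e by omega]
  nlinarith

/-- exponent vector attached to a pair -/
noncomputable def mon (q : ℕ × ℕ) : Fin 2 →₀ ℕ := Finsupp.single 0 q.1 + Finsupp.single 1 q.2

@[simp] lemma mon_zero (q : ℕ × ℕ) : mon q 0 = q.1 := by simp [mon]
@[simp] lemma mon_one (q : ℕ × ℕ) : mon q 1 = q.2 := by simp [mon]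

lemma mon_injective : Function.Injective mon := by
  intro a b h
  have h0 := DFunLike.congr_fun h 0
  have h1 := DFunLike.congr_fun h 1
  simp at h0 h1
  exact Prod.ext h0 h1

lemma mon_eta (m : Fin 2 →₀ ℕ) : mon (m 0, m 1) = m := by
  ext i; fin_cases i <;> simp

/-- the equivalence between exponent vectors and pairs -/
noncomputable def monEquiv : (ℕ × ℕ) ≃ (Fin 2 →₀ ℕ) where
  toFun := mon
  invFun m := (m 0, m 1)
  left_inv q := by simp
  right_inv m := mon_eta m

lemma mon_add (a b : ℕ × ℕ) : mon (a + b) = mon a + mon b := by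
  ext i; fin_cases i <;> simp

lemma degree_fin2 (m : Fin 2 →₀ ℕ) : m.degree = m 0 + m 1 := by
  rw [Finsupp.degree_eq_sum]; simp

section
variable {k : Type*} [CommRing k]

lemma totalDegree_le_iff' {f : MvPolynomial (Fin 2) k} {n : ℕ} :
    f.totalDegree ≤ n ↔ ∀ m, coeff m f ≠ 0 → m 0 + m 1 ≤ n := by
  rw [MvPolynomial.totalDegree, Finset.sup_le_iff]
  constructor
  · intro h m hm
    have := h m (by simpa [mem_support_iff] using hm)
    rw [Finsupp.sum_fintype _ _ (by simp)] at this
    simpa using this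
  · intro h m hm
    have := h m (by simpa [mem_support_iff] using hm)
    rw [Finsupp.sum_fintype _ _ (by simp)]
    simpa using this

lemma restrictTotalDegree_eq (n : ℕ) :
    restrictTotalDegree (Fin 2) k n = restrictSupport k (mon '' (tri n : Set (ℕ × ℕ))) := by
  ext f
  rw [mem_restrictTotalDegree, totalDegree_le_iff', mem_restrictSupport_iff]
  constructor
  · intro h m hm
    refine ⟨(m 0, m 1), ?_, mon_eta m⟩
    simp only [Finset.mem_coe, mem_tri]
    exact h m (by simpa [mem_support_iff] using hm)
  · intro h m hm
    obtain ⟨q, hq, rfl⟩ := h (show m ∈ (f.support : Set _) by simpa [mem_support_iff] using hm)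
    simpa [mem_tri] using hq
end

section
variable {k : Type*} [Field k]

lemma finrank_restrictSupport (S : Finset (ℕ × ℕ)) :
    Module.finrank k (restrictSupport k (mon '' (S : Set (ℕ × ℕ)))) = S.card := by
  rw [Module.finrank_eq_nat_card_basis (basisRestrictSupport k _),
    Nat.card_image_of_injective mon_injective]
  simp

instance finite_restrictSupport (S : Finset (ℕ × ℕ)) :
    Module.Finite k (restrictSupport k (mon '' (S : Set (ℕ × ℕ)))) := by
  have : Finite (mon '' (S : Set (ℕ × ℕ))) := (S.finite_toSet.image _).to_subtype
  exact Module.Finite.of_basis (basisRestrictSupport k _)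

instance finite_restrictTotalDegree (n : ℕ) :
    Module.Finite k (restrictTotalDegree (Fin 2) k n) := by
  rw [restrictTotalDegree_eq]; exact finite_restrictSupport _

lemma finrank_V (n : ℕ) :
    Module.finrank k (restrictTotalDegree (Fin 2) k n) = (tri n).card := by
  rw [restrictTotalDegree_eq, finrank_restrictSupport]

/-- multiplication `V_a → V_n` by `f` when `deg f + a ≤ n` -/
noncomputable def mulV (f : MvPolynomial (Fin 2) k) (a n : ℕ) (h : f.totalDegree + a ≤ n) :
    restrictTotalDegree (Fin 2) k a →ₗ[k] restrictTotalDegree (Fin 2) k n :=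
  ((LinearMap.mulLeft k f).comp (Submodule.subtype _)).codRestrict _ (by
    rintro ⟨u, hu⟩
    rw [mem_restrictTotalDegree] at hu ⊢
    exact (totalDegree_mul _ _).trans (by simpa using by omega))

@[simp] lemma mulV_coe (f : MvPolynomial (Fin 2) k) (a n : ℕ) (h) (u) :
    ((mulV f a n h u : restrictTotalDegree (Fin 2) k n) : MvPolynomial (Fin 2) k) = f * u := rfl

/-- polynomials of degree at most `n` -/
noncomputable abbrev VV (k : Type*) [Field k] (n : ℕ) : Submodule k (MvPolynomial (Fin 2) k) :=
  restrictTotalDegree (Fin 2) k n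

theorem bezout {f g : MvPolynomial (Fin 2) k} (hf : Irreducible f) (hg : ¬ f ∣ g) {D : ℕ}
    (hD : g.totalDegree ≤ D) {T : Type*} [AddCommGroup T] [Module k T] [Module.Finite k T]
    (φ : MvPolynomial (Fin 2) k →ₗ[k] T) (hφ : Function.Surjective φ)
    (h1 : ∀ h, φ (f * h) = 0) (h2 : ∀ h, φ (g * h) = 0) :
    Module.finrank k T ≤ f.totalDegree * D := by
  classical
  set d := f.totalDegree with hd
  have hf0 : f ≠ 0 := hf.ne_zero
  have hg0 : g ≠ 0 := fun h => hg (h ▸ dvd_zero _)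
  -- a degree `n` with `V_n → T` surjective
  obtain ⟨n, hn, hnD⟩ : ∃ n, (∀ t : T, ∃ u ∈ restrictTotalDegree (Fin 2) k n, φ u = t) ∧ d + D ≤ n := by
    let b := Module.finBasis k T
    choose u hu using fun i => hφ (b i)
    refine ⟨d + D + ∑ i, (u i).totalDegree, fun t => ⟨∑ i, b.repr t i • u i, ?_, ?_⟩, by omega⟩
    · refine Submodule.sum_mem _ fun i _ => Submodule.smul_mem _ _ ?_
      rw [mem_restrictTotalDegree]
      have := Finset.single_le_sum (f := fun i => (u i).totalDegree) (fun _ _ => Nat.zero_le _)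
        (Finset.mem_univ i)
      omega
    · simp [map_sum, hu, b.sum_repr]
  let φn : VV k n →ₗ[k] T := φ.comp (Submodule.subtype _)
  have hφn : LinearMap.range φn = ⊤ := by
    rw [LinearMap.range_eq_top]
    intro t
    obtain ⟨u, hu, rfl⟩ := hn t
    exact ⟨⟨u, hu⟩, rfl⟩
  have e1 := LinearMap.finrank_range_add_finrank_ker φn
  rw [hφn, finrank_top, finrank_V] at e1
  let ψ : (VV k (n - d) × VV k (n - D)) →ₗ[k] VV k n :=
    LinearMap.coprod (mulV f (n - d) n (by omega)) (mulV g (n - D) n (by omega))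
  have hψ : LinearMap.range ψ ≤ LinearMap.ker φn := by
    rintro _ ⟨⟨u, v⟩, rfl⟩
    simp [ψ, φn, h1, h2]
  have e2 := LinearMap.finrank_range_add_finrank_ker ψ
  rw [Module.finrank_prod, finrank_V, finrank_V] at e2
  have e3 := Submodule.finrank_mono hψ
  -- kernel of ψ
  have e4 : Module.finrank k (LinearMap.ker ψ) ≤ (tri (n - d - D)).card := by
    let χ : VV k (n - d - D) →ₗ[k] (VV k (n - d) × VV k (n - D)) :=
      LinearMap.prod (-(mulV g (n - d - D) (n - d) (by omega)))
        (mulV f (n - d - D) (n - D) (by omega))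
    have : LinearMap.ker ψ ≤ LinearMap.range χ := by
      rintro ⟨⟨u, hu⟩, ⟨v, hv⟩⟩ huv
      have huv' : f * u + g * v = 0 := by
        have := congrArg Subtype.val (LinearMap.mem_ker.1 huv)
        simpa [ψ] using this
      have hp : Prime f := hf.prime
      have : f ∣ g * v := ⟨-u, by linear_combination huv'⟩
      obtain ⟨w, rfl⟩ := (hp.dvd_or_dvd this).resolve_left hg
      have hu' : u = - (g * w) := by
        have : f * (u + g * w) = 0 := by linear_combination huv'
        have := (mul_eq_zero.1 this).resolve_left hf0
        linear_combination this
      have hw : w ∈ VV k (n - d - D) := by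
        by_cases hw0 : w = 0
        · rw [hw0]; exact Submodule.zero_mem _
        · rw [mem_restrictTotalDegree] at hv ⊢
          rw [totalDegree_mul_of_isDomain hf0 hw0] at hv
          omega
      refine ⟨⟨w, hw⟩, ?_⟩
      ext1
      · apply Subtype.ext; simp [χ, hu']
      · apply Subtype.ext; simp [χ]
    calc _ ≤ _ := Submodule.finrank_mono this
      _ ≤ _ := LinearMap.finrank_range_le χ
      _ = _ := finrank_V _
  obtain ⟨e, rfl⟩ : ∃ e, n = d + D + e := ⟨n - d - D, by omega⟩
  have c1 := card_tri (d + D + e)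
  have c2 := card_tri (D + e)
  have c3 := card_tri (d + e)
  have c4 := card_tri e
  rw [show d + D + e - d - D = e by omega] at e4
  have t1 : tri (d + D + e - d) = tri (D + e) := by congr 1; omega
  have t2 : tri (d + D + e - D) = tri (d + e) := by congr 1; omega
  rw [t1, t2] at e2
  nlinarith
end
end PCB

-- Module M2

namespace PCB
open MvPolynomial

section
variable {k : Type*} [CommRing k]

/-- The derivation `f_y ∂x - f_x ∂y`, tangent to `f = 0`. -/
noncomputable def del (f : MvPolynomial (Fin 2) k) :
    Derivation k (MvPolynomial (Fin 2) k) (MvPolynomial (Fin 2) k) :=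
  (pderiv 1 f) • (pderiv 0) - (pderiv 0 f) • (pderiv 1)

lemma del_apply (f h : MvPolynomial (Fin 2) k) :
    del f h = pderiv 1 f * pderiv 0 h - pderiv 0 f * pderiv 1 h := by
  simp [del]

lemma del_self (f : MvPolynomial (Fin 2) k) : del f f = 0 := by
  rw [del_apply]; ring

lemma del_mul (f a b : MvPolynomial (Fin 2) k) :
    del f (a * b) = a * del f b + b * del f a := by
  simp [Derivation.leibniz]

lemma del_iter_self_mul (f h : MvPolynomial (Fin 2) k) (j : ℕ) :
    (del f)^[j] (f * h) = f * (del f)^[j] h := by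
  induction j with
  | zero => rfl
  | succ j ih =>
    rw [Function.iterate_succ_apply', ih, Function.iterate_succ_apply', del_mul, del_self]; ring

/-- iterated `del` as a linear map -/
noncomputable def delL (f : MvPolynomial (Fin 2) k) (j : ℕ) :
    MvPolynomial (Fin 2) k →ₗ[k] MvPolynomial (Fin 2) k := ((del f).toLinearMap) ^ j

lemma delL_apply (f h : MvPolynomial (Fin 2) k) (j : ℕ) : delL f j h = (del f)^[j] h := by
  rw [delL, Module.End.pow_apply]; rfl

lemma delL_zero (f h : MvPolynomial (Fin 2) k) : delL f 0 h = h := by simp [delL_apply]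

lemma delL_succ (f h : MvPolynomial (Fin 2) k) (j : ℕ) : delL f (j + 1) h = delL f j (del f h) := by
  simp [delL_apply]

lemma delL_succ' (f h : MvPolynomial (Fin 2) k) (j : ℕ) : delL f (j + 1) h = del f (delL f j h) := by
  simp only [delL_apply, Function.iterate_succ_apply']

lemma delL_self_mul (f h : MvPolynomial (Fin 2) k) (j : ℕ) :
    delL f j (f * h) = f * delL f j h := by
  simp only [delL_apply, del_iter_self_mul]

lemma vanish_mul (f : MvPolynomial (Fin 2) k) (P : Fin 2 → k) (j : ℕ) :
    ∀ g h, (∀ i ≤ j, eval P (delL f i g) = 0) → eval P (delL f j (g * h)) = 0 := by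
  induction j with
  | zero => intro g h hg; have := hg 0 le_rfl; simp only [delL_zero] at *; simp [this]
  | succ j ih =>
    intro g h hg
    rw [delL_succ, del_mul, map_add, map_add, ih g _ (fun i hi => hg i (by omega)), mul_comm h,
      ih (del f g) h (fun i hi => by rw [← delL_succ]; exact hg _ (by omega)), add_zero]

lemma vanish_pow (f l : MvPolynomial (Fin 2) k) (P : Fin 2 → k) (hl : eval P l = 0) (i : ℕ) :
    ∀ j u, i < j → eval P (delL f i (l ^ j * u)) = 0 := by
  induction i with
  | zero => intro j u hj; simp [delL_zero, hl, zero_pow (by omega : j ≠ 0)]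
  | succ i ih =>
    intro j u hj
    obtain ⟨j, rfl⟩ : ∃ j', j = j' + 1 := ⟨j - 1, by omega⟩
    have : del f (l ^ (j + 1) * u) = l ^ j * ((j + 1 : ℕ) * u * del f l + l * del f u) := by
      rw [del_mul, Derivation.leibniz_pow]; simp; ring
    rw [delL_succ, this]
    exact ih _ _ (by omega)

lemma leading_pow (f l : MvPolynomial (Fin 2) k) (P : Fin 2 → k) (hl : eval P l = 0) (j : ℕ) :
    ∀ u, eval P (delL f j (l ^ j * u)) = (j.factorial : k) * (eval P (del f l)) ^ j * eval P u := by
  induction j with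
  | zero => intro u; simp [delL_zero]
  | succ j ih =>
    intro u
    have : del f (l ^ (j + 1) * u) = l ^ j * ((j + 1 : ℕ) * u * del f l + l * del f u) := by
      rw [del_mul, Derivation.leibniz_pow]; simp; ring
    rw [delL_succ, this, ih]
    simp [hl, Nat.factorial_succ]; ring
end

section
variable {k : Type*} [Field k]

/-- jets along the curve -/
noncomputable def jet (f : MvPolynomial (Fin 2) k) (Z : Finset (Fin 2 → k)) (m : ℕ) :
    MvPolynomial (Fin 2) k →ₗ[k] (Z × Fin m → k) :=
  LinearMap.pi fun q => (aeval (R := k) (q.1 : Fin 2 → k)).toLinearMap.comp (delL f q.2)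

lemma jet_apply (f : MvPolynomial (Fin 2) k) (Z : Finset (Fin 2 → k)) (m : ℕ) (h) (q) :
    jet f Z m h q = eval (q.1 : Fin 2 → k) (delL f q.2 h) := by
  simp [jet, aeval_eq_eval]

lemma exists_sep {Z : Finset (Fin 2 → k)} (P : Fin 2 → k) :
    ∃ h : MvPolynomial (Fin 2) k, (∀ Q ∈ Z, Q ≠ P → eval Q h = 0) ∧ eval P h ≠ 0 := by
  classical
  have : ∀ Q : Fin 2 → k, ∃ l : MvPolynomial (Fin 2) k, (Q ≠ P → eval Q l = 0) ∧ eval P l ≠ 0 := by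
    intro Q
    by_cases h : Q = P
    · exact ⟨1, by simp [h]⟩
    · obtain ⟨i, hi⟩ : ∃ i, Q i ≠ P i := by
        by_contra hh; push Not at hh; exact h (funext hh)
      exact ⟨X i - C (Q i), by simp, by simpa [sub_eq_zero] using hi.symm⟩
  choose l h1 h2 using this
  refine ⟨∏ Q ∈ Z, l Q, fun Q hQ hQP => ?_, ?_⟩
  · rw [map_prod]; exact Finset.prod_eq_zero hQ (h1 Q hQP)
  · rw [map_prod]; exact Finset.prod_ne_zero_iff.2 fun Q _ => h2 Q

theorem jet_surjective (f : MvPolynomial (Fin 2) k) (Z : Finset (Fin 2 → k)) (m : ℕ)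
    (hZ : ∀ P ∈ Z, ∀ j < m, (j.factorial : k) * (eval P (pderiv 1 f)) ^ j ≠ 0) :
    Function.Surjective (jet f Z m) := by
  classical
  rw [← LinearMap.range_eq_top]
  have key : ∀ n : ℕ, ∀ q : Z × Fin m, m ≤ n + q.2 → Pi.single q 1 ∈ LinearMap.range (jet f Z m) := by
    intro n
    induction n with
    | zero => intro q hq; have := q.2.2; omega
    | succ n ih =>
      rintro ⟨⟨P, hP⟩, j⟩ hq
      obtain ⟨h, h1, h2⟩ := exists_sep (Z := Z) P
      set l : MvPolynomial (Fin 2) k := X 0 - C (P 0)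
      have hl : eval P l = 0 := by simp [l]
      have hdl : eval P (del f l) = eval P (pderiv 1 f) := by
        simp [del_apply, l, pderiv_X]
      set u := l ^ (j : ℕ) * h ^ m
      set q₀ : Z × Fin m := (⟨P, hP⟩, j)
      have hu0 : jet f Z m u q₀ ≠ 0 := by
        rw [jet_apply]
        simp only [q₀, u]
        rw [leading_pow f l P hl, hdl]
        exact mul_ne_zero (hZ P hP j j.2) (by simpa using pow_ne_zero _ h2)
      have hu1 : jet f Z m u = ∑ q : Z × Fin m, jet f Z m u q • Pi.single q 1 := by
        ext q; simp [Finset.sum_apply, Pi.single_apply]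
      rw [← Finset.add_sum_erase _ _ (Finset.mem_univ q₀)] at hu1
      have hmem : jet f Z m u q₀ • (Pi.single q₀ (1 : k) : Z × Fin m → k)
          ∈ LinearMap.range (jet f Z m) := by
        rw [eq_comm, ← eq_sub_iff_add_eq] at hu1
        rw [hu1]
        refine Submodule.sub_mem _ ⟨u, rfl⟩ (Submodule.sum_mem _ ?_)
        rintro ⟨⟨Q, hQ⟩, i⟩ hq1
        by_cases hQP : Q = P
        · subst hQP
          rcases lt_trichotomy i j with hij | hij | hij
          · have : jet f Z m u (⟨Q, hQ⟩, i) = 0 := by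
              rw [jet_apply]; exact vanish_pow f l Q hl _ _ _ hij
            rw [this, zero_smul]; exact Submodule.zero_mem _
          · exact absurd (by rw [hij]) (Finset.ne_of_mem_erase hq1)
          · refine Submodule.smul_mem _ _ (ih _ ?_)
            have : (j : ℕ) < i := hij
            change m ≤ n + 1 + (j : ℕ) at hq
            change m ≤ n + (i : ℕ)
            omega
        · have : jet f Z m u (⟨Q, hQ⟩, i) = 0 := by
            rw [jet_apply]; simp only [u]; rw [mul_comm]
            exact vanish_pow f h Q (h1 Q hQ hQP) _ _ _ i.2
          rw [this, zero_smul]; exact Submodule.zero_mem _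
      have := Submodule.smul_mem _ (jet f Z m u q₀)⁻¹ hmem
      rwa [smul_smul, inv_mul_cancel₀ hu0, one_smul] at this
  rw [eq_top_iff]
  intro v _
  have hv : v = ∑ q : Z × Fin m, v q • Pi.single q 1 := by
    ext q; simp [Finset.sum_apply, Pi.single_apply]
  rw [hv]
  exact Submodule.sum_mem _ fun q _ => Submodule.smul_mem _ _ (key m q (by omega))

/-- Counting zeros with multiplicity along the curve. -/
theorem count_zeros {f g : MvPolynomial (Fin 2) k} (hf : Irreducible f) (hg : ¬ f ∣ g) {D : ℕ}
    (hD : g.totalDegree ≤ D) (Z : Finset (Fin 2 → k)) (m : ℕ)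
    (hZ : ∀ P ∈ Z, ∀ j < m, (j.factorial : k) * (eval P (pderiv 1 f)) ^ j ≠ 0)
    (hfZ : ∀ P ∈ Z, eval P f = 0)
    (hgZ : ∀ P ∈ Z, ∀ j < m, eval P (delL f j g) = 0) :
    Z.card * m ≤ f.totalDegree * D := by
  have := bezout hf hg hD (jet f Z m) (jet_surjective f Z m hZ) ?_ ?_
  · simpa using this
  · intro h; ext q
    rw [jet_apply, delL_self_mul]; simp [hfZ q.1 q.1.2]
  · intro h; ext q
    rw [jet_apply]
    exact vanish_mul f _ _ g h (fun i hi => hgZ _ q.1.2 i (by have := q.2.2; omega))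

theorem count_points {f g : MvPolynomial (Fin 2) k} (hf : Irreducible f) (hg : ¬ f ∣ g) {D : ℕ}
    (hD : g.totalDegree ≤ D) (Z : Finset (Fin 2 → k))
    (hfZ : ∀ P ∈ Z, eval P f = 0) (hgZ : ∀ P ∈ Z, eval P g = 0) :
    Z.card ≤ f.totalDegree * D := by
  have := count_zeros hf hg hD Z 1 ?_ hfZ ?_
  · simpa using this
  · intro P _ j hj; have : j = 0 := by omega
    simp [this]
  · intro P hP j hj; have : j = 0 := by omega
    rw [this, delL_zero]; exact hgZ P hP
end
end PCB

-- Module M3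

namespace PCB
open MvPolynomial

section
variable {k : Type*} [CommRing k]

lemma totalDegree_pderiv_le {f : MvPolynomial (Fin 2) k} {n : ℕ} (h : f.totalDegree ≤ n + 1)
    (i : Fin 2) : (pderiv i f).totalDegree ≤ n := by
  rw [totalDegree_le_iff'] at h ⊢
  intro m hm
  rw [coeff_pderiv] at hm
  have := h _ (left_ne_zero_of_mul hm)
  fin_cases i <;> simp at this <;> omega

lemma totalDegree_pderiv_le' {f : MvPolynomial (Fin 2) k} {n : ℕ} (h : f.totalDegree ≤ n)
    (i : Fin 2) : (pderiv i f).totalDegree ≤ n :=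
  totalDegree_pderiv_le (by omega) i

lemma totalDegree_delL_le {f h : MvPolynomial (Fin 2) k} {d n : ℕ} (hf : f.totalDegree ≤ d)
    (hh : h.totalDegree ≤ n) (j : ℕ) : (delL f j h).totalDegree ≤ n + j * d := by
  induction j with
  | zero => simpa [delL_zero] using hh
  | succ j ih =>
    rw [delL_succ', del_apply]
    refine (totalDegree_sub _ _).trans (max_le ?_ ?_) <;>
    refine (totalDegree_mul _ _).trans ?_
    · have h1 := totalDegree_pderiv_le' hf 1
      have h2 := totalDegree_pderiv_le' ih 0
      rw [Nat.add_mul]; omega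
    · have h1 := totalDegree_pderiv_le' hf 0
      have h2 := totalDegree_pderiv_le' ih 1
      rw [Nat.add_mul]; omega

/-- The monomial `x^i y^j`. -/
noncomputable abbrev xm (k : Type*) [CommRing k] (q : ℕ × ℕ) : MvPolynomial (Fin 2) k :=
  monomial (mon q) 1

lemma totalDegree_xm_le {q : ℕ × ℕ} {n : ℕ} (h : q.1 + q.2 ≤ n) : (xm k q).totalDegree ≤ n := by
  rw [totalDegree_le_iff']
  intro m hm
  classical
  rw [coeff_monomial] at hm
  split_ifs at hm with h1
  · rw [← h1]; simpa using h
  · simp at hm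

lemma sum_xm_coeff (f : MvPolynomial (Fin 2) k) {n : ℕ} (h : f.totalDegree ≤ n) :
    f = ∑ q ∈ tri n, coeff (mon q) f • xm k q := by
  classical
  ext m
  rw [coeff_sum]
  simp only [coeff_smul, coeff_monomial, smul_eq_mul, mul_ite, mul_one, mul_zero]
  by_cases hm : coeff m f = 0
  · rw [hm, Finset.sum_eq_zero]
    intro q _
    split_ifs with h1
    · rw [h1, hm]
    · rfl
  · rw [totalDegree_le_iff'] at h
    rw [Finset.sum_eq_single (m 0, m 1)]
    · simp [mon_eta]
    · intro q _ hq
      rw [if_neg]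
      rintro rfl
      simp at hq
    · intro hh; exact absurd (mem_tri.2 (h m hm)) hh

lemma coeff_sum_xm (S : Finset (ℕ × ℕ)) (a : ℕ × ℕ → k) (q : ℕ × ℕ) (hq : q ∈ S) :
    coeff (mon q) (∑ b ∈ S, a b • xm k b) = a q := by
  classical
  rw [coeff_sum]
  simp only [coeff_smul, coeff_monomial, smul_eq_mul, mul_ite, mul_one, mul_zero]
  rw [Finset.sum_eq_single q]
  · simp
  · intro b _ hb; rw [if_neg]; exact fun h => hb (mon_injective h)
  · intro h; exact absurd hq h

lemma coeff_sum_xm_ne (S : Finset (ℕ × ℕ)) (a : ℕ × ℕ → k) (m : Fin 2 →₀ ℕ)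
    (hq : coeff m (∑ b ∈ S, a b • xm k b) ≠ 0) : (m 0, m 1) ∈ S := by
  classical
  rw [coeff_sum] at hq
  obtain ⟨b, hb, h⟩ := Finset.exists_ne_zero_of_sum_ne_zero hq
  rw [coeff_smul, coeff_monomial] at h
  split_ifs at h with h1
  · rw [← h1]; simpa using hb
  · simp at h
end

section
variable {k : Type*} [Field k]

lemma not_dvd_low {f e : MvPolynomial (Fin 2) k} {d : ℕ} (hc : coeff (mon (0, d)) f ≠ 0)
    (he0 : e ≠ 0) (he : ∀ m, coeff m e ≠ 0 → m 1 < d) : ¬ f ∣ e := by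
  rintro ⟨h, rfl⟩
  have hf0 : f ≠ 0 := by rintro rfl; simp at hc
  have hh0 : h ≠ 0 := by rintro rfl; simp at he0
  have h1 := degreeOf_mul_eq (n := 1) hf0 hh0
  have h2 : d ≤ degreeOf 1 f := by
    have := monomial_le_degreeOf (1 : Fin 2) (f := f) (m := mon (0, d)) (by simpa [mem_support_iff] using hc)
    simpa using this
  by_cases hd : d = 0
  · subst hd
    obtain ⟨m, hm⟩ := ne_zero_iff.1 he0
    exact absurd (he m hm) (by omega)
  have h3 : degreeOf 1 (f * h) < d := by
    rw [degreeOf_lt_iff (by omega)]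
    intro m hm; exact he m (by simpa [mem_support_iff] using hm)
  omega

/-- Image of `V_L` in `k[x,y]/(f)`. -/
noncomputable abbrev WW (f : MvPolynomial (Fin 2) k) (L : ℕ) :
    Submodule k (MvPolynomial (Fin 2) k ⧸ Ideal.span {f}) :=
  Submodule.map (Ideal.Quotient.mkₐ k (Ideal.span {f})).toLinearMap (VV k L)

lemma WW_le {f : MvPolynomial (Fin 2) k} {d : ℕ} (hd : f.totalDegree ≤ d)
    (hc : coeff (mon (0, d)) f ≠ 0) (L : ℕ) :
    WW f L ≤ Submodule.span k (Set.range fun q : low d L => Ideal.Quotient.mk (Ideal.span {f}) (xm k q)) := by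
  set S := Submodule.span k (Set.range fun q : low d L => Ideal.Quotient.mk (Ideal.span {f}) (xm k q))
  have key : ∀ j i : ℕ, i + j ≤ L → Ideal.Quotient.mk (Ideal.span {f}) (xm k (i, j)) ∈ S := by
    intro j
    induction j using Nat.strong_induction_on with
    | _ j ih =>
      intro i hij
      by_cases hj : j < d
      · exact Submodule.subset_span ⟨⟨(i, j), mem_low.2 ⟨hij, hj⟩⟩, rfl⟩
      · set c := coeff (mon (0, d)) f
        have hmem : (0, d) ∈ tri d := by simp [mem_tri]
        have hsum := sum_xm_coeff f hd
        rw [← Finset.add_sum_erase _ _ hmem] at hsum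
        have h0 : Ideal.Quotient.mk (Ideal.span {f}) (f * xm k (i, j - d)) = 0 := by
          rw [Ideal.Quotient.eq_zero_iff_mem]
          exact Ideal.mul_mem_right _ _ (Ideal.mem_span_singleton_self f)
        have h1 : f * xm k (i, j - d) = c • xm k (i, j)
            + ∑ q ∈ (tri d).erase (0, d), coeff (mon q) f • xm k (q.1 + i, q.2 + (j - d)) := by
          conv_lhs => rw [hsum]
          rw [add_mul, Finset.sum_mul]
          congr 1
          · rw [smul_mul_assoc, monomial_mul, ← mon_add, one_mul]
            have : ((0, d) + (i, j - d) : ℕ × ℕ) = (i, j) := Prod.ext (by simp) (by simp; omega)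
            rw [this]
          · refine Finset.sum_congr rfl fun q _ => ?_
            rw [smul_mul_assoc, monomial_mul, ← mon_add, one_mul]; rfl
        rw [h1, map_add] at h0
        have h2 : c • Ideal.Quotient.mk (Ideal.span {f}) (xm k (i, j)) =
            - Ideal.Quotient.mk (Ideal.span {f}) (∑ q ∈ (tri d).erase (0, d), coeff (mon q) f • xm k (q.1 + i, q.2 + (j - d))) := by
          rw [← eq_neg_iff_add_eq_zero] at h0
          rw [← h0]; rfl
        have h3 : c • Ideal.Quotient.mk (Ideal.span {f}) (xm k (i, j)) ∈ S := by
          rw [h2, map_sum]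
          refine Submodule.neg_mem _ (Submodule.sum_mem _ fun q hq => ?_)
          have hq1 := Finset.ne_of_mem_erase hq
          have hq2 := mem_tri.1 (Finset.mem_of_mem_erase hq)
          have hq3 : q.2 < d := by
            by_contra h
            exact hq1 (Prod.ext (by simp; omega) (by simp; omega))
          exact Submodule.smul_mem S (coeff (mon q) f) (ih _ (by omega) _ (by omega))
        have := Submodule.smul_mem S c⁻¹ h3
        rwa [smul_smul, inv_mul_cancel₀ hc, one_smul] at this
  rintro _ ⟨u, hu, rfl⟩
  have hu' := (mem_restrictTotalDegree _ _ _).1 hu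
  rw [sum_xm_coeff u hu', map_sum]
  refine Submodule.sum_mem _ fun q hq => ?_
  rw [map_smul]
  exact Submodule.smul_mem _ _ (key _ _ (mem_tri.1 hq))

lemma finrank_WW_le {f : MvPolynomial (Fin 2) k} {d : ℕ} (hd : f.totalDegree ≤ d)
    (hc : coeff (mon (0, d)) f ≠ 0) (L : ℕ) :
    Module.finrank k (WW f L) ≤ d * (L + 1) := by
  have h1 := WW_le hd hc L
  have : Module.Finite k (Submodule.span k (Set.range fun q : low d L => Ideal.Quotient.mk (Ideal.span {f}) (xm k q))) :=
    Module.Finite.span_of_finite k (Set.finite_range _)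
  refine (Submodule.finrank_mono h1).trans ?_
  have := finrank_range_le_card (R := k) (fun q : low d L => Ideal.Quotient.mk (Ideal.span {f}) (xm k q))
  rw [Set.finrank] at this
  refine this.trans ?_
  rw [Fintype.card_coe]
  exact card_low_le d L
end
end PCB

-- Module M4
namespace PCB
open MvPolynomial

section
variable {p : ℕ} [Fact p.Prime]

lemma del_ppow (f e : MvPolynomial (Fin 2) (ZMod p)) : del f (e ^ p) = 0 := by
  rw [Derivation.leibniz_pow]
  simp

lemma delL_mul_ppow (f b e : MvPolynomial (Fin 2) (ZMod p)) (j : ℕ) :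
    delL f j (b * e ^ p) = delL f j b * e ^ p := by
  induction j with
  | zero => simp [delL_zero]
  | succ j ih => rw [delL_succ', ih, del_mul, del_ppow, delL_succ']; ring

lemma dvd_delL {k : Type*} [Field k] {f g : MvPolynomial (Fin 2) k} (h : f ∣ g) (j : ℕ) : f ∣ delL f j g := by
  obtain ⟨h, rfl⟩ := h
  rw [delL_self_mul]; exact dvd_mul_right _ _

lemma stepanov_jets {f : MvPolynomial (Fin 2) (ZMod p)} {d : ℕ} (hf : Irreducible f)
    (hd : f.totalDegree ≤ d) (hc : coeff (mon (0, d)) f ≠ 0) {A : ℕ} (hA : d * A < p)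
    (P : Fin 2 → ZMod p) (hP : eval P f = 0) (hP' : eval P (pderiv 1 f) ≠ 0)
    (E : low d A → MvPolynomial (Fin 2) (ZMod p))
    (hE : f ∣ ∑ b : low d A, xm (ZMod p) b * E b ^ p) (b : low d A) : f ∣ E b := by
  classical
  -- the jet map
  let J : (low d A → ZMod p) →ₗ[ZMod p] (Fin p → ZMod p) :=
    LinearMap.pi fun j => (aeval (R := ZMod p) P).toLinearMap.comp ((delL f j).comp
      (Fintype.linearCombination (ZMod p) (fun b : low d A => xm (ZMod p) b)))
  have hJ : ∀ a j, J a j = eval P (delL f j (∑ b : low d A, a b • xm (ZMod p) b)) := by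
    intro a j
    simp [J, Fintype.linearCombination_apply, aeval_eq_eval]
  have hJinj : LinearMap.ker J = ⊥ := by
    rw [LinearMap.ker_eq_bot']
    intro a ha
    by_contra ha0
    set g := ∑ b : low d A, a b • xm (ZMod p) b with hg
    let a' : ℕ × ℕ → ZMod p := fun q => if h : q ∈ low d A then a ⟨q, h⟩ else 0
    have hg' : g = ∑ q ∈ low d A, a' q • xm (ZMod p) q := by
      rw [← Finset.sum_coe_sort, hg]
      refine Finset.sum_congr rfl fun q _ => ?_
      simp [a']
    have hg0 : g ≠ 0 := by
      intro h0
      apply ha0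
      funext q
      have := coeff_sum_xm (low d A) a' q q.2
      rw [← hg', h0] at this
      simpa [a'] using this.symm
    have hndvd : ¬ f ∣ g := by
      refine not_dvd_low hc hg0 fun m hm => ?_
      rw [hg'] at hm
      have := coeff_sum_xm_ne _ _ _ hm
      exact (mem_low.1 this).2
    have hgd : g.totalDegree ≤ A := by
      rw [totalDegree_le_iff']
      intro m hm
      rw [hg'] at hm
      have := coeff_sum_xm_ne _ _ _ hm
      exact (mem_low.1 this).1
    have := count_zeros hf hndvd hgd {P} p ?_ (by simpa using hP) ?_
    · simp only [Finset.card_singleton, one_mul] at this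
      have h2 := Nat.mul_le_mul_right A hd
      omega
    · intro Q hQ j hj
      rw [Finset.mem_singleton.1 hQ]
      refine mul_ne_zero ?_ (pow_ne_zero _ hP')
      rw [Ne, ZMod.natCast_eq_zero_iff, (Fact.out : p.Prime).dvd_factorial]
      omega
    · intro Q hQ j hj
      rw [Finset.mem_singleton.1 hQ]
      have := congrFun ha ⟨j, hj⟩
      rw [hJ] at this
      exact this
  obtain ⟨Y, hY⟩ := J.exists_leftInverse_of_injective hJinj
  let S : Matrix (low d A) (low d A) (MvPolynomial (Fin 2) (ZMod p)) := fun b' b =>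
    ∑ j : Fin p, C (Y (Pi.single j 1) b') * delL f j (xm (ZMod p) b)
  have hS : S.map (eval P) = 1 := by
    ext b' b
    rw [Matrix.map_apply]
    simp only [S, map_sum, map_mul, eval_C]
    have h1 := LinearMap.congr_fun hY (Pi.single b 1)
    have h2 : J (Pi.single b 1) = ∑ j : Fin p, eval P (delL f j (xm (ZMod p) b)) • Pi.single j 1 := by
      conv_lhs => rw [pi_eq_sum_univ' (J (Pi.single b 1))]
      refine Finset.sum_congr rfl fun j _ => ?_
      rw [hJ]
      congr 1
      rw [Finset.sum_eq_single b]
      · simp [← Pi.single_smul]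
      · intro c _ hc; simp [Pi.single_apply, hc]
      · simp
    simp only [LinearMap.comp_apply, LinearMap.id_apply] at h1
    rw [h2, map_sum] at h1
    have h3 := congrFun h1 b'
    simp only [Finset.sum_apply, map_smul, Pi.smul_apply, smul_eq_mul] at h3
    rw [Matrix.one_apply]
    rw [Pi.single_apply] at h3
    rw [← h3]
    exact Finset.sum_congr rfl fun j _ => mul_comm _ _
  have hdet : ¬ f ∣ S.det := by
    rintro ⟨h, hh⟩
    have h1 : eval P S.det = 1 := by
      rw [RingHom.map_det, RingHom.mapMatrix_apply, hS, Matrix.det_one]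
    rw [hh, map_mul, hP, zero_mul] at h1
    exact zero_ne_one h1
  have hj : ∀ j, f ∣ ∑ b : low d A, delL f j (xm (ZMod p) b) * E b ^ p := by
    intro j
    have := dvd_delL hE j
    rw [map_sum] at this
    simpa only [delL_mul_ppow] using this
  have hSE : ∀ b', f ∣ (S.mulVec fun b => E b ^ p) b' := by
    intro b'
    have : (S.mulVec fun b => E b ^ p) b' =
        ∑ j : Fin p, C (Y (Pi.single j 1) b') * ∑ b : low d A, delL f j (xm (ZMod p) b) * E b ^ p := by
      simp only [Matrix.mulVec, dotProduct, S, Finset.sum_mul, Finset.mul_sum]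
      rw [Finset.sum_comm]
      simp only [mul_assoc]
    rw [this]
    exact Finset.dvd_sum fun j _ => Dvd.dvd.mul_left (hj j) _
  have hfin : f ∣ S.det * E b ^ p := by
    have h1 : (S.adjugate.mulVec (S.mulVec fun b => E b ^ p)) b = S.det * E b ^ p := by
      rw [Matrix.mulVec_mulVec, Matrix.adjugate_mul, Matrix.smul_mulVec, Matrix.one_mulVec]
      simp
    rw [← h1]
    exact Finset.dvd_sum fun j _ => Dvd.dvd.mul_left (hSE j) _
  have hp : Prime f := hf.prime
  exact hp.dvd_of_dvd_pow ((hp.dvd_or_dvd hfin).resolve_left hdet)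

end
end PCB

-- Module M4b
namespace PCB
open MvPolynomial

section
variable {p : ℕ} [Fact p.Prime]

lemma stepanov_exists {f : MvPolynomial (Fin 2) (ZMod p)} {d : ℕ}
    (hd : f.totalDegree ≤ d) (hc : coeff (mon (0, d)) f ≠ 0) {A k₀ m : ℕ}
    (hdim : 2 * m * (d * (A + k₀ + 1)) + d * d * (m * m) < 2 * (low d A).card * (low d k₀).card) :
    ∃ c : low d A × low d k₀ → ZMod p, c ≠ 0 ∧ ∀ j < m,
      f ∣ ∑ b : low d A, delL f j (xm (ZMod p) b) * ∑ e : low d k₀, c (b, e) • xm (ZMod p) e := by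
  classical
  let T : ℕ → (low d A × low d k₀ → ZMod p) →ₗ[ZMod p] MvPolynomial (Fin 2) (ZMod p) := fun j =>
    Fintype.linearCombination (ZMod p) (fun q : low d A × low d k₀ => delL f j (xm (ZMod p) q.1) * xm (ZMod p) q.2)
  have hT : ∀ j c, T j c = ∑ b : low d A, delL f j (xm (ZMod p) b) * ∑ e : low d k₀, c (b, e) • xm (ZMod p) e := by
    intro j c
    simp only [T, Fintype.linearCombination_apply]
    rw [Fintype.sum_prod_type]
    refine Finset.sum_congr rfl fun b _ => ?_
    rw [Finset.mul_sum]
    refine Finset.sum_congr rfl fun e _ => ?_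
    rw [mul_smul_comm]
  have hTd : ∀ j c, T j c ∈ VV (ZMod p) (A + k₀ + j * d) := by
    intro j c
    simp only [T, Fintype.linearCombination_apply]
    refine Submodule.sum_mem _ fun q _ => Submodule.smul_mem _ _ ?_
    rw [mem_restrictTotalDegree]
    refine (totalDegree_mul _ _).trans ?_
    have h1 := totalDegree_delL_le hd (totalDegree_xm_le (k := ZMod p) (mem_low.1 q.1.2).1) j
    have h2 := totalDegree_xm_le (k := ZMod p) (mem_low.1 q.2.2).1
    omega
  let Φ : (low d A × low d k₀ → ZMod p) →ₗ[ZMod p] ((j : Fin m) → WW f (A + k₀ + j * d)) :=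
    LinearMap.pi fun j => (((Ideal.Quotient.mkₐ (ZMod p) (Ideal.span {f})).toLinearMap.comp (T j)).codRestrict
      (WW f (A + k₀ + j * d)) (fun c => Submodule.mem_map_of_mem (hTd j c)))
  have hfin : ∀ L, Module.Finite (ZMod p) (WW f L) := fun L => inferInstance
  have hker : LinearMap.ker Φ ≠ ⊥ := by
    apply LinearMap.ker_ne_bot_of_finrank_lt
    rw [Module.finrank_pi_fintype, Module.finrank_fintype_fun_eq_card, Fintype.card_prod,
      Fintype.card_coe, Fintype.card_coe]
    have h1 : ∑ j : Fin m, Module.finrank (ZMod p) (WW f (A + k₀ + j * d)) ≤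
        ∑ j : Fin m, (d * (A + k₀ + 1) + d * d * (j : ℕ)) := by
      refine Finset.sum_le_sum fun j _ => (finrank_WW_le hd hc _).trans ?_
      apply le_of_eq; ring
    have h2 : 2 * ∑ j : Fin m, (d * (A + k₀ + 1) + d * d * (j : ℕ)) ≤
        2 * m * (d * (A + k₀ + 1)) + d * d * (m * m) := by
      rw [Finset.sum_add_distrib, ← Finset.mul_sum _ _ (d * d), Fin.sum_univ_eq_sum_range (fun i => i)]
      have h3 := Finset.sum_range_id_mul_two m
      have h4 : (∑ i ∈ Finset.range m, i) * 2 ≤ m * m := by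
        rw [h3]; exact Nat.mul_le_mul_left _ (Nat.sub_le _ _)
      simp only [Finset.sum_const, Finset.card_univ, Fintype.card_fin, smul_eq_mul]
      nlinarith [Nat.zero_le (d * d)]
    nlinarith
  obtain ⟨c, hc1, hc0⟩ := Submodule.exists_mem_ne_zero_of_ne_bot hker
  refine ⟨c, hc0, fun j hj => ?_⟩
  have h1 := congrArg Subtype.val (congrFun (LinearMap.mem_ker.1 hc1) ⟨j, hj⟩)
  rw [← hT]
  have h2 : Ideal.Quotient.mk (Ideal.span {f}) (T j c) = 0 := h1
  rwa [Ideal.Quotient.eq_zero_iff_mem, Ideal.mem_span_singleton] at h2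

theorem stepanov_param {f : MvPolynomial (Fin 2) (ZMod p)} {d : ℕ} (hf : Irreducible f)
    (hd : f.totalDegree ≤ d) (hc : coeff (mon (0, d)) f ≠ 0) {A k₀ m : ℕ} (hA : d * A < p) (hm : m ≤ p)
    (hdim : 2 * m * (d * (A + k₀ + 1)) + d * d * (m * m) < 2 * (low d A).card * (low d k₀).card)
    (Z : Finset (Fin 2 → ZMod p)) (hZ : ∀ P ∈ Z, eval P f = 0 ∧ eval P (pderiv 1 f) ≠ 0) :
    Z.card * m ≤ d * (A + p * k₀) := by
  classical
  rcases Z.eq_empty_or_nonempty with rfl | ⟨P, hP⟩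
  · simp
  obtain ⟨c, hc0, hcj⟩ := stepanov_exists hd hc hdim
  set E : low d A → MvPolynomial (Fin 2) (ZMod p) := fun b => ∑ e : low d k₀, c (b, e) • xm (ZMod p) e with hEdef
  set G := ∑ b : low d A, xm (ZMod p) b * E b ^ p with hG
  have hEd : ∀ b, (E b).totalDegree ≤ k₀ := by
    intro b
    rw [← mem_restrictTotalDegree]
    refine Submodule.sum_mem _ fun q _ => Submodule.smul_mem _ _ ?_
    rw [mem_restrictTotalDegree]
    exact totalDegree_xm_le (mem_low.1 q.2).1
  have hGd : G.totalDegree ≤ A + p * k₀ := by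
    rw [← mem_restrictTotalDegree]
    refine Submodule.sum_mem _ fun q _ => ?_
    rw [mem_restrictTotalDegree]
    refine (totalDegree_mul _ _).trans (add_le_add (totalDegree_xm_le (mem_low.1 q.2).1) ?_)
    exact (totalDegree_pow _ _).trans (Nat.mul_le_mul_left _ (hEd q))
  have hndvd : ¬ f ∣ G := by
    intro hdiv
    apply hc0
    funext ⟨b, e⟩
    have h1 := stepanov_jets hf hd hc hA P (hZ P hP).1 (hZ P hP).2 E hdiv b
    let a' : ℕ × ℕ → ZMod p := fun q => if h : q ∈ low d k₀ then c (b, ⟨q, h⟩) else 0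
    have hg' : E b = ∑ q ∈ low d k₀, a' q • xm (ZMod p) q := by
      rw [← Finset.sum_coe_sort, hEdef]
      refine Finset.sum_congr rfl fun q _ => ?_
      simp [a']
    have h0 : E b = 0 := by
      by_contra hne
      refine not_dvd_low hc hne (fun m hm => ?_) h1
      rw [hg'] at hm
      exact (mem_low.1 (coeff_sum_xm_ne _ _ _ hm)).2
    have := coeff_sum_xm (low d k₀) a' e e.2
    rw [← hg', h0] at this
    simpa [a'] using this.symm
  have := count_zeros hf hndvd hGd Z m ?_ (fun P hP => (hZ P hP).1) ?_
  · exact this.trans (Nat.mul_le_mul_right _ hd)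
  · intro Q hQ j hj
    refine mul_ne_zero ?_ (pow_ne_zero _ (hZ Q hQ).2)
    rw [Ne, ZMod.natCast_eq_zero_iff, (Fact.out : p.Prime).dvd_factorial]
    omega
  · intro Q hQ j hj
    rw [hG, map_sum, map_sum]
    obtain ⟨h, hh⟩ := hcj j hj
    have h2 := congrArg (eval Q) hh
    rw [map_mul, (hZ Q hQ).1, zero_mul, map_sum] at h2
    rw [← h2]
    refine Finset.sum_congr rfl fun b _ => ?_
    rw [delL_mul_ppow, map_mul, map_pow, ZMod.pow_card, map_mul]

lemma stepanov_num {d p m A q cA ck : ℕ} (hd1 : 1 ≤ d) (hp : 64 * d ^ 4 ≤ p) (hmm : m * m ≤ p)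
    (hm8 : 8 * d ^ 2 ≤ m) (hA1 : d * A + 1 ≤ p) (hA2 : p ≤ d * A + d) (hq1 : d * q ≤ m)
    (hq2 : m + 1 ≤ d * q + d) (hlA : 2 * cA + d * d = d * (2 * A + 3))
    (hlk : 2 * ck + d * d = d * (2 * (q + 3 * d) + 3)) :
    2 * m * (d * (A + (q + 3 * d) + 1)) + d * d * (m * m) < 2 * cA * ck := by
  zify at *
  set a : ℤ := d * A
  set b : ℤ := d * q
  have e1 : (2 * cA : ℤ) = 2 * a + 3 * d - d * d := by linarith
  have e2 : (2 * ck : ℤ) = 2 * b + 6 * d * d + 3 * d - d * d := by linarith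
  have h1 : (2 * p - (d : ℤ) ^ 2) ≤ 2 * cA := by nlinarith
  have h2 : (2 * m + 5 * (d : ℤ) ^ 2) ≤ 2 * ck := by nlinarith
  have h3 : (2 * p - (d : ℤ) ^ 2) * (2 * m + 5 * (d : ℤ) ^ 2) ≤ (2 * cA) * (2 * ck) := by
    apply mul_le_mul h1 h2
    · positivity
    · positivity
  have hD : (1 : ℤ) ≤ (d : ℤ) ^ 2 := by nlinarith
  have hmD : 9 * (m : ℤ) * d ^ 2 ≤ p * d ^ 2 + d ^ 2 * m := by
    have : 8 * (m : ℤ) ≤ p := by nlinarith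
    nlinarith
  have h4 : 2 * (m : ℤ) * (d * (A + (q + 3 * d) + 1)) + d * d * (m * m) ≤
     2 * m * (p + m + 3 * d ^ 2 + d) + d ^ 2 * p := by
    have e : (d : ℤ) * (A + (q + 3 * d) + 1) = a + b + 3 * d ^ 2 + d := by simp only [a, b]; ring
    rw [e]
    have : (d : ℤ) * d * (m * m) ≤ d ^ 2 * p := by rw [← sq]; gcongr
    have : 2 * (m : ℤ) * (a + b + 3 * d ^ 2 + d) ≤ 2 * m * (p + m + 3 * d ^ 2 + d) := by gcongr; linarith
    linarith
  have h5 : 2 * (m : ℤ) * (p + m + 3 * d ^ 2 + d) + d ^ 2 * p ≤ 2 * m * p + 2 * p + 8 * m * d ^ 2 + d ^ 2 * p := by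
    have i1 : (d : ℤ) ≤ d ^ 2 := by nlinarith
    have i2 : (m : ℤ) * d ≤ m * d ^ 2 := mul_le_mul_of_nonneg_left i1 (by positivity)
    linarith
  have h7 : (d : ℤ) ^ 2 * d ^ 2 * 64 ≤ p := by
    have h6 : (d : ℤ) ^ 4 = d ^ 2 * d ^ 2 := by ring
    linarith
  have h8 : (p : ℤ) ≤ p * d ^ 2 := le_mul_of_one_le_right (by positivity) hD
  have h9 : 0 < (p : ℤ) := by nlinarith
  have h10 : (d : ℤ) ^ 2 * d ^ 2 = d ^ 4 := by ring
  have h11 : (2 * p - (d : ℤ) ^ 2) * (2 * m + 5 * (d : ℤ) ^ 2) =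
    4 * (p * m) + 10 * (p * d ^ 2) - 2 * (m * d ^ 2) - 5 * (d ^ 2 * d ^ 2) := by ring
  have h12 : 2 * ((cA : ℤ) * ck) * 2 = (2 * cA) * (2 * ck) := by ring
  linarith

/-- Stepanov bound -/
theorem stepanov {f : MvPolynomial (Fin 2) (ZMod p)} {d : ℕ} (hf : Irreducible f)
    (hd1 : 1 ≤ d) (hd : f.totalDegree ≤ d) (hc : coeff (mon (0, d)) f ≠ 0) (hp : 64 * d ^ 4 ≤ p)
    (Z : Finset (Fin 2 → ZMod p)) (hZ : ∀ P ∈ Z, eval P f = 0 ∧ eval P (pderiv 1 f) ≠ 0) :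
    Z.card ≤ p + 8 * d ^ 2 * Nat.sqrt p := by
  set m := Nat.sqrt p with hm
  have hmm : m * m ≤ p := Nat.sqrt_le p
  have hmp : p < (m + 1) * (m + 1) := Nat.lt_succ_sqrt p
  have hm8 : 8 * d ^ 2 ≤ m := by
    rw [hm, Nat.le_sqrt]; calc _ = 64 * d ^ 4 := by ring
      _ ≤ p := hp
  obtain ⟨A, hAdef⟩ : ∃ A, A = (p - 1) / d := ⟨_, rfl⟩
  obtain ⟨q, hqdef⟩ : ∃ q, q = m / d := ⟨_, rfl⟩
  have hd2 : d ≤ d ^ 2 := by nlinarith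
  have hd24 : d ^ 2 ≤ d ^ 4 := Nat.pow_le_pow_right hd1 (by norm_num)
  have hA1 : d * A + 1 ≤ p := by
    have := Nat.mul_div_le (p - 1) d
    rw [hAdef]; omega
  have hA2 : p ≤ d * A + d := by
    have := Nat.lt_mul_div_succ (p - 1) (by omega : 0 < d)
    rw [← hAdef, Nat.mul_add] at this; omega
  have hq1 : d * q ≤ m := by rw [hqdef]; exact Nat.mul_div_le m d
  have hq2 : m + 1 ≤ d * q + d := by
    have := Nat.lt_mul_div_succ m (by omega : 0 < d)
    rw [← hqdef, Nat.mul_add] at this; omega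
  have hdA : d ≤ A + 1 := by
    by_contra h
    have h1 : A + 1 ≤ d := by omega
    have h2 : d * (A + 1) ≤ d * d := Nat.mul_le_mul_left _ h1
    nlinarith
  have hlA := card_low hdA
  have hlk := card_low (d := d) (L := q + 3 * d) (by omega)
  have hstep := stepanov_param hf hd hc (A := A) (k₀ := q + 3 * d) (m := m) (by omega) (by nlinarith) ?_ Z hZ
  · have hm1 : 0 < m := by nlinarith
    by_contra hcon
    push Not at hcon
    have h1 : (p + 8 * d ^ 2 * m + 1) * m ≤ Z.card * m := Nat.mul_le_mul_right _ hcon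
    have h2 : d * (A + p * (q + 3 * d)) ≤ p + p * (m + 3 * d ^ 2) := by
      calc d * (A + p * (q + 3 * d)) = d * A + p * (d * q + 3 * d ^ 2) := by ring
        _ ≤ p + p * (m + 3 * d ^ 2) := by gcongr; omega
    have h3 : p + p * (3 * d ^ 2) ≤ (8 * d ^ 2) * (m * m) := by
      have : p ≤ 2 * (m * m) := by nlinarith
      have := Nat.mul_le_mul_left (d ^ 2) this
      have : p ≤ d ^ 2 * p := Nat.le_mul_of_pos_left _ (by positivity)
      linarith
    have e1 : (p + 8 * d ^ 2 * m + 1) * m = p * m + 8 * d ^ 2 * (m * m) + m := by ring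
    have e2 : p + p * (m + 3 * d ^ 2) = p * m + (p + p * (3 * d ^ 2)) := by ring
    omega
  · exact stepanov_num hd1 hp hmm hm8 hA1 hA2 hq1 hq2 hlA hlk

end
end PCB

-- Module M5
namespace PCB
open MvPolynomial

section
variable {k : Type*}

/-- Ruppert operator -/
noncomputable def Lop [CommRing k] (f g h : MvPolynomial (Fin 2) k) : MvPolynomial (Fin 2) k :=
  f * pderiv 1 g - g * pderiv 1 f - (f * pderiv 0 h - h * pderiv 0 f)

lemma pderiv_comm01 [CommRing k] (f : MvPolynomial (Fin 2) k) :
    pderiv 0 (pderiv 1 f) = pderiv 1 (pderiv 0 f) := by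
  ext m
  simp only [coeff_pderiv]
  rw [add_right_comm]
  simp; ring

variable [Field k]

lemma vanish_lead (f : MvPolynomial (Fin 2) k) (P : Fin 2 → k) (j : ℕ) :
    ∀ g h, (∀ i < j, eval P (delL f i g) = 0) →
      eval P (delL f j (g * h)) = eval P (delL f j g) * eval P h := by
  induction j with
  | zero => intro g h hg; simp [delL_zero]
  | succ j ih =>
    intro g h hg
    rw [delL_succ, del_mul, map_add, map_add, vanish_mul f P j g _ (fun i hi => hg i (by omega)),
      mul_comm h, ih (del f g) h (fun i hi => by rw [← delL_succ]; exact hg _ (by omega)), zero_add,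
      delL_succ]

lemma coeff_pderiv_one (f : MvPolynomial (Fin 2) k) (n : ℕ) :
    coeff (mon (0, n)) (pderiv 1 f) = coeff (mon (0, n + 1)) f * ((n + 1 : ℕ) : k) := by
  rw [coeff_pderiv]
  have : mon (0, n) + Finsupp.single 1 1 = mon (0, n + 1) := by
    ext i; fin_cases i <;> simp
  rw [this]; simp

lemma totalDegree_smul_le' (a : k) (f : MvPolynomial (Fin 2) k) : (a • f).totalDegree ≤ f.totalDegree :=
  totalDegree_smul_le a f

theorem ruppert_zero [CharZero k] {f g h : MvPolynomial (Fin 2) k} {d : ℕ} (hf : Irreducible f) (hd1 : 1 ≤ d)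
    (hd : f.totalDegree ≤ d) (hc : coeff (mon (0, d)) f ≠ 0) (hL : Lop f g h = 0)
    (hg : g.totalDegree ≤ d - 1) (hh : h.totalDegree ≤ d - 1) (hh0 : coeff (mon (0, d - 1)) h = 0)
    (P : Fin 2 → k) (hP : eval P f = 0) (hP' : eval P (pderiv 1 f) ≠ 0) : g = 0 ∧ h = 0 := by
  obtain ⟨e, rfl⟩ : ∃ e, d = e + 1 := ⟨d - 1, by omega⟩
  simp only [Nat.add_sub_cancel] at hg hh hh0
  set l := eval P h / eval P (pderiv 1 f) with hl
  set w := h - C l * pderiv 1 f with hw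
  set D := pderiv 1 g - pderiv 0 h with hD
  have e1 : g * pderiv 1 f = h * pderiv 0 f + f * D := by
    rw [Lop] at hL; rw [hD]; linear_combination -hL
  have e2 := congrArg (pderiv 1) e1
  simp only [map_add, Derivation.leibniz, smul_eq_mul] at e2
  have e3 : pderiv 1 f * del f h = h * del f (pderiv 1 f) +
      f * (pderiv 1 f * pderiv 1 D - D * pderiv 1 (pderiv 1 f)) := by
    rw [del_apply, del_apply, pderiv_comm01]
    have : pderiv 0 h = pderiv 1 g - D := by rw [hD]; ring
    rw [this]
    linear_combination (pderiv 1 f) * e2 - (pderiv 1 (pderiv 1 f)) * e1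
  have e4 : del f w * pderiv 1 f = w * del f (pderiv 1 f) +
      f * (pderiv 1 f * pderiv 1 D - D * pderiv 1 (pderiv 1 f)) := by
    have : del f w = del f h - C l * del f (pderiv 1 f) := by
      rw [hw, map_sub, del_mul, ← MvPolynomial.algebraMap_eq, Derivation.map_algebraMap]; ring
    rw [this, hw]; linear_combination e3
  have hv : ∀ j, ∀ i ≤ j, eval P (delL f i w) = 0 := by
    intro j
    induction j with
    | zero =>
      intro i hi
      obtain rfl : i = 0 := by omega
      rw [delL_zero, hw, hl]; simp; field_simp; ring
    | succ j ih =>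
      intro i hi
      rcases Nat.lt_or_ge i (j + 1) with h1 | h1
      · exact ih i (by omega)
      obtain rfl : i = j + 1 := by omega
      have h2 := congrArg (fun q => eval P (delL f j q)) e4
      simp only [map_add, delL_self_mul, map_mul, hP, zero_mul, add_zero] at h2
      rw [vanish_mul f P j w _ ih, vanish_lead f P j _ _
        (fun i hi => by rw [← delL_succ]; exact ih _ (by omega)), ← delL_succ] at h2
      exact (mul_eq_zero.1 h2).resolve_right hP'
  have hfy := totalDegree_pderiv_le hd 1
  have hwd : w.totalDegree ≤ e := by
    rw [hw, ← smul_eq_C_mul]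
    exact (totalDegree_sub _ _).trans (max_le hh ((totalDegree_smul_le _ _).trans hfy))
  have hdvd : f ∣ w := by
    by_contra hn
    have := count_zeros hf hn hwd {P} ((e + 1) * e + 1) ?_ (by simpa using hP) ?_
    · simp only [Finset.card_singleton, one_mul] at this
      have := Nat.mul_le_mul_right e hd
      omega
    · intro Q hQ j _
      rw [Finset.mem_singleton.1 hQ]
      exact mul_ne_zero (by exact_mod_cast j.factorial_ne_zero) (pow_ne_zero _ hP')
    · intro Q hQ j _
      rw [Finset.mem_singleton.1 hQ]
      exact hv j j le_rfl
  have small : ∀ u : MvPolynomial (Fin 2) k, u.totalDegree ≤ e → f ∣ u → u = 0 := by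
    intro u hu hfu
    by_contra hne
    refine not_dvd_low hc hne (fun m hm => ?_) hfu
    have := totalDegree_le_iff'.1 hu m hm
    omega
  have hw0 := small w hwd hdvd
  have hl0 : l = 0 := by
    have := congrArg (coeff (mon (0, e))) hw0
    rw [hw, coeff_sub, hh0, coeff_C_mul, coeff_pderiv_one, coeff_zero, zero_sub, neg_eq_zero] at this
    have h2 : ((e + 1 : ℕ) : k) ≠ 0 := by exact_mod_cast Nat.succ_ne_zero e
    exact (mul_eq_zero.1 this).resolve_right (mul_ne_zero hc h2)
  have hh1 : h = 0 := by rw [hw, hl0] at hw0; simpa using hw0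
  refine ⟨small g hg ?_, hh1⟩
  have : f ∣ g * pderiv 1 f := by rw [e1, hh1]; simp
  refine (hf.prime.dvd_or_dvd this).resolve_right ?_
  rintro ⟨u, hu⟩
  rw [hu, map_mul, hP, zero_mul] at hP'
  exact hP' rfl

lemma coeff_mul_top {a b : MvPolynomial (Fin 2) k} {m n : ℕ} (ha : a.totalDegree ≤ m) (hb : b.totalDegree ≤ n) :
    coeff (mon (0, m + n)) (a * b) = coeff (mon (0, m)) a * coeff (mon (0, n)) b := by
  classical
  rw [coeff_mul]
  rw [Finset.sum_eq_single (mon (0, m), mon (0, n))]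
  · rintro ⟨u, v⟩ huv hne
    rw [Finset.HasAntidiagonal.mem_antidiagonal] at huv
    by_contra h
    have h1 := totalDegree_le_iff'.1 ha u (left_ne_zero_of_mul h)
    have h2 := totalDegree_le_iff'.1 hb v (right_ne_zero_of_mul h)
    have h3 := DFunLike.congr_fun huv 0
    have h4 := DFunLike.congr_fun huv 1
    simp at h3 h4
    apply hne
    have h5 : u 1 = m := by omega
    have h6 : v 1 = n := by omega
    rw [← mon_eta u, ← mon_eta v, h3.1, h3.2, h5, h6]
  · intro h
    exact absurd (Finset.HasAntidiagonal.mem_antidiagonal.2 (by rw [← mon_add]; simp)) h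

lemma factor_top {f a b : MvPolynomial (Fin 2) k} {d : ℕ} (hf : f = a * b) (hd : f.totalDegree ≤ d)
    (hc : coeff (mon (0, d)) f ≠ 0) : a.totalDegree + b.totalDegree = d ∧
      coeff (mon (0, a.totalDegree)) a ≠ 0 ∧ coeff (mon (0, b.totalDegree)) b ≠ 0 := by
  have hf0 : f ≠ 0 := by rintro h; rw [h] at hc; simp at hc
  have ha0 : a ≠ 0 := by rintro rfl; simp [hf] at hf0
  have hb0 : b ≠ 0 := by rintro rfl; simp [hf] at hf0
  have h1 : f.totalDegree = a.totalDegree + b.totalDegree := by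
    rw [hf, totalDegree_mul_of_isDomain ha0 hb0]
  have h2 : d ≤ f.totalDegree := by
    have := totalDegree_le_iff'.1 (le_refl f.totalDegree) _ hc
    simpa using this
  have h3 : a.totalDegree + b.totalDegree = d := by omega
  refine ⟨h3, ?_⟩
  rw [hf, ← h3, coeff_mul_top le_rfl le_rfl] at hc
  exact ⟨left_ne_zero_of_mul hc, right_ne_zero_of_mul hc⟩

lemma pderiv_ne_of_top {a : MvPolynomial (Fin 2) k} {n : ℕ} (hn : 1 ≤ n) (hc : coeff (mon (0, n)) a ≠ 0)
    (hk : (n : k) ≠ 0) : pderiv 1 a ≠ 0 := by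
  obtain ⟨e, rfl⟩ : ∃ e, n = e + 1 := ⟨n - 1, by omega⟩
  intro h
  have := congrArg (coeff (mon (0, e))) h
  rw [coeff_pderiv_one, coeff_zero] at this
  exact mul_ne_zero hc hk this

theorem ruppert_red {f : MvPolynomial (Fin 2) k} {d : ℕ} (hd1 : 1 ≤ d) (hf : ¬ Irreducible f)
    (hd : f.totalDegree ≤ d) (hc : coeff (mon (0, d)) f ≠ 0) (hk : ∀ j, 1 ≤ j → j ≤ d → (j : k) ≠ 0) :
    ∃ g h : MvPolynomial (Fin 2) k, Lop f g h = 0 ∧ g.totalDegree ≤ d - 1 ∧ h.totalDegree ≤ d - 1 ∧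
      coeff (mon (0, d - 1)) h = 0 ∧ (g ≠ 0 ∨ h ≠ 0) := by
  have hf0 : f ≠ 0 := by rintro h; rw [h] at hc; simp at hc
  have hunit0 : ∀ u : MvPolynomial (Fin 2) k, IsUnit u → u.totalDegree = 0 := by
    intro u hu
    rw [MvPolynomial.isUnit_iff_totalDegree_of_isReduced] at hu
    exact hu.2
  have hunit1 : ∀ u : MvPolynomial (Fin 2) k, u ≠ 0 → u.totalDegree = 0 → IsUnit u := by
    intro u hu0 hu
    rw [totalDegree_eq_zero_iff_eq_C] at hu
    rw [hu]
    refine IsUnit.map C (isUnit_iff_ne_zero.2 fun h => hu0 ?_)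
    rw [hu, h, C_0]
  have hfu : ¬ IsUnit f := by
    intro h
    have h1 := hunit0 f h
    have := totalDegree_le_iff'.1 h1.le _ hc
    simp at this; omega
  obtain ⟨a, ha, b, hab⟩ := WfDvdMonoid.exists_irreducible_factor hfu hf0
  obtain ⟨h1, h2, h3⟩ := factor_top hab hd hc
  have ha1 : 1 ≤ a.totalDegree := by
    by_contra h
    exact ha.not_isUnit (hunit1 a ha.ne_zero (by omega))
  have hb0 : b ≠ 0 := by rintro rfl; simp at h3
  have hb1 : 1 ≤ b.totalDegree := by
    by_contra h
    have : IsUnit b := hunit1 b hb0 (by omega)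
    exact hf (by rw [hab]; exact (irreducible_mul_isUnit this).2 ha)
  have hay := pderiv_ne_of_top ha1 h2 (hk _ ha1 (by omega))
  have hby := pderiv_ne_of_top hb1 h3 (hk _ hb1 (by omega))
  have hady : ∀ i, (pderiv i a).totalDegree ≤ a.totalDegree - 1 := fun i => totalDegree_pderiv_le (by omega) i
  by_cases hdv : a ∣ b
  · obtain ⟨e, he⟩ := hdv
    have he0 : e ≠ 0 := by rintro rfl; simp [he] at hb0
    have hed : b.totalDegree = a.totalDegree + e.totalDegree := by
      rw [he, totalDegree_mul_of_isDomain ha.ne_zero he0]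
    have hdeg : ∀ i, (e * pderiv i a).totalDegree < d - 1 := by
      intro i
      have := hady i
      have := totalDegree_mul e (pderiv i a)
      omega
    refine ⟨e * pderiv 0 a, e * pderiv 1 a, ?_, (hdeg 0).le, (hdeg 1).le, ?_, Or.inr (mul_ne_zero he0 hay)⟩
    · rw [Lop, hab, he]
      simp only [Derivation.leibniz, smul_eq_mul, pderiv_comm01]
      ring
    · by_contra h
      have := totalDegree_le_iff'.1 (le_refl (e * pderiv 1 a).totalDegree) _ h
      have := hdeg 1
      simp at *; omega
  · set l := coeff (mon (0, d - 1)) (b * pderiv 1 a) / coeff (mon (0, d - 1)) (pderiv 1 f) with hl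
    have hfy : coeff (mon (0, d - 1)) (pderiv 1 f) ≠ 0 := by
      rw [coeff_pderiv_one, show d - 1 + 1 = d by omega]
      exact mul_ne_zero hc (hk d hd1 le_rfl)
    have hdeg : ∀ i, (b * pderiv i a - C l * pderiv i f).totalDegree ≤ d - 1 := by
      intro i
      have i1 := hady i
      have i2 := totalDegree_mul b (pderiv i a)
      have i3 : (pderiv i f).totalDegree ≤ d - 1 := totalDegree_pderiv_le (by omega) i
      rw [← smul_eq_C_mul]
      exact (totalDegree_sub _ _).trans (max_le (by omega) ((totalDegree_smul_le _ _).trans i3))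
    refine ⟨b * pderiv 0 a - C l * pderiv 0 f, b * pderiv 1 a - C l * pderiv 1 f, ?_, hdeg 0, hdeg 1, ?_, ?_⟩
    · rw [Lop, hab]
      simp only [map_sub, Derivation.leibniz, smul_eq_mul, map_add, pderiv_comm01, pderiv_C, mul_zero, add_zero]
      ring
    · rw [coeff_sub, coeff_C_mul, hl]; field_simp; simp
    · right
      intro h0
      rw [hab, Derivation.leibniz, smul_eq_mul, smul_eq_mul] at h0
      have e1 : C (1 - l) * (b * pderiv 1 a) = a * (C l * pderiv 1 b) := by
        rw [C_sub, C_1]; linear_combination h0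
      by_cases hl1 : l = 1
      · rw [hl1] at e1
        simp at e1
        rcases e1 with h | h
        · exact ha.ne_zero h
        · exact hby h
      · have h4 : a ∣ C (1 - l) * (b * pderiv 1 a) := ⟨_, e1⟩
        have hu : IsUnit (C (1 - l) : MvPolynomial (Fin 2) k) :=
          IsUnit.map C (isUnit_iff_ne_zero.2 (sub_ne_zero.2 (Ne.symm hl1)))
        rw [hu.dvd_mul_left] at h4
        have h5 := (ha.prime.dvd_or_dvd h4).resolve_left hdv
        refine not_dvd_low h2 hay (fun m hm => ?_) h5
        have := totalDegree_le_iff'.1 (hady 1) m hm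
        omega

end
end PCB

-- Module M5b
namespace PCB
open MvPolynomial

section
variable {k : Type*} [CommRing k]

/-- index type of the unknowns -/
abbrev RI (d : ℕ) : Type := (tri (d - 1)) ⊕ (low (d - 1) (d - 1))

/-- the basis of the unknown pairs -/
noncomputable def rbas (k : Type*) [CommRing k] (d : ℕ) (b : RI d) : MvPolynomial (Fin 2) k × MvPolynomial (Fin 2) k :=
  match b with
  | Sum.inl q => (xm k q, 0)
  | Sum.inr q => (0, xm k q)

/-- Ruppert matrix -/
noncomputable def RM (d : ℕ) (f : MvPolynomial (Fin 2) k) : Matrix (tri (2 * d)) (RI d) k :=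
  fun q b => coeff (mon q) (Lop f (rbas k d b).1 (rbas k d b).2)

lemma Lop_map {k' : Type*} [CommRing k'] (φ : k →+* k') (f g h : MvPolynomial (Fin 2) k) :
    Lop (map φ f) (map φ g) (map φ h) = map φ (Lop f g h) := by
  simp only [Lop, map_sub, map_mul, pderiv_map]

lemma RM_map {k' : Type*} [CommRing k'] (φ : k →+* k') (d : ℕ) (f : MvPolynomial (Fin 2) k) :
    RM d (map φ f) = (RM d f).map φ := by
  ext q b
  rw [Matrix.map_apply, RM, RM, ← coeff_map, ← Lop_map]
  congr 2 <;> rcases b with b | b <;> simp [rbas]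

/-- the pair of polynomials with coordinates `v` -/
noncomputable def rg (d : ℕ) (v : RI d → k) : MvPolynomial (Fin 2) k := ∑ b, v b • (rbas k d b).1
noncomputable def rh (d : ℕ) (v : RI d → k) : MvPolynomial (Fin 2) k := ∑ b, v b • (rbas k d b).2

lemma Lop_sum (d : ℕ) (f : MvPolynomial (Fin 2) k) (v : RI d → k) :
    Lop f (rg d v) (rh d v) = ∑ b, v b • Lop f (rbas k d b).1 (rbas k d b).2 := by
  simp only [Lop, rg, rh, map_sum, Finset.mul_sum, Finset.sum_mul, ← Finset.sum_sub_distrib,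
    Derivation.map_smul, smul_sub, mul_smul_comm, smul_mul_assoc]

lemma RM_mulVec (d : ℕ) (f : MvPolynomial (Fin 2) k) (v : RI d → k) (q) :
    (RM d f).mulVec v q = coeff (mon q) (Lop f (rg d v) (rh d v)) := by
  rw [Lop_sum, coeff_sum]
  simp only [Matrix.mulVec, dotProduct, RM, coeff_smul, smul_eq_mul]
  exact Finset.sum_congr rfl fun b _ => mul_comm _ _

lemma rbas_deg (d : ℕ) (b : RI d) : (rbas k d b).1.totalDegree ≤ d - 1 ∧ (rbas k d b).2.totalDegree ≤ d - 1 := by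
  rcases b with b | b
  · exact ⟨totalDegree_xm_le (mem_tri.1 b.2), by simp [rbas]⟩
  · exact ⟨by simp [rbas], totalDegree_xm_le (mem_low.1 b.2).1⟩

lemma rg_deg (d : ℕ) (v : RI d → k) : (rg d v).totalDegree ≤ d - 1 := by
  rw [← mem_restrictTotalDegree]
  refine Submodule.sum_mem _ fun q _ => Submodule.smul_mem _ _ ?_
  rw [mem_restrictTotalDegree]; exact (rbas_deg d q).1

lemma rh_deg (d : ℕ) (v : RI d → k) : (rh d v).totalDegree ≤ d - 1 := by
  rw [← mem_restrictTotalDegree]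
  refine Submodule.sum_mem _ fun q _ => Submodule.smul_mem _ _ ?_
  rw [mem_restrictTotalDegree]; exact (rbas_deg d q).2

lemma rg_eq (d : ℕ) (v : RI d → k) : rg d v = ∑ b : tri (d - 1), v (Sum.inl b) • xm k b := by
  rw [rg, Fintype.sum_sum_type]; simp [rbas]
lemma rh_eq (d : ℕ) (v : RI d → k) : rh d v = ∑ b : low (d - 1) (d - 1), v (Sum.inr b) • xm k b := by
  rw [rh, Fintype.sum_sum_type]; simp [rbas]

lemma sum_sub_eq (S : Finset (ℕ × ℕ)) (v : S → k) :
    ∑ b : S, v b • xm k b = ∑ q ∈ S, (if h : q ∈ S then v ⟨q, h⟩ else 0) • xm k q := by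
  rw [← Finset.sum_coe_sort S]
  exact Finset.sum_congr rfl fun q _ => by simp

lemma coeff_sum_sub (S : Finset (ℕ × ℕ)) (v : S → k) (q : S) :
    coeff (mon q) (∑ b : S, v b • xm k b) = v q := by
  rw [sum_sub_eq, coeff_sum_xm _ _ _ q.2]; simp

lemma coeff_sum_sub_ne (S : Finset (ℕ × ℕ)) (v : S → k) (m : Fin 2 →₀ ℕ)
    (h : coeff m (∑ b : S, v b • xm k b) ≠ 0) : (m 0, m 1) ∈ S := by
  rw [sum_sub_eq] at h
  exact coeff_sum_xm_ne _ _ _ h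

lemma rh_coeff (d : ℕ) (v : RI d → k) : coeff (mon (0, d - 1)) (rh d v) = 0 := by
  by_contra h
  rw [rh_eq] at h
  have := (mem_low.1 (coeff_sum_sub_ne _ _ _ h)).2
  simp at this

lemma exists_v (d : ℕ) (g h : MvPolynomial (Fin 2) k) (hg : g.totalDegree ≤ d - 1) (hh : h.totalDegree ≤ d - 1)
    (hc : coeff (mon (0, d - 1)) h = 0) : ∃ v : RI d → k, rg d v = g ∧ rh d v = h := by
  refine ⟨fun b => match b with
    | Sum.inl q => coeff (mon q) g
    | Sum.inr q => coeff (mon q) h, ?_, ?_⟩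
  · rw [rg_eq]
    conv_rhs => rw [sum_xm_coeff g hg]
    rw [Finset.sum_coe_sort (tri (d - 1)) (fun q => coeff (mon q) g • xm k q)]
  · rw [rh_eq]
    conv_rhs => rw [sum_xm_coeff h hh]
    simp only
    rw [Finset.sum_coe_sort (low (d - 1) (d - 1)) (fun q => coeff (mon q) h • xm k q)]
    refine Finset.sum_subset (Finset.filter_subset _ _) fun q hq hq' => ?_
    have h1 := mem_tri.1 hq
    rw [mem_low] at hq'
    have : q = (0, d - 1) := Prod.ext (by simp; omega) (by simp; omega)
    rw [this, hc, zero_smul]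

lemma v_zero (d : ℕ) (v : RI d → k) (hg : rg d v = 0) (hh : rh d v = 0) : v = 0 := by
  funext b
  rcases b with b | b
  · have := coeff_sum_sub _ (fun q => v (Sum.inl q)) b
    rw [← rg_eq, hg] at this; simpa using this.symm
  · have := coeff_sum_sub _ (fun q => v (Sum.inr q)) b
    rw [← rh_eq, hh] at this; simpa using this.symm

lemma Lop_deg (d : ℕ) {f g h : MvPolynomial (Fin 2) k} (hf : f.totalDegree ≤ d) (hg : g.totalDegree ≤ d - 1)
    (hh : h.totalDegree ≤ d - 1) : (Lop f g h).totalDegree ≤ 2 * d := by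
  have key : ∀ a b : MvPolynomial (Fin 2) k, a.totalDegree ≤ d → b.totalDegree ≤ d → (a * b).totalDegree ≤ 2 * d := by
    intro a b ha hb
    exact (totalDegree_mul _ _).trans (by omega)
  have hp : ∀ (a : MvPolynomial (Fin 2) k) (i : Fin 2), a.totalDegree ≤ d → (pderiv i a).totalDegree ≤ d := by
    intro a i ha
    rw [totalDegree_le_iff'] at ha ⊢
    intro m hm
    rw [coeff_pderiv] at hm
    have := ha _ (left_ne_zero_of_mul hm)
    simp at this; omega
  have hg' : g.totalDegree ≤ d := by omega
  have hh' : h.totalDegree ≤ d := by omega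
  rw [Lop]
  refine (totalDegree_sub _ _).trans (max_le ((totalDegree_sub _ _).trans (max_le ?_ ?_))
    ((totalDegree_sub _ _).trans (max_le ?_ ?_))) <;> apply key <;> first | assumption | (apply hp; assumption)

lemma RM_ker (d : ℕ) {f : MvPolynomial (Fin 2) k} (hf : f.totalDegree ≤ d) (v : RI d → k) :
    (RM d f).mulVec v = 0 ↔ Lop f (rg d v) (rh d v) = 0 := by
  constructor
  · intro h
    have hdeg := Lop_deg d hf (rg_deg d v) (rh_deg d v)
    ext m
    by_contra hm
    rw [coeff_zero] at hm
    have h1 := totalDegree_le_iff'.1 hdeg m hm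
    have := congrFun h ⟨(m 0, m 1), mem_tri.2 h1⟩
    rw [RM_mulVec] at this
    simp only [mon_eta] at this
    exact hm this
  · intro h; funext q; rw [RM_mulVec, h]; simp

lemma coeff_mul_xm_le {f : MvPolynomial (Fin 2) ℤ} {H : ℤ} (hH : ∀ m, |coeff m f| ≤ H) (q : ℕ × ℕ) (m) :
    |coeff m (f * xm ℤ q)| ≤ H := by
  classical
  have h0 : 0 ≤ H := (abs_nonneg _).trans (hH 0)
  rw [coeff_mul_monomial']
  split_ifs
  · simpa using hH _
  · simpa using h0

lemma RM_entry_le {d : ℕ} (hd1 : 1 ≤ d) {f : MvPolynomial (Fin 2) ℤ} (hf : f.totalDegree ≤ d) {H : ℤ} (hH : ∀ m, |coeff m f| ≤ H) (q b) :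
    |RM d f q b| ≤ 2 * d * H := by
  classical
  have h0 : 0 ≤ H := (abs_nonneg _).trans (hH 0)
  have key : ∀ (i : Fin 2) (r : ℕ × ℕ) (m), r.1 + r.2 ≤ d → |coeff m (f * pderiv i (xm ℤ r))| ≤ d * H := by
    intro i r m hr
    rw [xm, pderiv_monomial, coeff_mul_monomial']
    have hri : ((mon r i : ℕ) : ℤ) ≤ d := by
      fin_cases i <;> simp <;> omega
    split_ifs
    · rw [abs_mul, mul_comm, one_mul, Nat.abs_cast]
      exact mul_le_mul hri (hH _) (abs_nonneg _) (by positivity)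
    · simp; positivity
  have key2 : ∀ (i : Fin 2) (r : ℕ × ℕ) (m), |coeff m (xm ℤ r * pderiv i f)| ≤ d * H := by
    intro i r m
    rw [mul_comm]
    refine coeff_mul_xm_le (fun m => ?_) r m
    rw [coeff_pderiv]
    by_cases hz : coeff (m + Finsupp.single i 1) f = 0
    · rw [hz]; simp; positivity
    have h1 := totalDegree_le_iff'.1 hf _ hz
    have h2 : ((m i : ℕ) : ℤ) + 1 ≤ d := by
      fin_cases i <;> simp at * <;> omega
    rw [abs_mul, mul_comm]
    refine mul_le_mul ?_ (hH _) (abs_nonneg _) (by positivity)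
    rw [abs_of_nonneg (by positivity)]; exact h2
  rcases b with b | b
  · have hb := mem_tri.1 b.2
    have h1 := key 1 b (mon q) (by omega)
    have h2 := key2 1 b (mon q)
    have : RM d f q (Sum.inl b) = coeff (mon q) (f * pderiv 1 (xm ℤ b)) - coeff (mon q) (xm ℤ b * pderiv 1 f) := by
      simp [RM, rbas, Lop]
    rw [this]
    refine (abs_sub _ _).trans ?_
    linarith
  · have hb := (mem_low.1 b.2).1
    have h1 := key 0 b (mon q) (by omega)
    have h2 := key2 0 b (mon q)
    have : RM d f q (Sum.inr b) = coeff (mon q) (xm ℤ b * pderiv 0 f) - coeff (mon q) (f * pderiv 0 (xm ℤ b)) := by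
      simp [RM, rbas, Lop]
    rw [this]
    refine (abs_sub _ _).trans ?_
    linarith

lemma card_tri_le (n : ℕ) : (tri n).card ≤ (n + 1) ^ 2 := by
  have := card_tri n
  nlinarith

lemma totalDegree_map_le' {k' : Type*} [CommRing k'] (φ : k →+* k') {f : MvPolynomial (Fin 2) k} {d : ℕ}
    (h : f.totalDegree ≤ d) : (map φ f).totalDegree ≤ d := by
  rw [totalDegree_le_iff'] at h ⊢
  intro m hm
  rw [coeff_map] at hm
  exact h m (fun h0 => hm (by rw [h0, map_zero]))

theorem ruppert {d : ℕ} (hd1 : 1 ≤ d) {F : MvPolynomial (Fin 2) ℤ} (hF : F.totalDegree ≤ d)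
    (hirr : Irreducible (map (Int.castRingHom ℚ) F)) (hc : coeff (mon (0, d)) F ≠ 0)
    {H : ℕ} (hH : ∀ m, |coeff m F| ≤ H)
    (P : Fin 2 → ℚ) (hP : eval P (map (Int.castRingHom ℚ) F) = 0)
    (hP' : eval P (pderiv 1 (map (Int.castRingHom ℚ) F)) ≠ 0) :
    ∃ R : ℤ, R ≠ 0 ∧ |R| ≤ (72 * d ^ 6 * H ^ 2) ^ (2 * d ^ 2) ∧ ∀ p : ℕ, p.Prime → d < p →
      ¬ ((p : ℤ) ∣ coeff (mon (0, d)) F) → ¬ ((p : ℤ) ∣ R) →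
      Irreducible (map (Int.castRingHom (ZMod p)) F) := by
  classical
  set A := RM d F with hA
  have hdegmap : ∀ (k : Type) [CommRing k], (map (Int.castRingHom k) F).totalDegree ≤ d := fun k _ =>
    totalDegree_map_le' _ hF
  have hH1 : 1 ≤ H := by
    have := hH (mon (0, d))
    have h2 := Int.one_le_abs hc
    exact_mod_cast h2.trans this
  refine ⟨(A.transpose * A).det, ?_, ?_, ?_⟩
  · intro h0
    have h1 : ((A.map (Int.castRingHom ℚ)).transpose * A.map (Int.castRingHom ℚ)).det = 0 := by
      rw [← Matrix.transpose_map, ← Matrix.map_mul, ← RingHom.mapMatrix_apply, ← RingHom.map_det, h0, map_zero]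
    obtain ⟨v, hv0, hv⟩ := Matrix.exists_mulVec_eq_zero_iff.2 h1
    have h2 : (A.map (Int.castRingHom ℚ)).mulVec v = 0 := by
      have h3 : dotProduct ((A.map (Int.castRingHom ℚ)).mulVec v) ((A.map (Int.castRingHom ℚ)).mulVec v) = 0 := by
        rw [Matrix.dotProduct_mulVec, Matrix.vecMul_mulVec, ← Matrix.dotProduct_mulVec, hv, dotProduct_zero]
      exact dotProduct_self_eq_zero.1 h3
    rw [hA, ← RM_map, RM_ker d (hdegmap ℚ)] at h2
    have h3 := ruppert_zero hirr hd1 (hdegmap ℚ) (by rw [coeff_map]; simpa using hc) h2 (rg_deg d v)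
      (rh_deg d v) (rh_coeff d v) P hP hP'
    exact hv0 (v_zero d v h3.1 h3.2)
  · have hentry : ∀ i j, |(A.transpose * A) i j| ≤ (9 * d ^ 2) * (4 * d ^ 2 * H ^ 2) := by
      intro i j
      rw [Matrix.mul_apply]
      refine (Finset.abs_sum_le_sum_abs _ _).trans ?_
      have h1 : ∀ q ∈ (Finset.univ : Finset (tri (2 * d))), |A.transpose i q * A q j| ≤ (4 * d ^ 2 * H ^ 2 : ℤ) := by
        intro q _
        rw [abs_mul, Matrix.transpose_apply]
        have e1 := RM_entry_le hd1 hF hH q i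
        have e2 := RM_entry_le hd1 hF hH q j
        calc _ ≤ (2 * d * H : ℤ) * (2 * d * H) := mul_le_mul e1 e2 (abs_nonneg _) (by positivity)
          _ = _ := by ring
      refine (Finset.sum_le_card_nsmul _ _ _ h1).trans ?_
      rw [Finset.card_univ, Fintype.card_coe, nsmul_eq_mul]
      have h2 := card_tri_le (2 * d)
      have h3 : (2 * d + 1) ^ 2 ≤ 9 * d ^ 2 := by nlinarith
      have h4 : ((tri (2 * d)).card : ℤ) ≤ 9 * d ^ 2 := by exact_mod_cast h2.trans h3
      exact mul_le_mul_of_nonneg_right h4 (by positivity)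
    have hdet := Matrix.det_le (A := A.transpose * A) (abv := AbsoluteValue.abs) hentry
    set n := Fintype.card (RI d) with hn
    have hn1 : n ≤ 2 * d ^ 2 := by
      have h1 : n = (tri (d - 1)).card + (low (d - 1) (d - 1)).card := by
        rw [hn, Fintype.card_sum, Fintype.card_coe, Fintype.card_coe]
      have h2 : (low (d - 1) (d - 1)).card ≤ (tri (d - 1)).card := Finset.card_le_card (Finset.filter_subset _ _)
      have h3 := card_tri_le (d - 1)
      rw [show d - 1 + 1 = d by omega] at h3
      omega
    have h5 : |(A.transpose * A).det| ≤ n.factorial • ((9 * d ^ 2) * (4 * d ^ 2 * H ^ 2)) ^ n := hdet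
    refine h5.trans ?_
    rw [nsmul_eq_mul]
    have h6 : (n.factorial : ℤ) ≤ (2 * d ^ 2) ^ n := by
      have : n.factorial ≤ n ^ n := n.factorial_le_pow
      exact_mod_cast this.trans (Nat.pow_le_pow_left hn1 n)
    calc (n.factorial : ℤ) * ((9 * d ^ 2) * (4 * d ^ 2 * H ^ 2)) ^ n ≤ (2 * d ^ 2) ^ n * ((9 * d ^ 2) * (4 * d ^ 2 * H ^ 2)) ^ n := by
          gcongr
      _ = (72 * d ^ 6 * H ^ 2 : ℤ) ^ n := by rw [← mul_pow]; ring
      _ ≤ (72 * d ^ 6 * H ^ 2 : ℤ) ^ (2 * d ^ 2) := by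
          apply pow_le_pow_right₀ _ hn1
          have : 0 < 72 * d ^ 6 * H ^ 2 := by positivity
          exact_mod_cast this
  · intro p hp hdp hpc hpR
    have : Fact p.Prime := ⟨hp⟩
    by_contra hred
    have hc' : coeff (mon (0, d)) (map (Int.castRingHom (ZMod p)) F) ≠ 0 := by
      intro h
      rw [coeff_map] at h
      exact hpc ((ZMod.intCast_zmod_eq_zero_iff_dvd _ p).1 h)
    have hk' : ∀ j, 1 ≤ j → j ≤ d → (j : ZMod p) ≠ 0 := by
      intro j hj1 hj2 h
      rw [ZMod.natCast_eq_zero_iff] at h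
      exact absurd (Nat.le_of_dvd (by omega) h) (by omega)
    obtain ⟨g, h, hL, hg, hh, hh0, hne⟩ := ruppert_red hd1 hred (hdegmap (ZMod p)) hc' hk'
    · obtain ⟨v, hvg, hvh⟩ := exists_v d g h hg hh hh0
      have h1 : (RM d (map (Int.castRingHom (ZMod p)) F)).mulVec v = 0 := by
        rw [RM_ker d (hdegmap (ZMod p)), hvg, hvh, hL]
      rw [RM_map] at h1
      have h2 : ((A.transpose * A).map (Int.castRingHom (ZMod p))).mulVec v = 0 := by
        rw [Matrix.map_mul, ← Matrix.mulVec_mulVec, h1, Matrix.mulVec_zero]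
      have h3 : v ≠ 0 := by
        rintro rfl
        rcases hne with h | h
        · apply h; rw [← hvg]; simp [rg]
        · apply h; rw [← hvh]; simp [rh]
      have h4 := Matrix.exists_mulVec_eq_zero_iff.1 ⟨v, h3, h2⟩
      rw [← RingHom.mapMatrix_apply, ← RingHom.map_det] at h4
      exact hpR ((ZMod.intCast_zmod_eq_zero_iff_dvd _ p).1 h4)

end
end PCB

-- Module M6
namespace PCB

section
variable {S : Type*} [CommRing S] {ι K J : Type*} [Fintype ι] [DecidableEq ι] [Fintype K]

theorem det_dvd (ϖ : S) (A : Matrix ι ι S) (R : ι → K → S) (C : K → ι → S) (lev : K → ℕ)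
    (hA : ∀ i j, A i j = ∑ κ, R i κ * C κ j) (hR : ∀ i κ, ϖ ^ lev κ ∣ R i κ) (e : ℕ)
    (he : ∀ τ : ι → K, Function.Injective τ → e ≤ ∑ i, lev (τ i)) : ϖ ^ e ∣ A.det := by
  classical
  have h1 : A = fun i => ∑ κ, R i κ • C κ := by
    funext i j
    simp [hA]
  have h2 : A.det = Matrix.detRowAlternating (fun i => ∑ κ, R i κ • C κ) := by
    conv_lhs => rw [h1]
    rfl
  rw [h2]
  have h3 := (Matrix.detRowAlternating (n := ι) (R := S)).toMultilinearMap.map_sum (fun i κ => R i κ • C κ)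
  rw [AlternatingMap.coe_multilinearMap] at h3
  rw [h3]
  refine Finset.dvd_sum fun τ _ => ?_
  have h4 := (Matrix.detRowAlternating (n := ι) (R := S)).toMultilinearMap.map_smul_univ (fun i => R i (τ i)) (fun i => C (τ i))
  rw [AlternatingMap.coe_multilinearMap] at h4
  rw [h4]
  by_cases hτ : Function.Injective τ
  · refine Dvd.dvd.mul_right ?_ _
    refine (pow_dvd_pow ϖ (he τ hτ)).trans ?_
    rw [← Finset.prod_pow_eq_pow_sum]
    exact Finset.prod_dvd_prod_of_dvd _ _ fun i _ => hR i _
  · rw [Function.not_injective_iff] at hτ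
    obtain ⟨i, j, hij, hne⟩ := hτ
    rw [AlternatingMap.map_eq_zero_of_eq _ _ (by simp only [hij]) hne]
    simp

lemma lev_sum (lev : K → ℕ) (N : ℕ) (hN : ∀ L, (Finset.univ.filter fun κ => lev κ = L).card ≤ N)
    (τ : ι → K) (hτ : Function.Injective τ) (T : ℕ) :
    Fintype.card ι * T ≤ ∑ i, lev (τ i) + N * ∑ l ∈ Finset.range T, (T - l) := by
  classical
  have h1 : ∀ i, T ≤ lev (τ i) + (T - lev (τ i)) := fun i => by omega
  have h2 : Fintype.card ι * T ≤ ∑ i, lev (τ i) + ∑ i, (T - lev (τ i)) := by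
    rw [← Finset.sum_add_distrib]
    calc Fintype.card ι * T = ∑ i : ι, T := by simp
      _ ≤ _ := Finset.sum_le_sum fun i _ => h1 i
  have h3 : ∑ i, (T - lev (τ i)) ≤ ∑ κ, (T - lev κ) := by
    rw [← Finset.sum_image (f := fun κ => T - lev κ) (s := Finset.univ) (g := τ) (fun a _ b _ h => hτ h)]
    exact Finset.sum_le_sum_of_subset (Finset.subset_univ _)
  have h4 : ∑ κ, (T - lev κ) ≤ N * ∑ l ∈ Finset.range T, (T - l) := by
    have : ∀ κ, T - lev κ = ∑ l ∈ Finset.range T, if lev κ = l then T - l else 0 := by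
      intro κ
      rw [Finset.sum_ite_eq]
      split_ifs with h
      · rfl
      · rw [Finset.mem_range] at h; omega
    simp_rw [this]
    rw [Finset.sum_comm, Finset.mul_sum]
    refine Finset.sum_le_sum fun l _ => ?_
    rw [← Finset.sum_filter, Finset.sum_const, smul_eq_mul]
    exact Nat.mul_le_mul_right _ (hN l)
  omega

/-- exponent lower bound -/
lemma exp_bound (s N : ℕ) (hN : 0 < N) : ∃ e : ℕ, ((s : ℝ) ^ 2 / (2 * N) - s ≤ e) ∧
    ∃ T : ℕ, e + N * ∑ l ∈ Finset.range T, (T - l) ≤ s * T := by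
  set T := s / N with hT
  have hTs : N * T ≤ s := Nat.mul_div_le s N
  have hsum : 2 * ∑ l ∈ Finset.range T, (T - l) = T * (T + 1) := by
    clear_value T
    clear hT hTs
    induction T with
    | zero => simp
    | succ T ih =>
      rw [Finset.sum_range_succ']
      simp only [Nat.add_sub_add_right, Nat.sub_zero]
      nlinarith
  have hle : N * ∑ l ∈ Finset.range T, (T - l) ≤ s * T := by
    have h1 : N * T * (T + 1) ≤ 2 * (s * T) := by
      rcases Nat.eq_zero_or_pos T with h0 | h0
      · simp [h0]
      · have : N * T * (T + 1) ≤ s * (T + 1) := Nat.mul_le_mul_right _ hTs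
        nlinarith
    nlinarith
  refine ⟨s * T - N * ∑ l ∈ Finset.range T, (T - l), ?_, T, by omega⟩
  rw [Nat.cast_sub hle]
  have h2 : ((∑ l ∈ Finset.range T, (T - l) : ℕ) : ℝ) = T * (T + 1) / 2 := by
    have : (2 : ℝ) * ((∑ l ∈ Finset.range T, (T - l) : ℕ) : ℝ) = T * (T + 1) := by exact_mod_cast hsum
    linarith
  rw [Nat.cast_mul, Nat.cast_mul, h2]
  have hN' : (0 : ℝ) < N := by exact_mod_cast hN
  obtain ⟨r, hr⟩ : ∃ r, s = N * T + r := ⟨s - N * T, by omega⟩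
  have hrN : r ≤ N := by
    have := Nat.lt_mul_div_succ s hN
    rw [← hT, Nat.mul_add] at this; omega
  have hs : (s : ℝ) = N * T + r := by exact_mod_cast hr
  have hrN' : (r : ℝ) ≤ N := by exact_mod_cast hrN
  have : (s : ℝ) ^ 2 / (2 * N) = N * T ^ 2 / 2 + r * T + r ^ 2 / (2 * N) := by
    rw [hs]; field_simp; ring
  rw [this, hs]
  have h5 : (r : ℝ) ^ 2 / (2 * N) ≤ r := by
    rw [div_le_iff₀ (by positivity)]
    nlinarith [(Nat.cast_nonneg r : (0 : ℝ) ≤ r)]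
  have h6 : (0 : ℝ) ≤ N * T := by positivity
  nlinarith

theorem det_dvd_classes (ϖ : S) (A : Matrix ι ι S) {Z : Type*} [Fintype Z] [DecidableEq Z] (w : Z → ℕ) (cl : ι → Z) (L : ℕ)
    (h : ∀ z, ∃ C : Fin L → Fin (w z) → ι → S, ∀ i, cl i = z → ∃ R : Fin L → Fin (w z) → S,
      (∀ (n : Fin L) m, ϖ ^ (n : ℕ) ∣ R n m) ∧ ∀ j, A i j = ∑ n, ∑ m, R n m * C n m j)
    (N : ℕ) (hN : ∑ z, w z ≤ N) (e T : ℕ) (he : e + N * ∑ l ∈ Finset.range T, (T - l) ≤ Fintype.card ι * T) :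
    ϖ ^ e ∣ A.det := by
  classical
  choose C hC using h
  have hC' : ∀ i, ∃ R : Fin L → Fin (w (cl i)) → S,
      (∀ (n : Fin L) m, ϖ ^ (n : ℕ) ∣ R n m) ∧ ∀ j, A i j = ∑ n, ∑ m, R n m * C (cl i) n m j := fun i => hC _ i rfl
  choose R hR1 hR2 using hC'
  let K := Σ z : Z, Fin L × Fin (w z)
  refine det_dvd (K := K) ϖ A
    (fun i κ => if hz : κ.1 = cl i then R i κ.2.1 (Fin.cast (by rw [hz]) κ.2.2) else 0)
    (fun κ j => C κ.1 κ.2.1 κ.2.2 j) (fun κ => κ.2.1) ?_ ?_ e ?_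
  · intro i j
    rw [hR2, Fintype.sum_sigma, Finset.sum_eq_single (cl i)]
    · rw [Fintype.sum_prod_type]; simp
    · intro z _ hz
      refine Finset.sum_eq_zero fun κ _ => ?_
      simp [hz]
    · simp
  · intro i κ
    split_ifs
    · exact hR1 _ _ _
    · exact dvd_zero _
  · intro τ hτ
    have := lev_sum (fun κ : K => (κ.2.1 : ℕ)) N ?_ τ hτ T
    · omega
    · intro l
      refine le_trans ?_ hN
      have : ∑ z, w z = (Finset.univ : Finset (Σ z : Z, Fin (w z))).card := by simp
      rw [this]
      refine Finset.card_le_card_of_injOn (fun κ : K => (⟨κ.1, κ.2.2⟩ : Σ z : Z, Fin (w z))) (fun _ _ => by simp) ?_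
      rintro ⟨z, n, m⟩ h1 ⟨z', n', m'⟩ h2 h3
      simp at h1 h2 h3
      obtain ⟨rfl, h4⟩ := h3
      have h5 : n = n' := Fin.ext (by omega)
      rw [heq_eq_eq] at h4
      rw [h5, h4]

end
end PCB

-- Module M6b
namespace PCB
open MvPolynomial

section
variable {S : Type*} [CommRing S]

lemma eval_taylor (F : MvPolynomial (Fin 2) S) (x y t : S) :
    ∃ k, eval ![x, y + t] F = eval ![x, y] F + eval ![x, y] (pderiv 1 F) * t + k * t ^ 2 := by
  induction F using MvPolynomial.induction_on with
  | C a => exact ⟨0, by simp⟩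
  | add f g hf hg =>
    obtain ⟨a, ha⟩ := hf
    obtain ⟨b, hb⟩ := hg
    exact ⟨a + b, by simp only [map_add, ha, hb]; ring⟩
  | mul_X f i hf =>
    obtain ⟨a, ha⟩ := hf
    fin_cases i
    · refine ⟨a * x, ?_⟩
      simp only [Fin.zero_eta, map_mul, ha, Derivation.leibniz, map_add, smul_eq_mul, eval_X, pderiv_X]
      simp; ring
    · refine ⟨a * (y + t) + eval ![x, y] (pderiv 1 f), ?_⟩
      simp only [Fin.mk_one, map_mul, ha, Derivation.leibniz, map_add, smul_eq_mul, eval_X, pderiv_X]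
      simp; ring

lemma map_eval' {k : Type*} [CommRing k] (π : S →+* k) (F : MvPolynomial (Fin 2) S) (x y : S) :
    π (eval ![x, y] F) = eval ![π x, π y] (map π F) := by
  rw [eval_map]
  change π (eval₂ (RingHom.id S) ![x, y] F) = _
  rw [eval₂_comp_left π, RingHom.comp_id]
  congr 1
  funext i; fin_cases i <;> rfl

lemma newton {k : Type*} [Field k] (π : S →+* k) (ϖ : S) (hϖ : π ϖ = 0) (hker : ∀ x, π x = 0 → ϖ ∣ x)
    (hunit : ∀ x, π x ≠ 0 → IsUnit x) (F : MvPolynomial (Fin 2) S) (α β : S)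
    (hα : π (eval ![α, β] (pderiv 1 F)) ≠ 0) (L : ℕ) :
    ∃ g : Polynomial S, ∀ u v, ϖ ∣ u → ϖ ∣ v → eval ![α + u, β + v] F = 0 → ϖ ^ (L + 1) ∣ v - g.eval u := by
  induction L with
  | zero => exact ⟨0, fun u v _ hv _ => by simpa using hv⟩
  | succ L ih =>
    obtain ⟨g, hg⟩ := ih
    obtain ⟨b, hb⟩ := (hunit _ hα).exists_right_inv
    refine ⟨g - Polynomial.C b * aeval ![Polynomial.C α + Polynomial.X, Polynomial.C β + g] F, fun u v hu hv h0 => ?_⟩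
    obtain ⟨t, ht⟩ : ∃ t, v = g.eval u + t := ⟨v - g.eval u, by ring⟩
    have h1 := hg u v hu hv h0
    have hev : Polynomial.eval u (aeval ![Polynomial.C α + Polynomial.X, Polynomial.C β + g] F) =
        eval ![α + u, β + g.eval u] F := by
      have := MvPolynomial.map_aeval ![Polynomial.C α + Polynomial.X, Polynomial.C β + g] (Polynomial.evalRingHom u) F
      rw [Polynomial.coe_evalRingHom] at this
      rw [this, eval]
      congr 2
      · ext x; simp
      · funext i; fin_cases i <;> simp
    rw [ht, add_sub_cancel_left] at h1
    have htϖ : ϖ ∣ t := (dvd_pow_self ϖ (by omega)).trans h1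
    have hwϖ : ϖ ∣ g.eval u := by
      have : g.eval u = v - t := by rw [ht]; ring
      rw [this]; exact dvd_sub hv htϖ
    obtain ⟨k', hk'⟩ := eval_taylor F (α + u) (β + g.eval u) t
    rw [add_assoc β, ← ht, h0] at hk'
    set G := eval ![α + u, β + g.eval u] (pderiv 1 F) with hG
    have hdiv : ∀ x, ϖ ∣ x → π x = 0 := by
      rintro _ ⟨y, rfl⟩; rw [map_mul, hϖ, zero_mul]
    have h2 : ϖ ∣ 1 - b * G - b * k' * t := by
      apply hker
      have e1 : π G = π (eval ![α, β] (pderiv 1 F)) := by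
        rw [hG, map_eval', map_eval', map_add, map_add, hdiv u hu, hdiv _ hwϖ, add_zero, add_zero]
      rw [map_sub, map_sub, map_mul, map_mul, hdiv t htϖ, e1, ← map_mul, mul_comm b, hb]; simp
    have h3 : v - Polynomial.eval u (g - Polynomial.C b * aeval ![Polynomial.C α + Polynomial.X, Polynomial.C β + g] F)
        = t * (1 - b * G - b * k' * t) := by
      rw [Polynomial.eval_sub, Polynomial.eval_mul, hev, Polynomial.eval_C, ht]
      linear_combination (-b) * hk'
    rw [h3, pow_succ]
    exact mul_dvd_mul h1 h2

lemma poly_trunc (P : Polynomial S) (ϖ u : S) (L : ℕ) (hL : ϖ ^ L = 0) (hu : ϖ ∣ u) :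
    P.eval u = ∑ n : Fin L, P.coeff n * u ^ (n : ℕ) := by
  have h0 : ∀ n, L ≤ n → u ^ n = 0 := by
    intro n hn
    have h1 : ϖ ^ L ∣ u ^ n := (pow_dvd_pow ϖ hn).trans (pow_dvd_pow_of_dvd hu n)
    rw [hL] at h1
    exact zero_dvd_iff.1 h1
  rw [P.eval_eq_sum_range' (n := max (P.natDegree + 1) L) (by omega), Fin.sum_univ_eq_sum_range (fun n => P.coeff n * u ^ n)]
  symm
  refine Finset.sum_subset (by intro; simp; omega) fun n _ hn => ?_
  rw [h0 n (by simpa using hn), mul_zero]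

/-- weight `d` classes -/
lemma class_sing (ϖ : S) (L : ℕ) (hL : ϖ ^ L = 0) {J : Type*} (d : ℕ) (e1 e2 : J → ℕ) (he2 : ∀ j, e2 j < d) (α β : S) :
    ∃ C : Fin L → Fin d → J → S, ∀ c u v, ϖ ∣ u → ∃ R : Fin L → Fin d → S,
      (∀ (n : Fin L) m, ϖ ^ (n : ℕ) ∣ R n m) ∧
      ∀ j, c * ((α + u) ^ e1 j * (β + v) ^ e2 j) = ∑ n, ∑ m, R n m * C n m j := by
  let P : J → Polynomial S := fun j => (Polynomial.C α + Polynomial.X) ^ e1 j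
  let Q : J → Polynomial S := fun j => (Polynomial.C β + Polynomial.X) ^ e2 j
  refine ⟨fun n m j => (P j).coeff n * (Q j).coeff m, fun c u v hu => ⟨fun n m => c * (u ^ (n : ℕ) * v ^ (m : ℕ)), ?_, ?_⟩⟩
  · intro n m
    exact Dvd.dvd.mul_left (Dvd.dvd.mul_right (pow_dvd_pow_of_dvd hu _) _) _
  · intro j
    have h1 : (α + u) ^ e1 j = (P j).eval u := by simp [P]
    have h2 : (β + v) ^ e2 j = (Q j).eval v := by simp [Q]
    have h3 : (Q j).natDegree < d := by
      refine lt_of_le_of_lt ?_ (he2 j)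
      refine (Polynomial.natDegree_pow_le_of_le (m := 1) (e2 j) ?_).trans (by simp)
      refine (Polynomial.natDegree_add_le _ _).trans (max_le (by simp) Polynomial.natDegree_X_le)
    rw [h1, h2, poly_trunc _ ϖ u L hL hu, (Q j).eval_eq_sum_range' h3,
      ← Fin.sum_univ_eq_sum_range (fun n => (Q j).coeff n * v ^ n), Finset.sum_mul_sum, Finset.mul_sum]
    refine Finset.sum_congr rfl fun n _ => ?_
    rw [Finset.mul_sum]
    exact Finset.sum_congr rfl fun m _ => by ring

/-- weight 1 classes -/
lemma class_smooth {k : Type*} [Field k] (π : S →+* k) (ϖ : S) (hϖ : π ϖ = 0) (hker : ∀ x, π x = 0 → ϖ ∣ x)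
    (hunit : ∀ x, π x ≠ 0 → IsUnit x) (F : MvPolynomial (Fin 2) S) (α β : S)
    (hα : π (eval ![α, β] (pderiv 1 F)) ≠ 0) (L : ℕ) (hL : ϖ ^ L = 0) {J : Type*} (e1 e2 : J → ℕ) :
    ∃ C : Fin L → Fin 1 → J → S, ∀ c u v, ϖ ∣ u → ϖ ∣ v → eval ![α + u, β + v] F = 0 → ∃ R : Fin L → Fin 1 → S,
      (∀ (n : Fin L) m, ϖ ^ (n : ℕ) ∣ R n m) ∧
      ∀ j, c * ((α + u) ^ e1 j * (β + v) ^ e2 j) = ∑ n, ∑ m, R n m * C n m j := by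
  obtain ⟨g, hg⟩ := newton π ϖ hϖ hker hunit F α β hα L
  let P : J → Polynomial S := fun j => (Polynomial.C α + Polynomial.X) ^ e1 j * (Polynomial.C β + g) ^ e2 j
  refine ⟨fun n m j => (P j).coeff n, fun c u v hu hv h0 => ⟨fun n m => c * u ^ (n : ℕ), ?_, ?_⟩⟩
  · intro n m
    exact Dvd.dvd.mul_left (pow_dvd_pow_of_dvd hu _) _
  · intro j
    have h1 := hg u v hu hv h0
    rw [pow_succ, hL, zero_mul, zero_dvd_iff, sub_eq_zero] at h1
    have h2 : (α + u) ^ e1 j * (β + v) ^ e2 j = (P j).eval u := by simp [P, h1]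
    rw [h2, poly_trunc _ ϖ u L hL hu, Finset.mul_sum]
    refine Finset.sum_congr rfl fun n _ => ?_
    simp; ring

/-- homogeneous evaluation -/
noncomputable def hev (F : MvPolynomial (Fin 2) S) (d : ℕ) (a b q : S) : S :=
  ∑ r ∈ tri d, coeff (mon r) F * (a ^ r.1 * b ^ r.2 * q ^ (d - r.1 - r.2))

lemma hev_smul (F : MvPolynomial (Fin 2) S) (d : ℕ) (l a b q : S) :
    hev F d (l * a) (l * b) (l * q) = l ^ d * hev F d a b q := by
  rw [hev, hev, Finset.mul_sum]
  refine Finset.sum_congr rfl fun r hr => ?_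
  have := mem_tri.1 hr
  have h1 : l ^ d = l ^ r.1 * l ^ r.2 * l ^ (d - r.1 - r.2) := by
    rw [← pow_add, ← pow_add]; congr 1; omega
  rw [h1]; ring

lemma hev_one (F : MvPolynomial (Fin 2) S) {d : ℕ} (hd : F.totalDegree ≤ d) (a b : S) :
    hev F d a b 1 = eval ![a, b] F := by
  conv_rhs => rw [sum_xm_coeff F hd]
  rw [hev, map_sum]
  refine Finset.sum_congr rfl fun r _ => ?_
  rw [smul_eval, eval_monomial, Finsupp.prod_fintype _ _ (by simp)]
  simp

lemma hev_map {k : Type*} [CommRing k] (π : S →+* k) (F : MvPolynomial (Fin 2) S) (d : ℕ) (a b q : S) :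
    π (hev F d a b q) = hev (map π F) d (π a) (π b) (π q) := by
  simp [hev, coeff_map]

lemma hev_top (F : MvPolynomial (Fin 2) S) (d : ℕ) (b : S) :
    hev F d 0 b 0 = coeff (mon (0, d)) F * b ^ d := by
  rw [hev, Finset.sum_eq_single (0, d)]
  · simp
  · rintro ⟨i, j⟩ hr hne
    have := mem_tri.1 hr
    simp only at this
    by_cases hi : i = 0
    · have : d - i - j ≠ 0 := by
        intro h; apply hne; ext <;> simp <;> omega
      simp [zero_pow this]
    · simp [zero_pow hi]
  · intro h; exact absurd (mem_tri.2 (by simp)) h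

lemma card_inf {k : Type*} [Field k] [Fintype k] [DecidableEq k] (f : MvPolynomial (Fin 2) k) (d : ℕ)
    (hc : coeff (mon (0, d)) f ≠ 0) : (Finset.univ.filter fun t : k => hev f d 1 t 0 = 0).card ≤ d := by
  classical
  let Q : Polynomial k := ∑ r ∈ tri d, Polynomial.C (coeff (mon r) f * 0 ^ (d - r.1 - r.2)) * Polynomial.X ^ r.2
  have hQ : ∀ t, Q.eval t = hev f d 1 t 0 := by
    intro t
    simp only [Q, hev, Polynomial.eval_finsetSum, Polynomial.eval_mul, Polynomial.eval_C, Polynomial.eval_pow, Polynomial.eval_X]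
    exact Finset.sum_congr rfl fun r _ => by ring
  have hdeg : Q.natDegree ≤ d := by
    refine Polynomial.natDegree_sum_le_of_forall_le _ _ fun r hr => ?_
    refine (Polynomial.natDegree_C_mul_X_pow_le _ _).trans ?_
    have := mem_tri.1 hr; omega
  have hQ0 : Q ≠ 0 := by
    intro h0
    have := congrArg (fun P => Polynomial.coeff P d) h0
    simp only [Q, Polynomial.finsetSum_coeff, Polynomial.coeff_C_mul_X_pow, Polynomial.coeff_zero] at this
    rw [Finset.sum_eq_single (0, d)] at this
    · simp at this; exact hc this
    · rintro ⟨i, j⟩ hr hne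
      have := mem_tri.1 hr
      simp only at this
      rw [if_neg]
      intro h; apply hne; ext <;> simp <;> omega
    · intro h; exact absurd (mem_tri.2 (by simp)) h
  calc _ ≤ Q.roots.toFinset.card := by
        refine Finset.card_le_card fun t ht => ?_
        rw [Finset.mem_filter] at ht
        rw [Multiset.mem_toFinset, Polynomial.mem_roots hQ0, Polynomial.IsRoot, hQ]
        exact ht.2
    _ ≤ Multiset.card Q.roots := Multiset.toFinset_card_le _
    _ ≤ Q.natDegree := Q.card_roots'
    _ ≤ d := hdeg

end
end PCB

-- Module M6c
namespace PCB
open MvPolynomial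

/-- The interpolation matrix of homogenised low monomials. -/
def imat {S : Type*} [CommRing S] (d M : ℕ) (a b q : low d M → S) : Matrix (low d M) (low d M) S :=
  Matrix.of fun i j => a i ^ j.1.1 * b i ^ j.1.2 * q i ^ (M - j.1.1 - j.1.2)

section
variable {p : ℕ} [Fact p.Prime] {S : Type*} [CommRing S]

open Classical in
/-- Weight of a residue class. -/
noncomputable def wt (f : MvPolynomial (Fin 2) (ZMod p)) (d : ℕ) : (Fin 2 → ZMod p) ⊕ ZMod p → ℕ
  | .inl z => if eval z f ≠ 0 then 0 else if eval z (pderiv 1 f) ≠ 0 then 1 else d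
  | .inr t => if hev f d 1 t 0 ≠ 0 then 0 else d

lemma wt_sum {f : MvPolynomial (Fin 2) (ZMod p)} {d : ℕ} (hf : Irreducible f)
    (hd1 : 1 ≤ d) (hd : f.totalDegree ≤ d) (hc : coeff (mon (0, d)) f ≠ 0) (hp : 64 * d ^ 4 ≤ p) :
    ∑ z, wt f d z ≤ p + 9 * d ^ 2 * Nat.sqrt p := by
  classical
  have hdp : d < p := by
    have : d ^ 1 ≤ d ^ 4 := Nat.pow_le_pow_right hd1 (by norm_num)
    rw [pow_one] at this
    omega
  rw [Fintype.sum_sum_type]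
  have h1 : ∑ z, wt f d (Sum.inl z) ≤
      (Finset.univ.filter fun z => eval z f = 0 ∧ eval z (pderiv 1 f) ≠ 0).card +
      d * (Finset.univ.filter fun z => eval z f = 0 ∧ eval z (pderiv 1 f) = 0).card := by
    rw [Finset.card_filter, Finset.card_filter, Finset.mul_sum, ← Finset.sum_add_distrib]
    refine Finset.sum_le_sum fun z _ => ?_
    simp only [wt]
    by_cases h1 : eval z f = 0 <;> by_cases h2 : eval z (pderiv 1 f) = 0 <;> simp [h1, h2]
  have h2 : ∑ t, wt f d (Sum.inr t) = d * (Finset.univ.filter fun t : ZMod p => hev f d 1 t 0 = 0).card := by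
    rw [Finset.card_filter, Finset.mul_sum]
    refine Finset.sum_congr rfl fun z _ => ?_
    simp only [wt]
    by_cases h1 : hev f d 1 z 0 = 0 <;> simp [h1]
  have h3 := stepanov hf hd1 hd hc hp (Finset.univ.filter fun z => eval z f = 0 ∧ eval z (pderiv 1 f) ≠ 0)
    (by simp)
  have h4 := card_inf f d hc
  have hdk : (d : ZMod p) ≠ 0 := by
    rw [Ne, ZMod.natCast_eq_zero_iff]
    exact fun h => absurd (Nat.le_of_dvd (by omega) h) (by omega)
  have hfy : (pderiv 1 f).totalDegree ≤ d - 1 := totalDegree_pderiv_le (by omega) 1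
  have h5 := count_points hf (g := pderiv 1 f) (D := d) (not_dvd_low hc (pderiv_ne_of_top hd1 hc hdk) (by
    intro m hm
    have := totalDegree_le_iff'.1 hfy m hm
    omega)) (by omega) (Finset.univ.filter fun z => eval z f = 0 ∧ eval z (pderiv 1 f) = 0)
    (by simp +contextual) (by simp +contextual)
  have h6 : f.totalDegree * d ≤ d * d := Nat.mul_le_mul_right _ hd
  have h7 : d + 1 ≤ Nat.sqrt p := by
    rw [Nat.le_sqrt]
    refine le_trans ?_ hp
    have e1 : d ^ 2 ≤ d ^ 4 := Nat.pow_le_pow_right hd1 (by norm_num)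
    nlinarith
  have h8 := Nat.mul_le_mul_left d (h5.trans h6)
  have h9 := Nat.mul_le_mul_left d h4
  have h10 := Nat.mul_le_mul_left (d ^ 2) h7
  rw [h2]
  nlinarith

lemma padic_gen (π : S →+* ZMod p) (hπ : Function.Surjective π) (ϖ : S) (hϖ : π ϖ = 0)
    (hker : ∀ x, π x = 0 → ϖ ∣ x)
    (hunit : ∀ x, π x ≠ 0 → IsUnit x) (F : MvPolynomial (Fin 2) S) {d M : ℕ} (hF : F.totalDegree ≤ d)
    (hc : coeff (mon (0, d)) (map π F) ≠ 0)
    (L : ℕ) (hL : ϖ ^ L = 0) (a b q : low d M → S) (hz : ∀ i, hev F d (a i) (b i) (q i) = 0)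
    (hprim : ∀ i, π (a i) ≠ 0 ∨ π (b i) ≠ 0 ∨ π (q i) ≠ 0)
    (N : ℕ) (hN : ∑ z, wt (map π F) d z ≤ N) (e T : ℕ)
    (he : e + N * ∑ l ∈ Finset.range T, (T - l) ≤ (low d M).card * T) :
    ϖ ^ e ∣ (imat d M a b q).det := by
  classical
  have hdiv : ∀ x, ϖ ∣ x → π x = 0 := by
    rintro _ ⟨y, rfl⟩; rw [map_mul, hϖ, zero_mul]
  have ha : ∀ i, π (q i) = 0 → π (a i) ≠ 0 := by
    intro i hq h
    have h1 := congrArg π (hz i)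
    rw [hev_map, hq, h, hev_top, map_zero, mul_eq_zero] at h1
    rcases h1 with h1 | h1
    · exact hc h1
    · rcases hprim i with h2 | h2 | h2
      · exact h2 h
      · exact h2 (eq_zero_of_pow_eq_zero h1)
      · exact h2 hq
  let cl : low d M → (Fin 2 → ZMod p) ⊕ ZMod p := fun i =>
    if π (q i) ≠ 0 then .inl ![π (a i) / π (q i), π (b i) / π (q i)] else .inr (π (b i) / π (a i))
  refine det_dvd_classes ϖ (imat d M a b q) (wt (map π F) d) cl L ?_ N hN e T (by simpa using he)
  have key : ∀ i, π (q i) ≠ 0 → ∀ α β, π α = π (a i) / π (q i) → π β = π (b i) / π (q i) → 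
      ∃ u v, ϖ ∣ u ∧ ϖ ∣ v ∧ eval ![α + u, β + v] F = 0 ∧ 
      ∀ j : low d M, imat d M a b q i j = q i ^ M * ((α + u) ^ j.1.1 * (β + v) ^ j.1.2) := by
    intro i hq α β hα hβ
    obtain ⟨q', hq'⟩ := (hunit _ hq).exists_right_inv
    have hq2 : π q' = (π (q i))⁻¹ := by
      have := congrArg π hq'
      rw [map_mul, map_one] at this
      exact eq_inv_of_mul_eq_one_right this
    refine ⟨a i * q' - α, b i * q' - β, hker _ ?_, hker _ ?_, ?_, ?_⟩
    · rw [map_sub, map_mul, hq2, hα, div_eq_mul_inv, sub_self]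
    · rw [map_sub, map_mul, hq2, hβ, div_eq_mul_inv, sub_self]
    · have h1 := hz i
      have h2 := hev_smul F d q' (a i) (b i) (q i)
      rw [h1, mul_zero, mul_comm q' (q i), hq', hev_one F hF] at h2
      rw [← h2]; congr 2; simp [mul_comm]
    · intro j
      have := (mem_low.1 j.2).1
      have e1 : q i ^ M = q i ^ j.1.1 * q i ^ j.1.2 * q i ^ (M - j.1.1 - j.1.2) := by
        rw [← pow_add, ← pow_add]; congr 1; omega
      have e2 : a i = q i * (α + (a i * q' - α)) := by linear_combination (-a i) * hq'
      have e3 : b i = q i * (β + (b i * q' - β)) := by linear_combination (-b i) * hq'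
      simp only [imat, Matrix.of_apply]
      rw [e1]
      generalize (α + (a i * q' - α)) = x at *
      generalize (β + (b i * q' - β)) = y at *
      rw [e2, e3]; ring
  have hclq : ∀ i z, cl i = Sum.inl z → π (q i) ≠ 0 ∧ z = ![π (a i) / π (q i), π (b i) / π (q i)] := by
    intro i z h
    by_cases hq : π (q i) ≠ 0
    · simp only [cl, if_pos hq, Sum.inl.injEq] at h
      exact ⟨hq, h.symm⟩
    · simp only [cl, if_neg hq] at h
      exact absurd h (by simp)
  rintro (z | t)
  · obtain ⟨α, hα⟩ := hπ (z 0)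
    obtain ⟨β, hβ⟩ := hπ (z 1)
    have hzz : z = ![π α, π β] := by
      rw [hα, hβ]; funext i; fin_cases i <;> rfl
    by_cases h1 : eval z (map π F) ≠ 0
    · refine ⟨fun _ _ _ => 0, fun i hi => ?_⟩
      exfalso
      obtain ⟨hq, hz'⟩ := hclq i z hi
      obtain ⟨u, v, hu, hv, h0, -⟩ := key i hq α β (by rw [hα, hz']; rfl) (by rw [hβ, hz']; rfl)
      have := congrArg π h0
      rw [map_eval', map_add, map_add, hdiv u hu, hdiv v hv, add_zero, add_zero, ← hzz, map_zero] at this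
      exact h1 this
    · by_cases h2 : eval z (pderiv 1 (map π F)) ≠ 0
      · have hw : wt (map π F) d (Sum.inl z) = 1 := by simp only [wt, if_neg h1, if_pos h2]
        rw [hw]
        obtain ⟨C, hC⟩ := class_smooth π ϖ hϖ hker hunit F α β (by
          rw [map_eval', ← hzz, ← pderiv_map]; exact h2) L hL (fun j : low d M => j.1.1) (fun j => j.1.2)
        refine ⟨C, fun i hi => ?_⟩
        obtain ⟨hq, hz'⟩ := hclq i z hi
        obtain ⟨u, v, hu, hv, h0, h3⟩ := key i hq α β (by rw [hα, hz']; rfl) (by rw [hβ, hz']; rfl)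
        obtain ⟨R, hR1, hR2⟩ := hC (q i ^ M) u v hu hv h0
        exact ⟨R, hR1, fun j => by rw [h3, hR2]⟩
      · have hw : wt (map π F) d (Sum.inl z) = d := by simp only [wt, if_neg h1, if_neg h2]
        rw [hw]
        obtain ⟨C, hC⟩ := class_sing ϖ L hL d (fun j : low d M => j.1.1) (fun j => j.1.2)
          (fun j => (mem_low.1 j.2).2) α β
        refine ⟨C, fun i hi => ?_⟩
        obtain ⟨hq, hz'⟩ := hclq i z hi
        obtain ⟨u, v, hu, hv, h0, h3⟩ := key i hq α β (by rw [hα, hz']; rfl) (by rw [hβ, hz']; rfl)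
        obtain ⟨R, hR1, hR2⟩ := hC (q i ^ M) u v hu
        exact ⟨R, hR1, fun j => by rw [h3, hR2]⟩
  · have hclt : ∀ i, cl i = Sum.inr t → π (q i) = 0 ∧ t = π (b i) / π (a i) := by
      intro i h
      by_cases hq : π (q i) ≠ 0
      · simp only [cl, if_pos hq] at h
        exact absurd h (by simp)
      · simp only [cl, if_neg hq, Sum.inr.injEq] at h
        exact ⟨not_not.1 hq, h.symm⟩
    by_cases h1 : hev (map π F) d 1 t 0 ≠ 0
    · refine ⟨fun _ _ _ => 0, fun i hi => ?_⟩
      exfalso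
      obtain ⟨hq, ht⟩ := hclt i hi
      have h2 := congrArg π (hz i)
      have h3 := hev_smul (map π F) d (π (a i)) 1 t 0
      rw [ht, mul_one, mul_zero, mul_div_cancel₀ _ (ha i hq), ← hq, ← hev_map, h2, map_zero] at h3
      rcases mul_eq_zero.1 h3.symm with h4 | h4
      · exact ha i hq (eq_zero_of_pow_eq_zero h4)
      · rw [hq, ← ht] at h4
        exact h1 h4
    · have hw : wt (map π F) d (Sum.inr t) = d := by simp only [wt, if_neg h1]
      rw [hw]
      obtain ⟨C, hC⟩ := class_sing ϖ L hL d (fun j : low d M => M - j.1.1 - j.1.2) (fun j => j.1.2)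
          (fun j => (mem_low.1 j.2).2) 0 0
      refine ⟨C, fun i hi => ?_⟩
      obtain ⟨hq, ht⟩ := hclt i hi
      obtain ⟨a', ha'⟩ := (hunit _ (ha i hq)).exists_right_inv
      obtain ⟨R, hR1, hR2⟩ := hC (a i ^ M) (q i * a') (b i * a') (Dvd.dvd.mul_right (hker _ hq) _)
      refine ⟨R, hR1, fun j => ?_⟩
      rw [← hR2]
      have := (mem_low.1 j.2).1
      have e1 : a i ^ M = a i ^ j.1.1 * a i ^ j.1.2 * a i ^ (M - j.1.1 - j.1.2) := by
        rw [← pow_add, ← pow_add]; congr 1; omega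
      have e2 : q i = a i * (0 + q i * a') := by linear_combination (-q i) * ha'
      have e3 : b i = a i * (0 + b i * a') := by linear_combination (-b i) * ha'
      simp only [imat, Matrix.of_apply]
      rw [e1]
      generalize (0 + q i * a') = x at *
      generalize (0 + b i * a') = y at *
      rw [e2, e3]; ring

end

theorem padic {p : ℕ} [Fact p.Prime] {F : MvPolynomial (Fin 2) ℤ} {d M : ℕ} (hd1 : 1 ≤ d) (hF : F.totalDegree ≤ d)
    (hp : 64 * d ^ 4 ≤ p) (hirr : Irreducible (map (Int.castRingHom (ZMod p)) F))
    (hc : ¬ (p : ℤ) ∣ coeff (mon (0, d)) F) (a b q : low d M → ℤ)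
    (hz : ∀ i, hev F d (a i) (b i) (q i) = 0)
    (hprim : ∀ i, ¬ ((p : ℤ) ∣ a i ∧ (p : ℤ) ∣ b i ∧ (p : ℤ) ∣ q i)) :
    ∃ e : ℕ, (((low d M).card : ℝ) ^ 2 / (2 * ((p + 9 * d ^ 2 * Nat.sqrt p : ℕ) : ℝ)) - (low d M).card ≤ e) ∧
      (p : ℤ) ^ e ∣ (imat d M a b q).det := by
  have hpp := Fact.out (p := p.Prime)
  obtain ⟨e, he, T, hT⟩ := exp_bound (low d M).card (p + 9 * d ^ 2 * Nat.sqrt p) (by have := hpp.pos; omega)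
  refine ⟨e, he, ?_⟩
  let π : ZMod (p ^ (e + 1)) →+* ZMod p := ZMod.castHom (dvd_pow_self p (by omega)) (ZMod p)
  have : NeZero (p ^ (e + 1)) := ⟨pow_ne_zero _ hpp.ne_zero⟩
  let ψ : ℤ →+* ZMod (p ^ (e + 1)) := Int.castRingHom _
  have hπψ : ∀ x : ℤ, π (ψ x) = (x : ZMod p) := fun x => by simp [π, ψ]
  have hmm : map π (map ψ F) = map (Int.castRingHom (ZMod p)) F := by
    rw [map_map]; congr 2; exact Subsingleton.elim _ _
  have hc' : coeff (mon (0, d)) (map (Int.castRingHom (ZMod p)) F) ≠ 0 := by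
    rw [coeff_map, eq_intCast, Ne, ZMod.intCast_zmod_eq_zero_iff_dvd]; exact hc
  have hval : ∀ x : ZMod (p ^ (e + 1)), π x = (x.val : ZMod p) := by
    intro x
    conv_lhs => rw [← ZMod.natCast_zmod_val x]
    rw [map_natCast]
  have main := padic_gen π (ZMod.castHom_surjective _) (p : ZMod (p ^ (e + 1))) (by simp) (by
      intro x hx
      rw [hval, ZMod.natCast_eq_zero_iff] at hx
      rw [← ZMod.natCast_zmod_val x]
      exact_mod_cast (Nat.cast_dvd_cast hx)) (by
      intro x hx
      rw [hval, Ne, ZMod.natCast_eq_zero_iff] at hx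
      rw [← ZMod.natCast_zmod_val x, ZMod.isUnit_iff_coprime]
      exact ((Nat.Prime.coprime_iff_not_dvd hpp).2 hx).symm.pow_right _) (map ψ F) (d := d) (M := M)
      (totalDegree_map_le' _ hF) (by rw [hmm]; exact hc') (e + 1) (by
        have := ZMod.natCast_self (p ^ (e + 1))
        rwa [Nat.cast_pow] at this) (fun i => ψ (a i)) (fun i => ψ (b i)) (fun i => ψ (q i)) (by
        intro i; rw [← hev_map, hz, map_zero]) (by
        intro i
        have := hprim i
        simp only [hπψ, Ne, ZMod.intCast_zmod_eq_zero_iff_dvd]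
        tauto) _ (by rw [hmm]; exact wt_sum hirr hd1 (totalDegree_map_le' _ hF) hc' hp) e T hT
  have hmap : imat d M (fun i => ψ (a i)) (fun i => ψ (b i)) (fun i => ψ (q i)) = (imat d M a b q).map ψ := by
    ext i j; simp [imat]
  rw [hmap, ← RingHom.mapMatrix_apply, ← RingHom.map_det] at main
  obtain ⟨x, hx⟩ := main
  obtain ⟨y, rfl⟩ := ZMod.intCast_surjective x
  have h1 : (((imat d M a b q).det - p ^ e * y : ℤ) : ZMod (p ^ (e + 1))) = 0 := by
    have : ψ (imat d M a b q).det = ((imat d M a b q).det : ZMod (p ^ (e + 1))) := rfl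
    rw [this] at hx
    rw [Int.cast_sub, hx]; push_cast; ring
  rw [ZMod.intCast_zmod_eq_zero_iff_dvd] at h1
  have h2 : (p : ℤ) ^ e ∣ (imat d M a b q).det - p ^ e * y := by
    refine dvd_trans ?_ h1
    push_cast
    exact pow_dvd_pow _ (by omega)
  have := dvd_add h2 (Dvd.intro y rfl)
  rwa [sub_add_cancel] at this

end PCB

-- Module M7
namespace PCB
open MvPolynomial

lemma det_tri {n : Type*} [Fintype n] [DecidableEq n] {R : Type*} [CommRing R] (A : Matrix n n R) (h : n → ℕ)
    (hA : ∀ i j, i ≠ j → A i j ≠ 0 → h i < h j) : A.det = ∏ i, A i i := by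
  rw [Matrix.det_apply, Finset.sum_eq_single 1]
  · simp
  · intro σ _ hσ
    by_cases h0 : ∏ i, A (σ i) i = 0
    · rw [h0, smul_zero]
    exfalso
    have h1 : ∀ i, A (σ i) i ≠ 0 := by
      intro i hi
      exact h0 (Finset.prod_eq_zero (Finset.mem_univ i) hi)
    have h2 : ∀ i, h (σ i) ≤ h i := by
      intro i
      by_cases hi : σ i = i
      · rw [hi]
      · exact (hA _ _ hi (h1 i)).le
    obtain ⟨i, hi⟩ : ∃ i, σ i ≠ i := by
      by_contra! hh
      exact hσ (Equiv.ext hh)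
    have h3 : ∑ i, h (σ i) < ∑ i, h i :=
      Finset.sum_lt_sum (fun i _ => h2 i) ⟨i, Finset.mem_univ i, hA _ _ hi (h1 i)⟩
    rw [Equiv.sum_comp σ h] at h3
    exact lt_irrefl _ h3
  · simp

theorem lattice_abs {I J K : Type} [Fintype I] [Fintype J] [Fintype K] [DecidableEq I] [DecidableEq J] [DecidableEq K]
    (σ : I ⊕ J ≃ K) (μ : (I → ℤ) →ₗ[ℤ] (K → ℤ)) (hμ : Function.Injective μ)
    (hsat : ∀ (n : ℤ) (v : K → ℤ), n ≠ 0 → n • v ∈ LinearMap.range μ → v ∈ LinearMap.range μ)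
    (E : J → (K → ℤ) →ₗ[ℤ] ℤ) (hE : ∀ j h, E j (μ h) = 0) :
    (Matrix.of fun r k : I ⊕ J => Sum.elim (fun α => μ (Pi.single α 1)) (fun j => (Pi.single (σ (Sum.inr j)) 1 : K → ℤ)) k (σ r)).det
      ∣ (Matrix.of fun i j : J => E i (Pi.single (σ (Sum.inr j)) 1)).det := by
  set W := LinearMap.range μ with hW
  set g : I ⊕ J → (K → ℤ) := Sum.elim (fun α => μ (Pi.single α 1)) (fun j => (Pi.single (σ (Sum.inr j)) 1 : K → ℤ)) with hg
  let bW : Module.Basis I ℤ W := (Pi.basisFun ℤ I).map (LinearEquiv.ofInjective μ hμ)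
  have hbW : ∀ α, (bW α : K → ℤ) = μ (Pi.single α 1) := by
    intro α
    simp only [bW, Module.Basis.map_apply, Pi.basisFun_apply]
    rfl
  have htf : Module.IsTorsionFree ℤ ((K → ℤ) ⧸ W) := by
    rw [Module.isTorsionFree_iff_smul_eq_zero]
    intro n x hx
    obtain ⟨v, rfl⟩ := Submodule.Quotient.mk_surjective _ x
    by_cases hn : n = 0
    · exact Or.inl hn
    · right
      rw [← Submodule.Quotient.mk_smul, Submodule.Quotient.mk_eq_zero] at hx
      rw [Submodule.Quotient.mk_eq_zero]
      exact hsat n v hn hx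
  have hfree : Module.Free ℤ ((K → ℤ) ⧸ W) := Module.free_iff_isTorsionFree.2 htf
  have hrank : Module.finrank ℤ ((K → ℤ) ⧸ W) = Fintype.card J := by
    have h1 := Submodule.finrank_quotient_add_finrank W
    rw [Module.finrank_eq_card_basis bW, Module.finrank_fintype_fun_eq_card, ← Fintype.card_congr σ, Fintype.card_sum] at h1
    omega
  let bQ : Module.Basis J ℤ ((K → ℤ) ⧸ W) := (Module.finBasisOfFinrankEq ℤ _ hrank).reindex (Fintype.equivFin J).symm
  let B := Module.Basis.sumQuot bW bQ
  let b0 : Module.Basis (I ⊕ J) ℤ (K → ℤ) := (Pi.basisFun ℤ K).reindex σ.symm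
  have h1 : b0.toMatrix g = Matrix.of fun r k => g k (σ r) := by
    ext r k; simp [b0, Module.Basis.toMatrix_apply]
  have h2 : B.toMatrix b0 * b0.toMatrix g = B.toMatrix g := Module.Basis.toMatrix_mul_toMatrix _ _ _
  let Q : Matrix J J ℤ := Matrix.of fun k j => bQ.repr (W.mkQ (Pi.single (σ (Sum.inr j)) 1)) k
  have h3 : B.toMatrix g = Matrix.fromBlocks 1 (Matrix.of fun i j => B.repr (Pi.single (σ (Sum.inr j)) 1) (Sum.inl i)) 0 Q := by
    ext r k
    rw [Module.Basis.toMatrix_apply]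
    rcases k with α | j
    · have e1 : g (Sum.inl α) = B (Sum.inl α) := by
        simp only [hg, Sum.elim_inl, B, Module.Basis.sumQuot_inl, hbW]
      rw [e1, Module.Basis.repr_self, Finsupp.single_apply]
      rcases r with r | r
      · simp [Matrix.one_apply, eq_comm]
      · simp
    · rcases r with r | r
      · simp [hg]
      · simp [hg, Q, B]
  have h4 : (B.toMatrix g).det = Q.det := by
    rw [h3, Matrix.det_fromBlocks_zero₂₁, Matrix.det_one, one_mul]
  let P : Matrix J J ℤ := Matrix.of fun i k => W.liftQ (E i) (by
    rintro _ ⟨h, rfl⟩; exact hE i h) (bQ k)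
  have h5 : (Matrix.of fun i j : J => E i (Pi.single (σ (Sum.inr j)) 1)) = P * Q := by
    ext i j
    rw [Matrix.mul_apply]
    simp only [Matrix.of_apply, P, Q]
    have e1 := bQ.sum_repr (W.mkQ (Pi.single (σ (Sum.inr j)) 1))
    have e2 := congrArg (W.liftQ (E i) (by rintro _ ⟨h, rfl⟩; exact hE i h)) e1
    rw [map_sum, Submodule.mkQ_apply, Submodule.liftQ_apply] at e2
    rw [← e2]
    refine Finset.sum_congr rfl fun k _ => ?_
    rw [map_smul, smul_eq_mul, mul_comm]
    rfl
  rw [h5, Matrix.det_mul, ← h4, ← h2, Matrix.det_mul, h1]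
  exact Dvd.dvd.mul_left (Dvd.dvd.mul_left dvd_rfl _) _

lemma gauss {F : MvPolynomial (Fin 2) ℤ} (hprim : ∀ p : ℤ, Prime p → ¬ C p ∣ F) (n : ℤ) (hn : n ≠ 0) :
    ∀ h : MvPolynomial (Fin 2) ℤ, C n ∣ F * h → C n ∣ h := by
  induction n using UniqueFactorizationMonoid.induction_on_prime with
  | h₁ => exact absurd rfl hn
  | h₂ x hx => intro h _; exact (hx.map C).dvd
  | h₃ a p ha hp ih =>
    intro h hh
    rw [C_mul] at hh ⊢
    have hpC : Prime (C p : MvPolynomial (Fin 2) ℤ) := (MvPolynomial.prime_C_iff _).2 hp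
    rcases hpC.dvd_or_dvd ((Dvd.intro _ rfl).trans hh) with h1 | ⟨h', rfl⟩
    · exact absurd h1 (hprim p hp)
    · refine mul_dvd_mul_left _ (ih ha h' ?_)
      rw [mul_left_comm] at hh
      exact (mul_dvd_mul_iff_left hpC.ne_zero).1 hh

section
variable {S : Type*} [CommRing S]

lemma hev_xm {M : ℕ} {r : ℕ × ℕ} (hr : r ∈ tri M) (a b q : S) :
    hev (xm S r) M a b q = a ^ r.1 * b ^ r.2 * q ^ (M - r.1 - r.2) := by
  classical
  rw [hev, Finset.sum_eq_single r]
  · simp [coeff_monomial]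
  · intro r' _ hne
    rw [coeff_monomial, if_neg (fun h => hne (mon_injective h.symm)), zero_mul]
  · intro h; exact absurd hr h

lemma hev_sum {ι : Type*} (s : Finset ι) (t : ι → S) (G : ι → MvPolynomial (Fin 2) S) (M : ℕ) (a b q : S) :
    hev (∑ i ∈ s, t i • G i) M a b q = ∑ i ∈ s, t i * hev (G i) M a b q := by
  simp only [hev, coeff_sum, coeff_smul, smul_eq_mul, Finset.sum_mul, Finset.mul_sum]
  rw [Finset.sum_comm]
  exact Finset.sum_congr rfl fun i _ => Finset.sum_congr rfl fun r _ => by ring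

lemma hev_mul_xm {F : MvPolynomial (Fin 2) S} {d M : ℕ} (hF : F.totalDegree ≤ d) {α : ℕ × ℕ}
    (hα : α.1 + α.2 + d ≤ M) (a b q : S) :
    hev (F * xm S α) M a b q = hev F d a b q * (a ^ α.1 * b ^ α.2 * q ^ (M - d - α.1 - α.2)) := by
  have h1 : F * xm S α = ∑ r ∈ tri d, coeff (mon r) F • xm S (r + α) := by
    conv_lhs => rw [sum_xm_coeff F hF]
    rw [Finset.sum_mul]
    refine Finset.sum_congr rfl fun r _ => ?_
    rw [smul_mul_assoc, monomial_mul, ← mon_add, one_mul]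
  rw [h1, hev_sum, hev, Finset.sum_mul]
  refine Finset.sum_congr rfl fun r hr => ?_
  have := mem_tri.1 hr
  rw [hev_xm (mem_tri.2 (by simp only [Prod.fst_add, Prod.snd_add]; omega))]
  have e1 : M - (r + α).1 - (r + α).2 = (d - r.1 - r.2) + (M - d - α.1 - α.2) := by
    simp only [Prod.fst_add, Prod.snd_add]; omega
  rw [e1, Prod.fst_add, Prod.snd_add]
  ring
end

/-- the index bijection -/
def sigF (d M : ℕ) (h : d ≤ M) : tri (M - d) ⊕ low d M → tri M
  | .inl α => ⟨(α.1.1, α.1.2 + d), mem_tri.2 (by have := mem_tri.1 α.2; simp only; omega)⟩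
  | .inr j => ⟨j.1, mem_tri.2 (mem_low.1 j.2).1⟩

lemma sigF_bij (d M : ℕ) (h : d ≤ M) : Function.Bijective (sigF d M h) := by
  constructor
  · rintro (⟨⟨i, j⟩, h1⟩ | ⟨⟨i, j⟩, h1⟩) (⟨⟨i', j'⟩, h2⟩ | ⟨⟨i', j'⟩, h2⟩) he <;>
      simp only [sigF, Subtype.mk.injEq, Prod.mk.injEq] at he
    · obtain ⟨rfl, he⟩ := he
      have : j = j' := by omega
      subst this; rfl
    · have := (mem_low.1 h2).2
      simp only at this; omega
    · have := (mem_low.1 h1).2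
      simp only at this; omega
    · obtain ⟨rfl, rfl⟩ := he; rfl
  · rintro ⟨⟨i, j⟩, h1⟩
    have h1' := mem_tri.1 h1
    simp only at h1'
    by_cases hj : j < d
    · exact ⟨.inr ⟨(i, j), mem_low.2 ⟨h1', hj⟩⟩, rfl⟩
    · refine ⟨.inl ⟨(i, j - d), mem_tri.2 (by simp only; omega)⟩, ?_⟩
      simp only [sigF, Subtype.mk.injEq, Prod.mk.injEq, true_and]; omega

theorem lattice {F : MvPolynomial (Fin 2) ℤ} {d M : ℕ} (hF : F.totalDegree ≤ d) (hM : d ≤ M)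
    (hprim : ∀ p : ℤ, Prime p → ¬ C p ∣ F) (hc : coeff (mon (0, d)) F ≠ 0) (a b q : low d M → ℤ)
    (hz : ∀ i, hev F d (a i) (b i) (q i) = 0) :
    (coeff (mon (0, d)) F) ^ (tri (M - d)).card ∣ (imat d M a b q).det := by
  classical
  have hF0 : F ≠ 0 := by rintro rfl; simp at hc
  let σ : tri (M - d) ⊕ low d M ≃ tri M := Equiv.ofBijective _ (sigF_bij d M hM)
  let H : (tri (M - d) → ℤ) → MvPolynomial (Fin 2) ℤ := fun h => ∑ α : tri (M - d), h α • xm ℤ α.1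
  have hHc : ∀ h α, coeff (mon α.1) (H h) = h α := by
    intro h α
    simp only [H, coeff_sum, coeff_smul, coeff_monomial, smul_eq_mul]
    rw [Finset.sum_eq_single α]
    · simp
    · intro β _ hne
      rw [if_neg (fun h => hne (Subtype.ext (mon_injective h))), mul_zero]
    · simp
  have hHd : ∀ h, (H h).totalDegree ≤ M - d := by
    intro h
    refine totalDegree_finsetSum_le fun α _ => ?_
    exact (totalDegree_smul_le _ _).trans (totalDegree_xm_le (mem_tri.1 α.2))
  let μ : (tri (M - d) → ℤ) →ₗ[ℤ] (tri M → ℤ) :=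
    { toFun := fun h r => coeff (mon r.1) (F * H h)
      map_add' := by
        intro x y; funext r
        simp only [H, Pi.add_apply, add_smul, Finset.sum_add_distrib, mul_add, coeff_add]
      map_smul' := by
        intro c x; funext r
        have : H (c • x) = c • H x := by
          simp only [H, Pi.smul_apply, Finset.smul_sum, smul_assoc]
        rw [this, mul_smul_comm, coeff_smul]; rfl }
  have hμ : ∀ h r, μ h r = coeff (mon r.1) (F * H h) := fun h r => rfl
  have hdvd : ∀ (n : ℤ) h, (∀ r, n ∣ μ h r) → C n ∣ F * H h := by
    intro n h hh
    rw [C_dvd_iff_dvd_coeff]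
    intro m
    by_cases hm : m 0 + m 1 ≤ M
    · have := hh ⟨(m 0, m 1), mem_tri.2 hm⟩
      rwa [hμ, mon_eta] at this
    · have : coeff m (F * H h) = 0 := by
        by_contra h0
        have h1 := totalDegree_le_iff'.1 ((totalDegree_mul _ _).trans (Nat.add_le_add hF (hHd h))) m h0
        omega
      rw [this]; exact dvd_zero _
  have hinj : Function.Injective μ := by
    rw [← LinearMap.ker_eq_bot, LinearMap.ker_eq_bot']
    intro h h0
    have h1 := hdvd 0 h (fun r => by rw [h0]; simp)
    rw [C_0, zero_dvd_iff, mul_eq_zero] at h1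
    have h2 := h1.resolve_left hF0
    funext α
    rw [← hHc h α, h2]; simp
  have hsat : ∀ (n : ℤ) (v : tri M → ℤ), n ≠ 0 → n • v ∈ LinearMap.range μ → v ∈ LinearMap.range μ := by
    rintro n v hn ⟨h, hh⟩
    have h1 := gauss hprim n hn _ (hdvd n h (fun r => by rw [hh]; exact Dvd.intro _ rfl))
    rw [C_dvd_iff_dvd_coeff] at h1
    have h2 : ∀ α, n ∣ h α := fun α => by rw [← hHc h α]; exact h1 _
    choose h' hh' using h2
    refine ⟨h', ?_⟩
    have h3 : h = n • h' := funext hh'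
    rw [h3, map_smul] at hh
    exact smul_right_injective _ hn hh
  let E : low d M → (tri M → ℤ) →ₗ[ℤ] ℤ := fun i =>
    ∑ r : tri M, (a i ^ r.1.1 * b i ^ r.1.2 * q i ^ (M - r.1.1 - r.1.2)) • LinearMap.proj r
  have hEv : ∀ i v, E i v = ∑ r : tri M, v r * (a i ^ r.1.1 * b i ^ r.1.2 * q i ^ (M - r.1.1 - r.1.2)) := by
    intro i v; simp [E, LinearMap.sum_apply, mul_comm]
  have hE : ∀ j h, E j (μ h) = 0 := by
    intro i h
    rw [hEv]
    have e1 : ∑ r : tri M, μ h r * (a i ^ r.1.1 * b i ^ r.1.2 * q i ^ (M - r.1.1 - r.1.2)) =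
        hev (F * H h) M (a i) (b i) (q i) := by
      rw [hev, ← Finset.sum_coe_sort (tri M)]; rfl
    have e2 : F * H h = ∑ α : tri (M - d), h α • (F * xm ℤ α.1) := by
      simp only [H, Finset.mul_sum, mul_smul_comm]
    rw [e1, e2, hev_sum]
    refine Finset.sum_eq_zero fun α _ => ?_
    have := mem_tri.1 α.2
    rw [hev_mul_xm hF (by omega), hz, zero_mul, mul_zero]
  have main := lattice_abs σ μ hinj hsat E hE
  have hHs : ∀ α, H (Pi.single α 1) = xm ℤ α.1 := by
    intro α
    simp only [H]
    rw [Finset.sum_eq_single α]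
    · simp
    · intro β _ hne; simp [hne]
    · simp
  have himat : (Matrix.of fun i j : low d M => E i (Pi.single (σ (Sum.inr j)) 1)) = imat d M a b q := by
    ext i j
    simp only [Matrix.of_apply, hEv, imat]
    rw [Finset.sum_eq_single (σ (Sum.inr j))]
    · simp [σ, sigF]
    · intro r _ hne; simp [hne]
    · simp
  rw [himat, det_tri _ (fun k => (σ k).1.2)] at main
  · rw [Fintype.prod_sum_type] at main
    refine dvd_trans (dvd_trans (dvd_of_eq ?_) (dvd_mul_right _ _)) main
    rw [← Fintype.card_coe (tri (M - d)), ← Finset.card_univ, ← Finset.prod_const]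
    refine Finset.prod_congr rfl fun α _ => Eq.symm ?_
    simp only [Matrix.of_apply, Sum.elim_inl, hμ, hHs]
    have : mon (σ (Sum.inl α)).1 = mon (0, d) + mon α.1 := by
      rw [← mon_add]; congr 1
      simp only [σ, Equiv.ofBijective_apply, sigF]
      ext <;> simp [add_comm]
    rw [this, coeff_mul_monomial, mul_one]
  · intro r k hne h0
    rcases k with α | j
    · simp only [Matrix.of_apply, Sum.elim_inl, hμ, hHs] at h0
      rw [coeff_mul_monomial'] at h0
      split_ifs at h0 with hle
      · have h1 := totalDegree_le_iff'.1 hF _ (left_ne_zero_of_mul h0)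
        have h2 := hle 0
        have h3 := hle 1
        simp only [Finsupp.tsub_apply, mon_zero, mon_one] at h1 h2 h3
        have h4 : (σ (Sum.inl α)).1.2 = α.1.2 + d := rfl
        have h5 : (σ (Sum.inl α)).1.1 = α.1.1 := rfl
        rcases Nat.lt_or_ge (σ r).1.2 (σ (Sum.inl α)).1.2 with h6 | h6
        · exact h6
        · exfalso
          apply hne
          apply σ.injective
          apply Subtype.ext
          ext <;> omega
      · exact absurd rfl h0
    · simp only [Matrix.of_apply, Sum.elim_inr] at h0
      exfalso
      apply hne
      apply σ.injective
      by_contra h1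
      rw [Pi.single_eq_of_ne h1] at h0
      exact h0 rfl

end PCB

-- Module M8
namespace PCB
open MvPolynomial

lemma theta_le (n : ℕ) : ∑ p ∈ Nat.primesLE n, Real.log p ≤ Real.log 4 * n := by
  rw [← Chebyshev.theta_eq_sum_primesLE_log]
  exact Chebyshev.theta_le_log4_mul_x (by positivity)

lemma log_four_lt : Real.log 4 < 1.4 := by
  have : Real.log 4 = 2 * Real.log 2 := by
    rw [show (4 : ℝ) = 2 ^ 2 by norm_num, Real.log_pow]; norm_num
  have := Real.log_two_lt_d9
  linarith

/-- tail of `∑ log p / p^{3/2}` -/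
lemma tail_sum (n : ℕ) : ∀ k y : ℕ, 1 ≤ y → n ≤ y + k →
    ∑ p ∈ (Nat.primesLE n).filter (fun p => y ≤ p), Real.log p / (p * Real.sqrt p) ≤ 10 / Real.sqrt y := by
  intro k
  induction k using Nat.strong_induction_on with
  | _ k ih =>
    intro y hy hn
    have hy0 : (0 : ℝ) < y := by exact_mod_cast hy
    have hsy : 0 < Real.sqrt y := Real.sqrt_pos.2 hy0
    -- split
    have hsplit : ∑ p ∈ (Nat.primesLE n).filter (fun p => y ≤ p), Real.log p / (p * Real.sqrt p) =
        ∑ p ∈ ((Nat.primesLE n).filter (fun p => y ≤ p)).filter (fun p => p < 2 * y), Real.log p / (p * Real.sqrt p) +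
        ∑ p ∈ ((Nat.primesLE n).filter (fun p => y ≤ p)).filter (fun p => ¬ p < 2 * y), Real.log p / (p * Real.sqrt p) :=
      (Finset.sum_filter_add_sum_filter_not _ _ _).symm
    have h1 : ∑ p ∈ ((Nat.primesLE n).filter (fun p => y ≤ p)).filter (fun p => p < 2 * y), Real.log p / (p * Real.sqrt p)
        ≤ 2.8 / Real.sqrt y := by
      calc _ ≤ ∑ p ∈ ((Nat.primesLE n).filter (fun p => y ≤ p)).filter (fun p => p < 2 * y), Real.log p / (y * Real.sqrt y) := by
            refine Finset.sum_le_sum fun p hp => ?_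
            simp only [Finset.mem_filter] at hp
            have hpy : (y : ℝ) ≤ p := by exact_mod_cast hp.1.2
            have := Real.sqrt_le_sqrt hpy
            have hl : 0 ≤ Real.log p := Real.log_natCast_nonneg p
            gcongr
        _ ≤ ∑ p ∈ Nat.primesLE (2 * y), Real.log p / (y * Real.sqrt y) := by
            refine Finset.sum_le_sum_of_subset_of_nonneg ?_ ?_
            · intro p hp
              simp only [Finset.mem_filter, Nat.mem_primesLE] at hp ⊢
              exact ⟨by omega, hp.1.1.2⟩
            · intro p _ _
              have hl : 0 ≤ Real.log p := Real.log_natCast_nonneg p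
              positivity
        _ = (∑ p ∈ Nat.primesLE (2 * y), Real.log p) / (y * Real.sqrt y) := by rw [Finset.sum_div]
        _ ≤ (1.4 * (2 * y)) / (y * Real.sqrt y) := by
            have := theta_le (2 * y)
            push_cast at this
            have h4 := log_four_lt
            gcongr
            nlinarith
        _ = 2.8 / Real.sqrt y := by field_simp; norm_num
    have h2 : ∑ p ∈ ((Nat.primesLE n).filter (fun p => y ≤ p)).filter (fun p => ¬ p < 2 * y), Real.log p / (p * Real.sqrt p)
        ≤ 7.2 / Real.sqrt y := by
      have hset : ((Nat.primesLE n).filter (fun p => y ≤ p)).filter (fun p => ¬ p < 2 * y) =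
          (Nat.primesLE n).filter (fun p => 2 * y ≤ p) := by
        ext p; simp only [Finset.mem_filter]; constructor
        · rintro ⟨⟨h, _⟩, h'⟩; exact ⟨h, by omega⟩
        · rintro ⟨h, h'⟩; exact ⟨⟨h, by omega⟩, by omega⟩
      rw [hset]
      by_cases hk : k = 0
      · rw [Finset.sum_eq_zero]
        · positivity
        · intro p hp
          simp only [Finset.mem_filter, Nat.mem_primesLE] at hp
          omega
      · refine (ih (k - 1) (by omega) (2 * y) (by omega) (by omega)).trans ?_
        push_cast
        rw [Real.sqrt_mul (by norm_num), div_le_div_iff₀ (by positivity) hsy]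
        have : (1.4 : ℝ) ≤ Real.sqrt 2 := Real.le_sqrt_of_sq_le (by norm_num)
        nlinarith
    rw [hsplit]
    calc _ ≤ 2.8 / Real.sqrt y + 7.2 / Real.sqrt y := add_le_add h1 h2
      _ = 10 / Real.sqrt y := by rw [← add_div]; norm_num

lemma tail_sum' (n y : ℕ) (hy : 1 ≤ y) :
    ∑ p ∈ (Nat.primesLE n).filter (fun p => y ≤ p), Real.log p / (p * Real.sqrt p) ≤ 10 / Real.sqrt y :=
  tail_sum n n y hy (by omega)

lemma log_factorial_eq (n : ℕ) : Real.log (n.factorial : ℝ) =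
    ∑ p ∈ Nat.primesLE n, (padicValNat p n.factorial : ℝ) * Real.log p := by
  have h1 : ((n.factorial : ℕ) : ℝ) = ∏ p ∈ Nat.primesLE n, (p : ℝ) ^ padicValNat p n.factorial := by
    have h2 := Nat.prod_factorization_pow_eq_self (Nat.factorial_ne_zero n)
    rw [Finsupp.prod, Nat.support_factorization] at h2
    have h3 : n.factorial.primeFactors = Nat.primesLE n := by
      ext p
      simp only [Nat.mem_primeFactors, Nat.mem_primesLE]
      constructor
      · rintro ⟨hp, h, _⟩; exact ⟨(hp.dvd_factorial).1 h, hp⟩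
      · rintro ⟨h, hp⟩; exact ⟨hp, (hp.dvd_factorial).2 h, Nat.factorial_ne_zero n⟩
    rw [h3] at h2
    rw [← h2]
    push_cast
    refine Finset.prod_congr rfl fun p hp => ?_
    rw [h2, Nat.factorization_def _ (Nat.mem_primesLE.1 hp).2]
  rw [h1, Real.log_prod]
  · exact Finset.sum_congr rfl fun p _ => Real.log_pow _ _
  · intro p hp
    have := (Nat.mem_primesLE.1 hp).2.pos
    positivity

lemma mertens_upper (n : ℕ) (hn : 1 ≤ n) : ∑ p ∈ Nat.primesLE n, Real.log p / p ≤ Real.log n + 2 := by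
  have hn0 : (0 : ℝ) < n := by exact_mod_cast hn
  have h1 : Real.log (n.factorial : ℝ) ≤ n * Real.log n := by
    rw [← Real.log_pow]
    apply Real.log_le_log (by exact_mod_cast Nat.factorial_pos n)
    exact_mod_cast Nat.factorial_le_pow n
  rw [log_factorial_eq] at h1
  have h2 : ∑ p ∈ Nat.primesLE n, ((n : ℝ) * (Real.log p / p) - Real.log p) ≤
      ∑ p ∈ Nat.primesLE n, (padicValNat p n.factorial : ℝ) * Real.log p := by
    refine Finset.sum_le_sum fun p hp => ?_
    obtain ⟨hpn, hpp⟩ := Nat.mem_primesLE.1 hp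
    have hfact : Fact p.Prime := ⟨hpp⟩
    have hl : 0 ≤ Real.log p := Real.log_natCast_nonneg p
    have e1 : n / p ≤ padicValNat p n.factorial := by
      rw [padicValNat_factorial (b := Nat.log p n + 2) (by omega)]
      have := Finset.single_le_sum (f := fun i => n / p ^ i) (s := Finset.Ico 1 (Nat.log p n + 2)) (fun i _ => Nat.zero_le _)
        (Finset.mem_Ico.2 ⟨le_refl 1, by omega⟩)
      simpa using this
    have e2 : (n : ℝ) / p - 1 ≤ padicValNat p n.factorial := by
      have e3 : (n : ℝ) / p < (n / p : ℕ) + 1 := by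
        have hp0 : (0 : ℝ) < p := by exact_mod_cast hpp.pos
        rw [div_lt_iff₀ hp0]
        have := Nat.lt_div_mul_add hpp.pos (a := n)
        have h' : (n : ℝ) < (n / p : ℕ) * p + p := by exact_mod_cast this
        linarith
      have e4 : ((n / p : ℕ) : ℝ) ≤ padicValNat p n.factorial := by exact_mod_cast e1
      linarith
    calc (n : ℝ) * (Real.log p / p) - Real.log p = ((n : ℝ) / p - 1) * Real.log p := by ring
      _ ≤ _ := by gcongr
  rw [Finset.sum_sub_distrib, ← Finset.mul_sum] at h2
  have h3 := theta_le n
  have h4 := log_four_lt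
  have h5 : (n : ℝ) * ∑ p ∈ Nat.primesLE n, Real.log p / p ≤ n * (Real.log n + 2) := by nlinarith
  exact le_of_mul_le_mul_left h5 hn0

lemma mertens_lower (n : ℕ) (hn : 1 ≤ n) : Real.log n - 21 ≤ ∑ p ∈ Nat.primesLE n, Real.log p / p := by
  have hn0 : (0 : ℝ) < n := by exact_mod_cast hn
  have h1 : n * (Real.log n - 1) ≤ Real.log (n.factorial : ℝ) := by
    have := Stirling.le_log_factorial_stirling (n := n) (by omega)
    have h2 : 0 ≤ Real.log n := Real.log_natCast_nonneg n
    have h3 : 0 ≤ Real.log (2 * Real.pi) := Real.log_nonneg (by linarith [Real.pi_gt_three])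
    nlinarith
  rw [log_factorial_eq] at h1
  have h2 : ∑ p ∈ Nat.primesLE n, (padicValNat p n.factorial : ℝ) * Real.log p ≤
      ∑ p ∈ Nat.primesLE n, (n : ℝ) * (Real.log p / p + 2 * (Real.log p / (p * Real.sqrt p))) := by
    refine Finset.sum_le_sum fun p hp => ?_
    obtain ⟨hpn, hpp⟩ := Nat.mem_primesLE.1 hp
    have hfact : Fact p.Prime := ⟨hpp⟩
    have hl : 0 ≤ Real.log p := Real.log_natCast_nonneg p
    have hp2 : (2 : ℝ) ≤ p := by exact_mod_cast hpp.two_le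
    have e1 : ((p : ℝ) - 1) * padicValNat p n.factorial ≤ n := by
      have := sub_one_mul_padicValNat_factorial (p := p) n
      have h' : (p - 1) * padicValNat p n.factorial ≤ n := by omega
      have h'' : (((p - 1 : ℕ) : ℝ)) * padicValNat p n.factorial ≤ n := by exact_mod_cast h'
      rwa [Nat.cast_sub hpp.one_le, Nat.cast_one] at h''
    have e2 : (padicValNat p n.factorial : ℝ) ≤ n / (p - 1) := by
      rw [le_div_iff₀ (by linarith)]; linarith
    have hs : 0 < Real.sqrt p := Real.sqrt_pos.2 (by linarith)
    have hss : Real.sqrt p * Real.sqrt p = p := Real.mul_self_sqrt (by linarith)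
    have e3 : (n : ℝ) / (p - 1) ≤ n * (1 / p + 2 * (1 / (p * Real.sqrt p))) := by
      have hs1 : 1 ≤ Real.sqrt p := Real.one_le_sqrt.2 (by linarith)
      have : (1 : ℝ) / (p - 1) ≤ 1 / p + 2 * (1 / (p * Real.sqrt p)) := by
        have e4 : 1 / (p : ℝ) + 2 * (1 / (p * Real.sqrt p)) = (Real.sqrt p + 2) / (p * Real.sqrt p) := by
          field_simp
        rw [e4, div_le_div_iff₀ (by linarith) (by positivity)]
        nlinarith
      calc (n : ℝ) / (p - 1) = n * (1 / (p - 1)) := by ring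
        _ ≤ _ := by gcongr
    calc (padicValNat p n.factorial : ℝ) * Real.log p ≤ (n * (1 / p + 2 * (1 / (p * Real.sqrt p)))) * Real.log p := by
          gcongr; exact e2.trans e3
      _ = _ := by ring
  rw [← Finset.mul_sum, Finset.sum_add_distrib, ← Finset.mul_sum] at h2
  have h3 := tail_sum' n 1 le_rfl
  rw [Finset.filter_true_of_mem (fun p hp => (Nat.mem_primesLE.1 hp).2.one_le)] at h3
  simp only [Nat.cast_one, Real.sqrt_one, div_one] at h3
  have h4 := le_of_mul_le_mul_left (h1.trans h2) hn0
  linarith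

/-- The main lower bound on the sum over good primes. -/
theorem good_primes (s y : ℕ) (hs : 1 ≤ s) (hy : 1 ≤ y) (n : ℤ) (hn : n ≠ 0) (A : ℝ) (hA0 : 0 ≤ A) (hA : A ≤ Real.sqrt y) :
    Real.log s - Real.log (y + Real.log |(n : ℝ)|) - 40 - 10 ≤
    ∑ p ∈ (Nat.primesLE s).filter (fun p => y ≤ p ∧ ¬ (p : ℤ) ∣ n), Real.log p / (p + A * Real.sqrt p) := by
  set L := Real.log |(n : ℝ)| with hL
  have hn1 : (1 : ℝ) ≤ |(n : ℝ)| := by exact_mod_cast Int.one_le_abs hn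
  have hL0 : 0 ≤ L := Real.log_nonneg hn1
  have hy1 : (1 : ℝ) ≤ y := by exact_mod_cast hy
  set z := ⌊y + L⌋₊ with hz
  have hz1 : 1 ≤ z := by rw [hz, Nat.one_le_floor_iff]; linarith
  have hzl : (z : ℝ) ≤ y + L := Nat.floor_le (by linarith)
  have hzu : y + L < z + 1 := Nat.lt_floor_add_one _
  set P := (Nat.primesLE s).filter (fun p => y ≤ p ∧ ¬ (p : ℤ) ∣ n) with hP
  have hnn : ∀ p : ℕ, 0 ≤ Real.log p / p := fun p => div_nonneg (Real.log_natCast_nonneg p) (Nat.cast_nonneg p)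
  -- compare 1/(p+A√p) with 1/p
  have h1 : ∑ p ∈ P, Real.log p / p - 10 ≤ ∑ p ∈ P, Real.log p / (p + A * Real.sqrt p) := by
    have e1 : ∑ p ∈ P, (Real.log p / p - A * (Real.log p / (p * Real.sqrt p))) ≤ ∑ p ∈ P, Real.log p / (p + A * Real.sqrt p) := by
      refine Finset.sum_le_sum fun p hp => ?_
      have hpp := (Nat.mem_primesLE.1 (Finset.mem_filter.1 hp).1).2
      have hp0 : (0 : ℝ) < p := by exact_mod_cast hpp.pos
      have hs0 : 0 < Real.sqrt p := Real.sqrt_pos.2 hp0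
      have hss : Real.sqrt p * Real.sqrt p = p := Real.mul_self_sqrt hp0.le
      have hl : 0 ≤ Real.log p := Real.log_natCast_nonneg p
      have : (1 : ℝ) / p - A * (1 / (p * Real.sqrt p)) ≤ 1 / (p + A * Real.sqrt p) := by
        have e4 : 1 / (p : ℝ) - A * (1 / (p * Real.sqrt p)) = (Real.sqrt p - A) / (p * Real.sqrt p) := by
          field_simp
        rw [e4, div_le_div_iff₀ (by positivity) (by positivity)]
        nlinarith [mul_nonneg (mul_nonneg hA0 hA0) hs0.le]
      calc Real.log p / p - A * (Real.log p / (p * Real.sqrt p)) = Real.log p * ((1 : ℝ) / p - A * (1 / (p * Real.sqrt p))) := by ring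
        _ ≤ Real.log p * (1 / (p + A * Real.sqrt p)) := by gcongr
        _ = _ := by ring
    rw [Finset.sum_sub_distrib, ← Finset.mul_sum] at e1
    have e2 : ∑ p ∈ P, Real.log p / (p * Real.sqrt p) ≤ 10 / Real.sqrt y := by
      refine le_trans (Finset.sum_le_sum_of_subset_of_nonneg ?_ ?_) (tail_sum' s y hy)
      · intro p hp
        simp only [hP, Finset.mem_filter] at hp ⊢
        exact ⟨hp.1, hp.2.1⟩
      · intro p _ _
        have hl : 0 ≤ Real.log p := Real.log_natCast_nonneg p
        positivity
    have hsy : 0 < Real.sqrt y := Real.sqrt_pos.2 (by linarith)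
    have e3 : A * ∑ p ∈ P, Real.log p / (p * Real.sqrt p) ≤ 10 := by
      calc _ ≤ A * (10 / Real.sqrt y) := by gcongr
        _ ≤ Real.sqrt y * (10 / Real.sqrt y) := by gcongr
        _ = 10 := by field_simp
    linarith
  -- bad primes
  have h2 : ∑ p ∈ Nat.primesLE s, Real.log p / p ≤ ∑ p ∈ P, Real.log p / p +
      (∑ p ∈ Nat.primesLE z, Real.log p / p + ∑ p ∈ n.natAbs.primeFactors, Real.log p / (z + 1)) := by
    have e1 : ∑ p ∈ Nat.primesLE s, Real.log p / p = ∑ p ∈ P, Real.log p / p +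
        ∑ p ∈ (Nat.primesLE s).filter (fun p => ¬ (y ≤ p ∧ ¬ (p : ℤ) ∣ n)), Real.log p / p :=
      (Finset.sum_filter_add_sum_filter_not _ _ _).symm
    rw [e1]
    gcongr
    rw [← Finset.sum_filter_add_sum_filter_not _ (fun p => p ≤ z)]
    gcongr ?_ + ?_
    · refine Finset.sum_le_sum_of_subset_of_nonneg ?_ (fun p _ _ => hnn p)
      intro p hp
      simp only [Finset.mem_filter, Nat.mem_primesLE] at hp ⊢
      exact ⟨hp.2, hp.1.1.2⟩
    · have hyz : y ≤ z := by
        rw [hz]; exact Nat.le_floor (by linarith)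
      refine le_trans (Finset.sum_le_sum (g := fun p : ℕ => Real.log p / (z + 1)) ?_) (Finset.sum_le_sum_of_subset_of_nonneg ?_ ?_)
      · intro p hp
        simp only [Finset.mem_filter, Nat.mem_primesLE] at hp
        have : (z : ℝ) + 1 ≤ p := by
          have : z + 1 ≤ p := by omega
          exact_mod_cast this
        have hl : 0 ≤ Real.log p := Real.log_natCast_nonneg p
        gcongr
      · intro p hp
        simp only [Finset.mem_filter, Nat.mem_primesLE, Nat.mem_primeFactors] at hp ⊢
        refine ⟨hp.1.1.2, ?_, by simpa using hn⟩
        have : (p : ℤ) ∣ n := by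
          by_contra h
          exact hp.1.2 ⟨by omega, h⟩
        exact Int.natCast_dvd.1 this
      · intro p _ _
        have hl : 0 ≤ Real.log p := Real.log_natCast_nonneg p
        positivity
  have h3 : ∑ p ∈ n.natAbs.primeFactors, Real.log p / (z + 1) ≤ 1 := by
    rw [← Finset.sum_div, div_le_one (by positivity)]
    have e1 : ∑ p ∈ n.natAbs.primeFactors, Real.log p ≤ L := by
      rw [← Real.log_prod (fun p hp => by
        have := (Nat.mem_primeFactors.1 hp).1.pos
        positivity), hL]
      refine Real.log_le_log (Finset.prod_pos fun p hp => by
        have := (Nat.mem_primeFactors.1 hp).1.pos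
        positivity) ?_
      have := Nat.le_of_dvd (Int.natAbs_pos.2 hn) (Nat.prod_primeFactors_dvd n.natAbs)
      calc (∏ p ∈ n.natAbs.primeFactors, (p : ℝ)) = ((∏ p ∈ n.natAbs.primeFactors, p : ℕ) : ℝ) := by push_cast; rfl
        _ ≤ (n.natAbs : ℝ) := by exact_mod_cast this
        _ = |(n : ℝ)| := by rw [Nat.cast_natAbs]; push_cast; rfl
    linarith
  have h4 := mertens_upper z hz1
  have h5 : Real.log z ≤ Real.log (y + L) := Real.log_le_log (by exact_mod_cast hz1) hzl
  have h6 := mertens_lower s hs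
  linarith

end PCB

-- Module M9
namespace PCB
open MvPolynomial

theorem det_ineq {F : MvPolynomial (Fin 2) ℤ} {d M : ℕ} (hd1 : 1 ≤ d) (hF : F.totalDegree ≤ d) (hM : d ≤ M)
    (hprim : ∀ p : ℤ, Prime p → ¬ C p ∣ F) (hc : coeff (mon (0, d)) F ≠ 0) (R : ℤ) (hR0 : R ≠ 0)
    (hR : ∀ p : ℕ, p.Prime → d < p → ¬ (p : ℤ) ∣ coeff (mon (0, d)) F → ¬ (p : ℤ) ∣ R →
      Irreducible (map (Int.castRingHom (ZMod p)) F))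
    (a b q : low d M → ℤ)
    (hz : ∀ i, hev F d (a i) (b i) (q i) = 0)
    (hgcd : ∀ i, ∀ p : ℕ, p.Prime → ¬ ((p : ℤ) ∣ a i ∧ (p : ℤ) ∣ b i ∧ (p : ℤ) ∣ q i))
    (X : ℝ) (hX : ∀ i, |(a i : ℝ)| ≤ X ∧ |(b i : ℝ)| ≤ X ∧ |(q i : ℝ)| ≤ X) (hX1 : 1 ≤ X)
    (hdet : (imat d M a b q).det ≠ 0) :
    ((tri (M - d)).card : ℝ) * Real.log |((coeff (mon (0, d)) F : ℤ) : ℝ)| +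
      ((low d M).card : ℝ) ^ 2 / 2 * (Real.log (low d M).card -
        Real.log ((81 * d ^ 4 : ℕ) + Real.log |((coeff (mon (0, d)) F * R : ℤ) : ℝ)|) - 53)
      ≤ (low d M).card * Real.log (low d M).card + M * (low d M).card * Real.log X := by
  set c := coeff (mon (0, d)) F with hcdef
  set s := (low d M).card with hs
  set D := (imat d M a b q).det with hD
  have hs1 : 1 ≤ s := by
    rw [hs]; exact Finset.card_pos.2 ⟨(0, 0), mem_low.2 ⟨by simp, by simp; omega⟩⟩
  have hs0 : (0 : ℝ) < s := by exact_mod_cast hs1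
  -- upper bound
  have hup : |(D : ℝ)| ≤ (s.factorial : ℝ) * (X ^ M) ^ s := by
    have hent : ∀ i j, |(imat d M (fun i => (a i : ℝ)) (fun i => (b i : ℝ)) (fun i => (q i : ℝ))) i j| ≤ X ^ M := by
      intro i j
      obtain ⟨h1, h2, h3⟩ := hX i
      have hj := (mem_low.1 j.2).1
      simp only [imat, Matrix.of_apply, abs_mul, abs_pow]
      calc _ ≤ X ^ j.1.1 * X ^ j.1.2 * X ^ (M - j.1.1 - j.1.2) := by gcongr
        _ = X ^ M := by rw [← pow_add, ← pow_add]; congr 1; omega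
    have := Matrix.det_le (abv := AbsoluteValue.abs) hent
    have hmap : imat d M (fun i => (a i : ℝ)) (fun i => (b i : ℝ)) (fun i => (q i : ℝ)) = (imat d M a b q).map (Int.castRingHom ℝ) := by
      ext i j; simp [imat]
    rw [hmap, ← RingHom.mapMatrix_apply, ← RingHom.map_det, Fintype.card_coe, nsmul_eq_mul] at this
    exact this
  have hDpos : 0 < |(D : ℝ)| := by rw [abs_pos]; exact_mod_cast hdet
  have hlogup : Real.log |(D : ℝ)| ≤ s * Real.log s + M * s * Real.log X := by
    have h1 := Real.log_le_log hDpos hup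
    have hf0 : (0 : ℝ) < s.factorial := by exact_mod_cast s.factorial_pos
    rw [Real.log_mul hf0.ne' (by positivity), Real.log_pow, Real.log_pow] at h1
    have h2 : Real.log (s.factorial : ℝ) ≤ s * Real.log s := by
      rw [← Real.log_pow]
      apply Real.log_le_log hf0
      exact_mod_cast Nat.factorial_le_pow s
    linarith
  -- lower bound
  set y := 81 * d ^ 4 with hy
  have hd4 : 1 ≤ d ^ 4 := Nat.one_le_pow _ _ hd1
  have hdd : d ≤ d ^ 4 := by
    calc d = d ^ 1 := (pow_one d).symm
      _ ≤ d ^ 4 := Nat.pow_le_pow_right hd1 (by norm_num)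
  have hcR : c * R ≠ 0 := mul_ne_zero hc hR0
  set P := (Nat.primesLE s).filter (fun p => y ≤ p ∧ ¬ (p : ℤ) ∣ c * R) with hP
  have hex : ∀ p : ℕ, ∃ e : ℕ, p ∈ P → ((s : ℝ) ^ 2 / (2 * ((p + 9 * d ^ 2 * Nat.sqrt p : ℕ) : ℝ)) - s ≤ e) ∧
      (p : ℤ) ^ e ∣ D := by
    intro p
    by_cases hp : p ∈ P
    · simp only [hP, Finset.mem_filter, Nat.mem_primesLE] at hp
      obtain ⟨⟨_, hpp⟩, hyp, hnd⟩ := hp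
      have : Fact p.Prime := ⟨hpp⟩
      have hpc : ¬ (p : ℤ) ∣ c := fun h => hnd (Dvd.dvd.mul_right h _)
      have hpR : ¬ (p : ℤ) ∣ R := fun h => hnd (Dvd.dvd.mul_left h _)
      obtain ⟨e, he⟩ := padic hd1 hF (p := p) (by omega) (hR p hpp (by omega) hpc hpR) hpc a b q hz (fun i => hgcd i p hpp)
      exact ⟨e, fun _ => he⟩
    · exact ⟨0, fun h => absurd h hp⟩
  choose e he using hex
  have hPp : ∀ p ∈ P, p.Prime := fun p hp => (Nat.mem_primesLE.1 (Finset.mem_filter.1 hp).1).2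
  have hdvd1 : ∏ p ∈ P, (p : ℤ) ^ e p ∣ D := by
    refine Finset.prod_dvd_of_coprime ?_ (fun p hp => (he p hp).2)
    intro p hp p' hp' hne
    refine IsCoprime.pow ?_
    rw [Nat.isCoprime_iff_coprime]
    exact (Nat.coprime_primes (hPp p hp) (hPp p' hp')).2 hne
  have hdvd2 := lattice hF hM hprim hc a b q hz
  have hdvd : c ^ (tri (M - d)).card * ∏ p ∈ P, (p : ℤ) ^ e p ∣ D := by
    refine IsCoprime.mul_dvd ?_ hdvd2 hdvd1
    refine IsCoprime.prod_right fun p hp => ?_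
    refine IsCoprime.pow ?_
    refine IsCoprime.symm ?_
    rw [Prime.coprime_iff_not_dvd (Nat.prime_iff_prime_int.1 (hPp p hp))]
    exact fun h => (Finset.mem_filter.1 hp).2.2 (Dvd.dvd.mul_right h _)
  have hle : |(c : ℝ)| ^ (tri (M - d)).card * ∏ p ∈ P, (p : ℝ) ^ e p ≤ |(D : ℝ)| := by
    have h1 := Int.le_of_dvd (abs_pos.2 hdet) ((abs_dvd_abs _ _).2 hdvd)
    have h2 : ((|c ^ (tri (M - d)).card * ∏ p ∈ P, (p : ℤ) ^ e p| : ℤ) : ℝ) ≤ ((|D| : ℤ) : ℝ) := by exact_mod_cast h1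
    push_cast at h2
    rw [abs_mul, abs_pow, Finset.abs_prod] at h2
    simpa using h2
  have hc0 : 0 < |(c : ℝ)| := by rw [abs_pos]; exact_mod_cast hc
  have hlow := Real.log_le_log (by
    refine mul_pos (pow_pos hc0 _) (Finset.prod_pos fun p hp => ?_)
    have := (hPp p hp).pos
    positivity) hle
  have hpp0 : ∀ p ∈ P, (p : ℝ) ^ e p ≠ 0 := fun p hp => by
    have := (hPp p hp).pos
    positivity
  rw [Real.log_mul (pow_pos hc0 _).ne' (Finset.prod_ne_zero_iff.2 hpp0), Real.log_pow, Real.log_prod hpp0] at hlow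
  have hsum : (s : ℝ) ^ 2 / 2 * ∑ p ∈ P, Real.log p / (p + (9 * d ^ 2) * Real.sqrt p) - s * ∑ p ∈ P, Real.log p ≤
      ∑ p ∈ P, Real.log ((p : ℝ) ^ e p) := by
    rw [Finset.mul_sum, Finset.mul_sum, ← Finset.sum_sub_distrib]
    refine Finset.sum_le_sum fun p hp => ?_
    have hl : 0 ≤ Real.log p := Real.log_natCast_nonneg p
    have hp0 : (0 : ℝ) < p := by exact_mod_cast (hPp p hp).pos
    rw [Real.log_pow]
    have h1 := (he p hp).1
    have h2 : (s : ℝ) ^ 2 / (2 * (p + (9 * d ^ 2) * Real.sqrt p)) ≤ (s : ℝ) ^ 2 / (2 * ((p + 9 * d ^ 2 * Nat.sqrt p : ℕ) : ℝ)) := by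
      have : (Nat.sqrt p : ℝ) ≤ Real.sqrt p := Real.nat_sqrt_le_real_sqrt
      push_cast
      gcongr
    calc (s : ℝ) ^ 2 / 2 * (Real.log p / (p + (9 * d ^ 2) * Real.sqrt p)) - s * Real.log p =
        ((s : ℝ) ^ 2 / (2 * (p + (9 * d ^ 2) * Real.sqrt p)) - s) * Real.log p := by
          field_simp
      _ ≤ _ := by gcongr; linarith
  have hth : ∑ p ∈ P, Real.log p ≤ 1.4 * s := by
    refine le_trans (Finset.sum_le_sum_of_subset_of_nonneg (Finset.filter_subset _ _) (fun p _ _ => Real.log_natCast_nonneg p)) ?_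
    have := theta_le s
    have := log_four_lt
    nlinarith
  have hgp := good_primes s y hs1 (by omega) (c * R) hcR (9 * d ^ 2) (by positivity) (by
    apply Real.le_sqrt_of_sq_le
    rw [hy]; push_cast; nlinarith)
  have h9 := mul_le_mul_of_nonneg_left hgp (by positivity : (0 : ℝ) ≤ (s : ℝ) ^ 2 / 2)
  have h10 := mul_le_mul_of_nonneg_left hth hs0.le
  nlinarith

end PCB

-- Module M9b
namespace PCB
open MvPolynomial

set_option maxHeartbeats 800000 in
/-- The final numerical contradiction. -/
theorem num_contra (C1 : ℝ) (hC1 : 0 ≤ C1) : ∃ K : ℝ, 4 ≤ K ∧ ∀ (d M s t W X ell L : ℝ), 1 ≤ d → 1 ≤ W → K * d ^ 3 * W ≤ M →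
    2 * s + d * d = d * (2 * M + 3) → 2 * t = (M - d + 1) * (M - d + 2) →
    0 ≤ ell → 0 ≤ L → L ≤ 5 * d ^ 2 * ell + C1 * d ^ 4 → Real.log X ≤ Real.log (d + 1) + d / 2 * Real.log W →
    ¬ (t * ell + s ^ 2 / 2 * (Real.log s - Real.log (81 * d ^ 4 + L) - 53) ≤ s * Real.log s + M * s * Real.log X) := by
  refine ⟨4 * (81 + C1) * Real.exp 62, ?_, ?_⟩
  · have : 1 ≤ Real.exp 62 := Real.one_le_exp (by norm_num)
    nlinarith
  intro d M s t W X ell L hd hW hM hs ht hell hL0 hL hX hcon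
  have he : 1 ≤ Real.exp 62 := Real.one_le_exp (by norm_num)
  have hd0 : 0 < d := by linarith
  have hd3 : d ≤ d ^ 3 := by nlinarith [sq_nonneg (d - 1), mul_pos hd0 hd0]
  have hK4 : 4 ≤ 4 * (81 + C1) * Real.exp 62 := by nlinarith
  have hM4 : 4 * d * W ≤ M := by
    refine le_trans ?_ hM
    gcongr
  have hM4d : 4 * d ≤ M := by nlinarith
  have hM0 : 0 < M := by linarith
  have hs1 : d * M ≤ 2 * s := by nlinarith
  have hs2 : s ≤ d * (M + 1) := by nlinarith
  have hs0 : 0 < s := by nlinarith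
  -- lambda
  set lam := ell / d ^ 2 with hlam
  have hlam0 : 0 ≤ lam := by positivity
  have helllam : ell = d ^ 2 * lam := by rw [hlam]; field_simp
  have hlog1 : Real.log (1 + lam) ≤ lam / 2 + 1 := by
    have h1 : Real.log (1 + lam) = Real.log 2 + Real.log ((1 + lam) / 2) := by
      rw [← Real.log_mul (by norm_num) (by positivity)]; congr 1; ring
    have h2 := Real.log_le_sub_one_of_pos (show 0 < (1 + lam) / 2 by positivity)
    have h3 := Real.log_two_lt_d9
    linarith
  have hlogL : Real.log (81 * d ^ 4 + L) ≤ Real.log (81 + C1) + 4 * Real.log d + (lam / 2 + 1) := by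
    have h1 : 81 * d ^ 4 + L ≤ (81 + C1) * d ^ 4 * (1 + lam) := by
      rw [helllam] at hL
      have : 0 ≤ d ^ 4 * lam := by positivity
      nlinarith
    have h2 := Real.log_le_log (by positivity) h1
    rw [Real.log_mul (by positivity) (by positivity), Real.log_mul (by positivity) (by positivity),
      Real.log_pow] at h2
    push_cast at h2
    linarith
  have ht1 : s ^ 2 / 2 * (lam / 2) ≤ t * ell := by
    have h1 : s ^ 2 ≤ d ^ 2 * (M + 1) ^ 2 := by
      rw [← mul_pow]; exact pow_le_pow_left₀ hs0.le hs2 2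
    have h2 : (M + 1) ^ 2 / 4 ≤ t := by
      have h3 : 3 / 4 * (M + 1) ≤ M - d + 1 := by linarith
      nlinarith
    rw [helllam]
    calc s ^ 2 / 2 * (lam / 2) ≤ (d ^ 2 * (M + 1) ^ 2) / 2 * (lam / 2) := by gcongr
      _ = (M + 1) ^ 2 / 4 * (d ^ 2 * lam) := by ring
      _ ≤ _ := by gcongr
  set b := Real.log W with hb
  have hb0 : 0 ≤ b := Real.log_nonneg hW
  have hbW : b ≤ W := (Real.log_le_sub_one_of_pos (by linarith)).trans (by linarith)
  have hlogs : Real.log s ≤ s := (Real.log_le_sub_one_of_pos hs0).trans (by linarith)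
  have hlogd : Real.log (d + 1) ≤ d := (Real.log_le_sub_one_of_pos (by linarith)).trans (by linarith)
  have hX2 : M * s * Real.log X ≤ s ^ 2 / 2 * (5 + b) := by
    have h1 : M * Real.log X ≤ M * (d + d / 2 * b) := by gcongr; linarith
    have h2 : M * d ≤ 2 * s := by linarith
    have h3 : M * (d / 2 * b) ≤ s / 2 * (b + 1) := by
      -- M d b ≤ s (b+1)
      have h4 : 2 * (M * d) * b ≤ 2 * s * b + d * d * b := by
        have e1 : 2 * s * b + d * d * b = (2 * s + d * d) * b := by ring
        have e2 := mul_nonneg hd0.le hb0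
        rw [e1, hs]; linarith
      have h5 : d * d * b ≤ 2 * s := by
        have h7 : d * b ≤ d * W := by gcongr
        have h8 : 0 ≤ d * W := by positivity
        have h9 : d * (d * b) ≤ d * M := by gcongr; linarith
        linarith
      linarith
    have h6 : M * Real.log X ≤ s / 2 * (5 + b) := by linarith
    calc M * s * Real.log X = s * (M * Real.log X) := by ring
      _ ≤ s * (s / 2 * (5 + b)) := by gcongr
      _ = _ := by ring
  have hfin : s ^ 2 / 2 * (Real.log s - (Real.log (81 + C1) + 4 * Real.log d + 1) - 53) ≤ s ^ 2 / 2 * (2 + (5 + b)) := by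
    have h1 : s * Real.log s ≤ s * s := by gcongr
    have h2 : s ^ 2 / 2 * Real.log (81 * d ^ 4 + L) ≤ s ^ 2 / 2 * (Real.log (81 + C1) + 4 * Real.log d + (lam / 2 + 1)) := by gcongr
    nlinarith
  have hfin2 := le_of_mul_le_mul_left hfin (by positivity)
  have hlow : Real.log 2 + Real.log (81 + C1) + 62 + 4 * Real.log d + b ≤ Real.log s := by
    have h1 : 2 * (81 + C1) * Real.exp 62 * d ^ 4 * W ≤ s := by
      have : d * (4 * (81 + C1) * Real.exp 62 * d ^ 3 * W) ≤ 2 * s := le_trans (by gcongr) hs1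
      nlinarith
    have hW0 : 0 < W := by linarith
    have h2 := Real.log_le_log (by positivity) h1
    rw [Real.log_mul (by positivity) (by positivity), Real.log_mul (by positivity) (by positivity),
      Real.log_mul (by positivity) (by positivity), Real.log_mul (by positivity) (by positivity),
      Real.log_pow, Real.log_exp] at h2
    push_cast at h2
    linarith
  have := Real.log_two_gt_d9
  linarith

end PCB

-- Module M10a
namespace PCB
open MvPolynomial

lemma exists_kernel {T J : Type*} [Fintype J] [DecidableEq J] {k : Type*} [Field k] (v : T → J → k)
    (h : ∀ e : J → T, (Matrix.of fun i => v (e i)).det = 0) :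
    ∃ w : J → k, w ≠ 0 ∧ ∀ t, ∑ j, w j * v t j = 0 := by
  classical
  by_cases hs : Submodule.span k (Set.range v) = ⊤
  · exfalso
    let bs := Module.Basis.ofSpan hs.ge
    have hsub := Module.Basis.ofSpan_subset hs.ge
    let e0 : _ ≃ J := bs.indexEquiv (Pi.basisFun k J)
    have hmem : ∀ j, ∃ t, v t = bs (e0.symm j) := by
      intro j
      have : bs (e0.symm j) ∈ Set.range v := hsub ⟨_, rfl⟩
      exact this
    choose e he using hmem
    have hli : LinearIndependent k (fun i => v (e i)) := by
      have h1 : (fun i => v (e i)) = bs ∘ e0.symm := by ext1 j; exact he j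
      rw [h1]
      exact bs.linearIndependent.comp _ e0.symm.injective
    have h2 := Matrix.linearIndependent_rows_iff_isUnit (A := Matrix.of fun i => v (e i))
    have h3 := h2.1 hli
    rw [Matrix.isUnit_iff_isUnit_det, h e] at h3
    exact not_isUnit_zero h3
  · obtain ⟨f, hf0, hf⟩ := Submodule.exists_le_ker_of_lt_top _ (lt_top_iff_ne_top.2 hs)
    refine ⟨fun j => f (Pi.single j 1), ?_, ?_⟩
    · intro h0
      apply hf0
      refine (Pi.basisFun k J).ext fun j => ?_
      simpa using congrFun h0 j
    · intro t
      have h1 : f (v t) = 0 := hf (Submodule.subset_span ⟨t, rfl⟩)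
      rw [← h1]
      conv_rhs => rw [← (Pi.basisFun k J).sum_repr (v t)]
      rw [map_sum]
      refine Finset.sum_congr rfl fun j _ => ?_
      simp [mul_comm]

lemma card_inf' {k : Type*} [Field k] (f : MvPolynomial (Fin 2) k) (d : ℕ)
    (hc : coeff (mon (0, d)) f ≠ 0) (Z : Finset k) (hZ : ∀ t ∈ Z, hev f d 1 t 0 = 0) : Z.card ≤ d := by
  classical
  let Q : Polynomial k := ∑ r ∈ tri d, Polynomial.C (coeff (mon r) f * 0 ^ (d - r.1 - r.2)) * Polynomial.X ^ r.2
  have hQ : ∀ t, Q.eval t = hev f d 1 t 0 := by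
    intro t
    simp only [Q, hev, Polynomial.eval_finsetSum, Polynomial.eval_mul, Polynomial.eval_C, Polynomial.eval_pow, Polynomial.eval_X]
    exact Finset.sum_congr rfl fun r _ => by ring
  have hdeg : Q.natDegree ≤ d := by
    refine Polynomial.natDegree_sum_le_of_forall_le _ _ fun r hr => ?_
    refine (Polynomial.natDegree_C_mul_X_pow_le _ _).trans ?_
    have := mem_tri.1 hr; omega
  have hQ0 : Q ≠ 0 := by
    intro h0
    have := congrArg (fun P => Polynomial.coeff P d) h0
    simp only [Q, Polynomial.finsetSum_coeff, Polynomial.coeff_C_mul_X_pow, Polynomial.coeff_zero] at this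
    rw [Finset.sum_eq_single (0, d)] at this
    · simp at this; exact hc this
    · rintro ⟨i, j⟩ hr hne
      have := mem_tri.1 hr
      simp only at this
      rw [if_neg]
      intro h; apply hne; ext <;> simp <;> omega
    · intro h; exact absurd (mem_tri.2 (by simp)) h
  calc _ ≤ Q.roots.toFinset.card := by
        refine Finset.card_le_card fun t ht => ?_
        rw [Multiset.mem_toFinset, Polynomial.mem_roots hQ0, Polynomial.IsRoot, hQ]
        exact hZ t ht
    _ ≤ Multiset.card Q.roots := Multiset.toFinset_card_le _
    _ ≤ _ := (Polynomial.card_roots' Q).trans hdeg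

end PCB

-- Module M10
namespace PCB
open MvPolynomial

/-- number of points at infinity -/
lemma inf_count {F : MvPolynomial (Fin 2) ℤ} {d : ℕ} (hd1 : 1 ≤ d) (hc : coeff (mon (0, d)) F ≠ 0)
    (T : Finset (ℤ × ℤ × ℤ)) (hz : ∀ P ∈ T, hev F d P.1 P.2.1 P.2.2 = 0)
    (h0 : ∀ P ∈ T, P ≠ 0) (hq : ∀ P ∈ T, P.2.2 = 0)
    (hinj : ∀ P ∈ T, ∀ Q ∈ T, P.1 * Q.2.1 = Q.1 * P.2.1 → P.1 * Q.2.2 = Q.1 * P.2.2 → P.2.1 * Q.2.2 = Q.2.1 * P.2.2 → P = Q) :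
    T.card ≤ d := by
  classical
  have ha : ∀ P ∈ T, P.1 ≠ 0 := by
    intro P hP h1
    have h2 := hz P hP
    rw [h1, hq P hP, hev_top] at h2
    have h3 : P.2.1 = 0 := by
      rcases mul_eq_zero.1 h2 with h | h
      · exact absurd h hc
      · exact pow_eq_zero_iff (by omega) |>.1 h
    exact h0 P hP (Prod.ext h1 (Prod.ext h3 (hq P hP)))
  let φ : ℤ × ℤ × ℤ → ℚ := fun P => (P.2.1 : ℚ) / P.1
  have hinj' : Set.InjOn φ T := by
    intro P hP Q hQ h
    have hP1 : (P.1 : ℚ) ≠ 0 := by exact_mod_cast ha P hP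
    have hQ1 : (Q.1 : ℚ) ≠ 0 := by exact_mod_cast ha Q hQ
    simp only [φ] at h
    rw [div_eq_div_iff hP1 hQ1] at h
    have h' : P.2.1 * Q.1 = Q.2.1 * P.1 := by exact_mod_cast h
    apply hinj P hP Q hQ
    · linarith
    · rw [hq P hP, hq Q hQ]; simp
    · rw [hq P hP, hq Q hQ]; simp
  rw [← Finset.card_image_of_injOn hinj']
  refine card_inf' (map (Int.castRingHom ℚ) F) d (by rw [coeff_map]; simpa using hc) _ ?_
  intro t ht
  obtain ⟨P, hP, rfl⟩ := Finset.mem_image.1 ht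
  have hP1 : (P.1 : ℚ) ≠ 0 := by exact_mod_cast ha P hP
  have h1 := congrArg (Int.castRingHom ℚ) (hz P hP)
  rw [hev_map, hq P hP] at h1
  have h2 := hev_smul (map (Int.castRingHom ℚ) F) d (P.1 : ℚ) 1 (φ P) 0
  have h3 : (P.1 : ℚ) * φ P = P.2.1 := by simp only [φ]; field_simp
  rw [mul_one, mul_zero, h3] at h2
  simp only [eq_intCast, Int.cast_zero] at h1
  rw [h1] at h2
  exact (mul_eq_zero.1 h2.symm).resolve_left (pow_ne_zero _ hP1)

def affp (P : ℤ × ℤ × ℤ) : Fin 2 → ℚ := ![(P.1 : ℚ) / P.2.2, (P.2.1 : ℚ) / P.2.2]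

lemma affp_inj (T : Finset (ℤ × ℤ × ℤ)) (hq : ∀ P ∈ T, P.2.2 ≠ 0)
    (hinj : ∀ P ∈ T, ∀ Q ∈ T, P.1 * Q.2.1 = Q.1 * P.2.1 → P.1 * Q.2.2 = Q.1 * P.2.2 → P.2.1 * Q.2.2 = Q.2.1 * P.2.2 → P = Q) :
    Set.InjOn affp T := by
  intro P hP Q hQ h
  have hP1 : (P.2.2 : ℚ) ≠ 0 := by exact_mod_cast hq P hP
  have hQ1 : (Q.2.2 : ℚ) ≠ 0 := by exact_mod_cast hq Q hQ
  have h1 := congrFun h 0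
  have h2 := congrFun h 1
  simp only [affp, Matrix.cons_val_zero, Matrix.cons_val_one] at h1 h2
  apply hinj P hP Q hQ
  · have : (P.1 : ℚ) * Q.2.1 = Q.1 * P.2.1 := by
      rw [div_eq_iff hP1] at h1 h2
      rw [h1, h2]; field_simp
    exact_mod_cast this
  · rw [div_eq_div_iff hP1 hQ1] at h1
    exact_mod_cast h1
  · rw [div_eq_div_iff hP1 hQ1] at h2
    exact_mod_cast h2

lemma eval_affp (G : MvPolynomial (Fin 2) ℚ) {n : ℕ} (hG : G.totalDegree ≤ n) (P : ℤ × ℤ × ℤ) (hq : P.2.2 ≠ 0) :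
    eval (affp P) G = 0 ↔ hev G n (P.1 : ℚ) (P.2.1 : ℚ) (P.2.2 : ℚ) = 0 := by
  have hP1 : (P.2.2 : ℚ) ≠ 0 := by exact_mod_cast hq
  have h2 := hev_smul G n (P.2.2 : ℚ) ((P.1 : ℚ) / P.2.2) ((P.2.1 : ℚ) / P.2.2) 1
  rw [hev_one G hG, mul_one, mul_div_cancel₀ _ hP1, mul_div_cancel₀ _ hP1] at h2
  rw [h2, mul_eq_zero, or_iff_right (pow_ne_zero _ hP1)]
  rfl

/-- Affine count via an auxiliary polynomial. -/
lemma aff_count {F : MvPolynomial (Fin 2) ℤ} {d : ℕ} (hF : F.totalDegree ≤ d)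
    (hirr : Irreducible (map (Int.castRingHom ℚ) F)) (hc : coeff (mon (0, d)) F ≠ 0)
    (T : Finset (ℤ × ℤ × ℤ)) (hz : ∀ P ∈ T, hev F d P.1 P.2.1 P.2.2 = 0)
    (hq : ∀ P ∈ T, P.2.2 ≠ 0)
    (hinj : ∀ P ∈ T, ∀ Q ∈ T, P.1 * Q.2.1 = Q.1 * P.2.1 → P.1 * Q.2.2 = Q.1 * P.2.2 → P.2.1 * Q.2.2 = Q.2.1 * P.2.2 → P = Q)
    (G : MvPolynomial (Fin 2) ℚ) (hG0 : G ≠ 0) (hG : ∀ m, coeff m G ≠ 0 → m 1 < d) {M : ℕ} (hM : G.totalDegree ≤ M)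
    (hGz : ∀ P ∈ T, eval (affp P) G = 0) : T.card ≤ d * M := by
  classical
  have hF' : (map (Int.castRingHom ℚ) F).totalDegree ≤ d := totalDegree_map_le' _ hF
  rw [← Finset.card_image_of_injOn (affp_inj T hq hinj)]
  refine (count_points hirr (not_dvd_low (d := d) (by rw [coeff_map]; simpa using hc) hG0 hG) hM _ ?_ ?_).trans
    (Nat.mul_le_mul_right _ hF')
  · intro x hx
    obtain ⟨P, hP, rfl⟩ := Finset.mem_image.1 hx
    rw [eval_affp _ hF' P (hq P hP)]
    have := congrArg (Int.castRingHom ℚ) (hz P hP)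
    rw [hev_map] at this
    simpa using this
  · intro x hx
    obtain ⟨P, hP, rfl⟩ := Finset.mem_image.1 hx
    exact hGz P hP

/-- The determinant method alternative. -/
lemma aff_alt {d M : ℕ} (T : Finset (ℤ × ℤ × ℤ)) (hq : ∀ P ∈ T, P.2.2 ≠ 0)
    (hdet : ∀ e : low d M → T, (imat d M (fun i => (e i).1.1) (fun i => (e i).1.2.1) (fun i => (e i).1.2.2)).det = 0) :
    ∃ G : MvPolynomial (Fin 2) ℚ, G ≠ 0 ∧ (∀ m, coeff m G ≠ 0 → m 1 < d) ∧ G.totalDegree ≤ M ∧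
      ∀ P ∈ T, eval (affp P) G = 0 := by
  classical
  obtain ⟨w, hw0, hw⟩ := exists_kernel (k := ℚ) (J := low d M) (T := T)
    (fun t j => (t.1.1 : ℚ) ^ j.1.1 * (t.1.2.1 : ℚ) ^ j.1.2 * (t.1.2.2 : ℚ) ^ (M - j.1.1 - j.1.2)) (by
      intro e
      have h1 := congrArg (Int.castRingHom ℚ) (hdet e)
      rw [RingHom.map_det, map_zero] at h1
      rw [← h1]
      congr 1
      ext i j
      simp [imat])
  let G : MvPolynomial (Fin 2) ℚ := ∑ j : low d M, w j • xm ℚ j.1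
  have hcoef : ∀ j : low d M, coeff (mon j.1) G = w j := by
    intro j
    simp only [G, coeff_sum, coeff_smul, xm, coeff_monomial, smul_eq_mul]
    rw [Finset.sum_eq_single j]
    · simp
    · intro i _ hij
      rw [if_neg (fun h => hij (Subtype.ext (mon_injective h)))]; simp
    · simp
  have hsupp : ∀ m, coeff m G ≠ 0 → m 0 + m 1 ≤ M ∧ m 1 < d := by
    intro m hm
    simp only [G, coeff_sum, coeff_smul, xm, coeff_monomial, smul_eq_mul] at hm
    obtain ⟨j, _, hj⟩ := Finset.exists_ne_zero_of_sum_ne_zero hm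
    have h1 : mon j.1 = m := by
      by_contra h; rw [if_neg h] at hj; simp at hj
    have := mem_low.1 j.2
    rw [← h1]; simpa using this
  have hdeg : G.totalDegree ≤ M := totalDegree_le_iff'.2 fun m hm => (hsupp m hm).1
  refine ⟨G, ?_, fun m hm => (hsupp m hm).2, hdeg, ?_⟩
  · intro h
    apply hw0
    ext j
    rw [← hcoef, h]; simp
  · intro P hP
    rw [eval_affp G hdeg P (hq P hP)]
    simp only [G]
    rw [hev_sum, ← hw ⟨P, hP⟩]
    refine Finset.sum_congr rfl fun j _ => ?_
    rw [hev_xm (mem_tri.2 (mem_low.1 j.2).1)]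

end PCB

-- Module M10c
namespace PCB
open MvPolynomial

theorem log_R_bound {d : ℕ} (hd1 : 1 ≤ d) {H : ℕ} (hH1 : 1 ≤ H) {c R : ℤ} (hc : c ≠ 0) (hR0 : R ≠ 0)
    (hR : |R| ≤ (72 * d ^ 6 * H ^ 2) ^ (2 * d ^ 2)) (hlog : Real.log H ≤ Real.log |(c : ℝ)| + 20 * d ^ 2) :
    Real.log |((c * R : ℤ) : ℝ)| ≤ 5 * (d : ℝ) ^ 2 * Real.log |(c : ℝ)| + 102 * (d : ℝ) ^ 4 := by
  have hd : (1 : ℝ) ≤ d := by exact_mod_cast hd1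
  have hc1 : (1 : ℝ) ≤ |(c : ℝ)| := by exact_mod_cast Int.one_le_abs hc
  have hR1 : (1 : ℝ) ≤ |(R : ℝ)| := by exact_mod_cast Int.one_le_abs hR0
  have hH0 : (1 : ℝ) ≤ H := by exact_mod_cast hH1
  have hell := Real.log_nonneg hc1
  have hR' : |(R : ℝ)| ≤ (72 * (d : ℝ) ^ 6 * (H : ℝ) ^ 2) ^ (2 * d ^ 2) := by exact_mod_cast hR
  have h1 := Real.log_le_log (by linarith) hR'
  rw [Real.log_pow, Real.log_mul (by positivity) (by positivity), Real.log_mul (by positivity) (by positivity),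
    Real.log_pow, Real.log_pow] at h1
  push_cast at h1 ⊢
  rw [abs_mul, Real.log_mul (by linarith) (by linarith)]
  have h72 : Real.log 72 ≤ 5 := by
    have : Real.log 72 ≤ Real.log (2 ^ 7) := Real.log_le_log (by norm_num) (by norm_num)
    rw [Real.log_pow] at this
    have := Real.log_two_lt_d9
    push_cast at *
    linarith
  have hld : Real.log d ≤ d := (Real.log_le_sub_one_of_pos (by linarith)).trans (by linarith)
  have hd2 : (d : ℝ) ≤ (d : ℝ) ^ 2 := by nlinarith
  have hd2' : (1 : ℝ) ≤ (d : ℝ) ^ 2 := by nlinarith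
  set ell := Real.log |(c : ℝ)|
  have h2 : Real.log 72 + 6 * Real.log d + 2 * Real.log H ≤ 2 * ell + 51 * (d : ℝ) ^ 2 := by linarith
  have h3 : 2 * (d : ℝ) ^ 2 * (Real.log 72 + 6 * Real.log d + 2 * Real.log H) ≤ 2 * (d : ℝ) ^ 2 * (2 * ell + 51 * (d : ℝ) ^ 2) := by
    gcongr
  have h4 : ell ≤ (d : ℝ) ^ 2 * ell := by nlinarith
  nlinarith

theorem curve_count : ∃ K : ℝ, 0 < K ∧ ∀ (d : ℕ) (F : MvPolynomial (Fin 2) ℤ) (H : ℕ) (B : ℝ) (T : Finset (ℤ × ℤ × ℤ)),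
    1 ≤ d → F.totalDegree ≤ d → Irreducible (map (Int.castRingHom ℚ) F) → (∀ p : ℤ, Prime p → ¬ C p ∣ F) →
    coeff (mon (0, d)) F ≠ 0 → (∀ m, |coeff m F| ≤ H) →
    Real.log H ≤ Real.log |((coeff (mon (0, d)) F : ℤ) : ℝ)| + 20 * d ^ 2 → 1 ≤ B →
    (∀ P ∈ T, hev F d P.1 P.2.1 P.2.2 = 0) →
    (∀ P ∈ T, ∀ p : ℕ, p.Prime → ¬ ((p : ℤ) ∣ P.1 ∧ (p : ℤ) ∣ P.2.1 ∧ (p : ℤ) ∣ P.2.2)) →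
    (∀ P ∈ T, |(P.1 : ℝ)| ≤ (d + 1) * B ∧ |(P.2.1 : ℝ)| ≤ (d + 1) * B ∧ |(P.2.2 : ℝ)| ≤ (d + 1) * B) →
    (∀ P ∈ T, ∀ Q ∈ T, P.1 * Q.2.1 = Q.1 * P.2.1 → P.1 * Q.2.2 = Q.1 * P.2.2 → P.2.1 * Q.2.2 = Q.2.1 * P.2.2 → P = Q) →
    (T.card : ℝ) ≤ K * d ^ 4 * B ^ (2 / (d : ℝ)) := by
  classical
  obtain ⟨K, hK4, hK⟩ := num_contra 102 (by norm_num)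
  refine ⟨K + 2, by linarith, ?_⟩
  intro d F H B T hd1 hF hirr hprim hc hH hlog hB hz hgcd hX hinj
  have hd : (1 : ℝ) ≤ d := by exact_mod_cast hd1
  have hd0 : (0 : ℝ) < d := by linarith
  set W := B ^ (2 / (d : ℝ)) with hWdef
  have hW : 1 ≤ W := Real.one_le_rpow hB (by positivity)
  have hlogW : (d : ℝ) / 2 * Real.log W = Real.log B := by
    rw [hWdef, Real.log_rpow (by linarith)]; field_simp
  set M := ⌈K * d ^ 3 * W⌉₊ with hMdef
  have hM1 : K * d ^ 3 * W ≤ M := Nat.le_ceil _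
  have hM2 : (M : ℝ) ≤ K * d ^ 3 * W + 1 := (Nat.ceil_lt_add_one (by positivity)).le
  have hdM : d ≤ M := by
    have : (d : ℝ) ≤ M := by
      refine le_trans ?_ hM1
      have h1 : (d : ℝ) ≤ d ^ 3 := by nlinarith [sq_nonneg ((d : ℝ) - 1), mul_pos hd0 hd0]
      have h2 : (d : ℝ) ^ 3 ≤ K * d ^ 3 * W := by
        calc (d : ℝ) ^ 3 = 1 * d ^ 3 * 1 := by ring
          _ ≤ _ := by gcongr; linarith
      linarith
    exact_mod_cast this
  have hH1 : 1 ≤ H := by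
    have := hH (mon (0, d))
    have h2 := Int.one_le_abs hc
    have : (1 : ℤ) ≤ H := by linarith
    exact_mod_cast this
  have hne : ∀ P ∈ T, P ≠ 0 := by
    rintro P hP rfl
    exact hgcd _ hP 2 Nat.prime_two (by simp)
  have hinf : (T.filter fun P => P.2.2 = 0).card ≤ d := by
    refine inf_count hd1 hc _ (fun P hP => hz P (Finset.mem_filter.1 hP).1) (fun P hP => hne P (Finset.mem_filter.1 hP).1)
      (fun P hP => (Finset.mem_filter.1 hP).2) (fun P hP Q hQ => hinj P (Finset.mem_filter.1 hP).1 Q (Finset.mem_filter.1 hQ).1)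
  have haff : (T.filter fun P => ¬ P.2.2 = 0).card ≤ d * M := by
    set T' := T.filter fun P => ¬ P.2.2 = 0 with hT'
    have hsub : ∀ P ∈ T', P ∈ T := fun P hP => (Finset.mem_filter.1 hP).1
    have hq : ∀ P ∈ T', P.2.2 ≠ 0 := fun P hP => (Finset.mem_filter.1 hP).2
    have hinj' : ∀ P ∈ T', ∀ Q ∈ T', P.1 * Q.2.1 = Q.1 * P.2.1 → P.1 * Q.2.2 = Q.1 * P.2.2 → P.2.1 * Q.2.2 = Q.2.1 * P.2.2 → P = Q :=
      fun P hP Q hQ => hinj P (hsub P hP) Q (hsub Q hQ)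
    have hF' : (map (Int.castRingHom ℚ) F).totalDegree ≤ d := totalDegree_map_le' _ hF
    have hc' : coeff (mon (0, d)) (map (Int.castRingHom ℚ) F) ≠ 0 := by rw [coeff_map]; simpa using hc
    by_cases hsing : ∀ P ∈ T', eval (affp P) (pderiv 1 (map (Int.castRingHom ℚ) F)) = 0
    · have hdeg : (pderiv 1 (map (Int.castRingHom ℚ) F)).totalDegree ≤ d - 1 :=
        totalDegree_pderiv_le (by omega) 1
      have := aff_count hF hirr hc T' (fun P hP => hz P (hsub P hP)) hq hinj' _
        (pderiv_ne_of_top hd1 hc' (by exact_mod_cast (by omega : d ≠ 0)))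
        (fun m hm => by have := totalDegree_le_iff'.1 hdeg m hm; omega) hdeg hsing
      exact this.trans (Nat.mul_le_mul_left _ (by omega))
    · push Not at hsing
      obtain ⟨P0, hP0, hP0'⟩ := hsing
      have hP0z : eval (affp P0) (map (Int.castRingHom ℚ) F) = 0 := by
        rw [eval_affp _ hF' P0 (hq P0 hP0)]
        have := congrArg (Int.castRingHom ℚ) (hz P0 (hsub P0 hP0))
        rw [hev_map] at this
        simpa using this
      obtain ⟨R, hR0, hRb, hR⟩ := ruppert hd1 hF hirr hc hH _ hP0z hP0'
      obtain ⟨G, hG0, hGl, hGd, hGz⟩ := aff_alt (d := d) (M := M) T' hq (by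
        intro e
        by_contra hdet
        have hine := det_ineq hd1 hF hdM hprim hc R hR0 hR _ _ _ (fun i => hz _ (hsub _ (e i).2))
          (fun i => hgcd _ (hsub _ (e i).2)) ((d + 1) * B) (fun i => hX _ (hsub _ (e i).2)) (by nlinarith) hdet
        have hcR : (1 : ℝ) ≤ |((coeff (mon (0, d)) F * R : ℤ) : ℝ)| := by
          exact_mod_cast Int.one_le_abs (mul_ne_zero hc hR0)
        have hc1 : (1 : ℝ) ≤ |((coeff (mon (0, d)) F : ℤ) : ℝ)| := by
          exact_mod_cast Int.one_le_abs hc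
        refine hK d M (low d M).card (tri (M - d)).card W ((d + 1) * B) (Real.log |((coeff (mon (0, d)) F : ℤ) : ℝ)|)
          (Real.log |((coeff (mon (0, d)) F * R : ℤ) : ℝ)|) hd hW hM1 ?_ ?_ (Real.log_nonneg hc1) (Real.log_nonneg hcR)
          (log_R_bound hd1 hH1 hc hR0 hRb hlog) ?_ ?_
        · exact_mod_cast card_low (d := d) (L := M) (by omega)
        · have := card_tri (M - d)
          have h2 : (2 : ℝ) * (tri (M - d)).card = ((M - d : ℕ) + 1) * ((M - d : ℕ) + 2) := by exact_mod_cast this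
          rw [h2, Nat.cast_sub hdM]
        · rw [hlogW, Real.log_mul (by positivity) (by positivity)]
        · push_cast at hine ⊢
          exact hine)
      exact aff_count hF hirr hc T' (fun P hP => hz P (hsub P hP)) hq hinj' G hG0 hGl hGd hGz
  have hcard : T.card ≤ d + d * M := by
    rw [← Finset.card_filter_add_card_filter_not (s := T) (fun P => P.2.2 = 0)]
    omega
  have hcard' : (T.card : ℝ) ≤ d + d * M := by exact_mod_cast hcard
  have h5 : (d : ℝ) ≤ d ^ 4 * W := by
    have : (d : ℝ) ≤ d ^ 4 := le_self_pow₀ hd (by norm_num)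
    nlinarith [pow_pos hd0 4]
  have h6 : (d : ℝ) * M ≤ d * (K * d ^ 3 * W + 1) := by gcongr
  nlinarith

end PCB

-- Module M11a
namespace PCB

lemma coeff_prod_le {ι : Type*} [DecidableEq ι] (s : Finset ι) (a : ι → ℝ) {D : ℝ} (ha : ∀ i ∈ s, |a i| ≤ D) (n : ℕ) :
    |(∏ i ∈ s, (Polynomial.X - Polynomial.C (a i))).coeff n| ≤ (1 + D) ^ s.card := by
  induction s using Finset.induction_on generalizing n with
  | empty => simp [Polynomial.coeff_one]; split_ifs <;> simp
  | insert i s hi ih =>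
    have ih' := fun n => ih (fun j hj => ha j (Finset.mem_insert_of_mem hj)) n
    have hi' := ha i (Finset.mem_insert_self _ _)
    have hD : 0 ≤ D := (abs_nonneg _).trans hi'
    rw [Finset.prod_insert hi, Finset.card_insert_of_notMem hi, sub_mul, Polynomial.coeff_sub, Polynomial.coeff_C_mul,
      pow_succ, mul_comm _ (1 + D), add_mul, one_mul]
    refine (abs_sub _ _).trans (add_le_add ?_ ?_)
    · cases n with
      | zero => simp; positivity
      | succ n => rw [Polynomial.coeff_X_mul]; exact ih' n
    · rw [abs_mul]
      exact mul_le_mul hi' (ih' n) (abs_nonneg _) hD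

lemma interp (d : ℕ) (α : ℕ → ℝ) (N : ℝ) (h : ∀ x ∈ Finset.range (d + 1), |∑ i ∈ Finset.range (d + 1), α i * (x : ℝ) ^ i| ≤ N) :
    ∀ i ∈ Finset.range (d + 1), |α i| ≤ ((d : ℝ) + 1) ^ (d + 1) * N := by
  classical
  intro i hi
  let p : Polynomial ℝ := ∑ i ∈ Finset.range (d + 1), Polynomial.C (α i) * Polynomial.X ^ i
  have hpc : p.coeff i = α i := by
    simp only [p, Polynomial.finsetSum_coeff, Polynomial.coeff_C_mul_X_pow]
    rw [Finset.sum_ite_eq, if_pos hi]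
  have hpe : ∀ x, p.eval x = ∑ i ∈ Finset.range (d + 1), α i * x ^ i := by
    intro x; simp [p, Polynomial.eval_finsetSum]
  have hdeg : p.degree < (Finset.range (d + 1)).card := by
    rw [Finset.card_range]
    refine (Polynomial.degree_sum_le _ _).trans_lt ?_
    rw [Finset.sup_lt_iff (by exact WithBot.bot_lt_coe _)]
    intro j hj
    refine (Polynomial.degree_C_mul_X_pow_le _ _).trans_lt ?_
    exact_mod_cast Finset.mem_range.1 hj
  have hinj : Set.InjOn (fun n : ℕ => (n : ℝ)) (Finset.range (d + 1)) := fun a _ b _ hab => Nat.cast_injective hab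
  have hlagr := Lagrange.eq_interpolate hinj hdeg
  rw [← hpc, hlagr, Lagrange.interpolate_apply, Polynomial.finsetSum_coeff]
  refine (Finset.abs_sum_le_sum_abs _ _).trans ?_
  have hN : 0 ≤ N := (abs_nonneg _).trans (h 0 (by simp))
  have : ∀ j ∈ Finset.range (d + 1), |(Polynomial.C (Polynomial.eval (j : ℝ) p) * Lagrange.basis (Finset.range (d + 1)) (fun n : ℕ => (n : ℝ)) j).coeff i|
      ≤ N * ((d : ℝ) + 1) ^ d := by
    intro j hj
    rw [Polynomial.coeff_C_mul, abs_mul]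
    refine mul_le_mul ?_ ?_ (abs_nonneg _) hN
    · rw [hpe]; exact h j hj
    · rw [Lagrange.basis]
      simp only [Lagrange.basisDivisor]
      rw [Finset.prod_mul_distrib, ← map_prod, Polynomial.coeff_C_mul, abs_mul]
      have h1 : |∏ x ∈ (Finset.range (d + 1)).erase j, ((j : ℝ) - x)⁻¹| ≤ 1 := by
        rw [Finset.abs_prod]
        refine Finset.prod_le_one (fun _ _ => abs_nonneg _) fun x hx => ?_
        rw [abs_inv]
        refine inv_le_one_of_one_le₀ ?_
        have : (j : ℤ) - x ≠ 0 := by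
          have := Finset.ne_of_mem_erase hx
          omega
        exact_mod_cast Int.one_le_abs this
      have h2 := coeff_prod_le ((Finset.range (d + 1)).erase j) (fun n : ℕ => (n : ℝ)) (D := d) (fun x hx => by
        have := Finset.mem_range.1 (Finset.mem_of_mem_erase hx)
        rw [abs_of_nonneg (by positivity)]; exact_mod_cast (by omega : x ≤ d)) i
      rw [Finset.card_erase_of_mem hj, Finset.card_range, Nat.add_sub_cancel, add_comm (1 : ℝ)] at h2
      calc _ ≤ 1 * ((d : ℝ) + 1) ^ d := mul_le_mul h1 h2 (abs_nonneg _) zero_le_one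
        _ = _ := one_mul _
  refine (Finset.sum_le_card_nsmul _ _ _ this).trans ?_
  rw [Finset.card_range, nsmul_eq_mul]
  push_cast
  apply le_of_eq; ring

lemma interp2 (d : ℕ) (α : ℕ → ℕ → ℝ) (N : ℝ)
    (h : ∀ x ∈ Finset.range (d + 1), ∀ y ∈ Finset.range (d + 1),
      |∑ i ∈ Finset.range (d + 1), ∑ j ∈ Finset.range (d + 1), α i j * (x : ℝ) ^ i * (y : ℝ) ^ j| ≤ N) :
    ∀ i ∈ Finset.range (d + 1), ∀ j ∈ Finset.range (d + 1), |α i j| ≤ (((d : ℝ) + 1) ^ (d + 1)) ^ 2 * N := by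
  intro i hi j hj
  have := interp d (fun j => α i j) (((d : ℝ) + 1) ^ (d + 1) * N) (by
    intro y hy
    refine interp d (fun i => ∑ j ∈ Finset.range (d + 1), α i j * (y : ℝ) ^ j) N ?_ i hi
    intro x hx
    convert h x hx y hy using 3 with i' _
    rw [Finset.sum_mul]
    exact Finset.sum_congr rfl fun j _ => by ring) j hj
  refine this.trans (le_of_eq ?_); ring

end PCB

-- Module M11b
namespace PCB
open MvPolynomial

section
variable {S : Type*} [CommRing S]

lemma hev_add (F G : MvPolynomial (Fin 2) S) (d : ℕ) (a b q : S) :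
    hev (F + G) d a b q = hev F d a b q + hev G d a b q := by
  simp [hev, add_mul, Finset.sum_add_distrib]

lemma hev_C_mul (c : S) (G : MvPolynomial (Fin 2) S) (d : ℕ) (a b q : S) :
    hev (C c * G) d a b q = c * hev G d a b q := by
  simp [hev, coeff_C_mul, Finset.mul_sum, mul_assoc]

lemma hev_mul {F G : MvPolynomial (Fin 2) S} {d e : ℕ} (hF : F.totalDegree ≤ d) (hG : G.totalDegree ≤ e) (a b q : S) :
    hev (F * G) (d + e) a b q = hev F d a b q * hev G e a b q := by
  have h1 : F * G = ∑ r ∈ tri e, coeff (mon r) G • (F * xm S r) := by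
    conv_lhs => rw [sum_xm_coeff G hG]
    rw [Finset.mul_sum]
    exact Finset.sum_congr rfl fun r _ => by rw [mul_smul_comm]
  rw [h1, hev_sum]
  conv_rhs => rw [hev.eq_def G, Finset.mul_sum]
  refine Finset.sum_congr rfl fun r hr => ?_
  have hr' := mem_tri.1 hr
  rw [hev_mul_xm hF (by omega), show d + e - d - r.1 - r.2 = e - r.1 - r.2 by omega]
  ring

lemma hev_onepoly (a b q : S) : hev (1 : MvPolynomial (Fin 2) S) 0 a b q = 1 := by
  have : (tri 0) = {(0, 0)} := by ext ⟨i, j⟩; simp [mem_tri]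
  rw [hev, this, Finset.sum_singleton]
  have h : mon (0, 0) = 0 := by ext i; fin_cases i <;> simp
  simp [h]

lemma totalDegree_pow_le' {F : MvPolynomial (Fin 2) S} (hF : F.totalDegree ≤ 1) (n : ℕ) : (F ^ n).totalDegree ≤ n := by
  refine (totalDegree_pow _ _).trans ?_
  nlinarith

lemma hev_pow {F : MvPolynomial (Fin 2) S} (hF : F.totalDegree ≤ 1) (n : ℕ) (a b q : S) :
    hev (F ^ n) n a b q = hev F 1 a b q ^ n := by
  induction n with
  | zero => simp [hev_onepoly]
  | succ n ih => rw [pow_succ, hev_mul (totalDegree_pow_le' hF n) hF, ih, pow_succ]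

lemma tri_one : tri 1 = {(0, 0), (1, 0), (0, 1)} := by
  ext ⟨i, j⟩; simp [mem_tri]; omega

lemma hev_lin (F : MvPolynomial (Fin 2) S) (a b q : S) :
    hev F 1 a b q = coeff 0 F * q + coeff (Finsupp.single 0 1) F * a + coeff (Finsupp.single 1 1) F * b := by
  have h : mon (0, 0) = 0 := by ext i; fin_cases i <;> simp
  have h1 : mon (1, 0) = Finsupp.single 0 1 := by ext i; fin_cases i <;> simp
  have h2 : mon (0, 1) = Finsupp.single 1 1 := by ext i; fin_cases i <;> simp
  rw [hev, tri_one, Finset.sum_insert (by simp), Finset.sum_insert (by simp), Finset.sum_singleton]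
  simp only [h, h1, h2]
  simp
  ring

/-- the three linear forms -/
noncomputable def lf (v w : S) : Fin 3 → MvPolynomial (Fin 2) S :=
  ![X 0 + C v * X 1, 1 + C w * X 1, X 1]

/-- Change of variables followed by dehomogenisation. -/
noncomputable def sbt (v w : S) (f : MvPolynomial (Fin 3) S) : MvPolynomial (Fin 2) S :=
  aeval (lf v w) f

lemma lf_deg (v w : S) (i : Fin 3) : (lf v w i).totalDegree ≤ 1 := by
  have hX : ∀ j : Fin 2, (X j : MvPolynomial (Fin 2) S).totalDegree ≤ 1 := fun j => by
    have := totalDegree_monomial_le (Finsupp.single j 1) (1 : S)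
    simpa [X] using this
  have hCX : ∀ c : S, (C c * X 1 : MvPolynomial (Fin 2) S).totalDegree ≤ 1 := fun c => by
    refine (totalDegree_mul _ _).trans ?_
    simpa using hX 1
  fin_cases i
  · exact (totalDegree_add _ _).trans (max_le (hX 0) (hCX v))
  · exact (totalDegree_add _ _).trans (max_le (by simp) (hCX w))
  · exact hX 1

lemma hev_lf (v w a b q : S) (i : Fin 3) : hev (lf v w i) 1 a b q = ![a + v * b, q + w * b, b] i := by
  have e1 : (Finsupp.single (0 : Fin 2) 1 : Fin 2 →₀ ℕ) ≠ 0 := by simp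
  have e2 : (Finsupp.single (1 : Fin 2) 1 : Fin 2 →₀ ℕ) ≠ 0 := by simp
  have e3 : (Finsupp.single (0 : Fin 2) 1 : Fin 2 →₀ ℕ) ≠ Finsupp.single 1 1 := by
    intro h; have := DFunLike.congr_fun h 0; simp at this
  rw [hev_lin]
  fin_cases i <;>
    simp [lf, coeff_C_mul, coeff_X, coeff_one, e1, e2, e3, e3.symm, e1.symm, e2.symm]

lemma sbt_eq (v w : S) (f : MvPolynomial (Fin 3) S) :
    sbt v w f = ∑ m ∈ f.support, C (coeff m f) * (lf v w 0 ^ m 0 * lf v w 1 ^ m 1 * lf v w 2 ^ m 2) := by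
  rw [sbt, aeval_def, eval₂_eq]
  refine Finset.sum_congr rfl fun m _ => ?_
  rw [Finset.prod_subset (Finset.subset_univ _) (by intro i _ hi; rw [Finsupp.notMem_support_iff.1 hi, pow_zero])]
  simp [Fin.prod_univ_three, algebraMap_eq]

lemma deg_sum {d : ℕ} {f : MvPolynomial (Fin 3) S} (hf : f.IsHomogeneous d) {m : Fin 3 →₀ ℕ} (hm : coeff m f ≠ 0) :
    m 0 + m 1 + m 2 = d := by
  have := hf hm
  rw [← this]
  simp [Finsupp.weight_apply, Finsupp.sum_fintype, Fin.sum_univ_three]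

lemma lfm_deg (v w : S) (m : Fin 3 →₀ ℕ) :
    (lf v w 0 ^ m 0 * lf v w 1 ^ m 1 * lf v w 2 ^ m 2).totalDegree ≤ m 0 + m 1 + m 2 := by
  refine (totalDegree_mul _ _).trans (add_le_add ((totalDegree_mul _ _).trans (add_le_add ?_ ?_)) ?_) <;>
    exact totalDegree_pow_le' (lf_deg _ _ _) _

lemma sbt_deg (v w : S) {d : ℕ} {f : MvPolynomial (Fin 3) S} (hf : f.IsHomogeneous d) : (sbt v w f).totalDegree ≤ d := by
  rw [sbt_eq]
  refine totalDegree_finsetSum_le fun m hm => ?_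
  refine (totalDegree_mul _ _).trans ?_
  rw [totalDegree_C, zero_add]
  exact (lfm_deg v w m).trans (deg_sum hf (mem_support_iff.1 hm)).le

lemma hev_sbt (v w : S) {d : ℕ} {f : MvPolynomial (Fin 3) S} (hf : f.IsHomogeneous d) (a b q : S) :
    hev (sbt v w f) d a b q = eval ![a + v * b, q + w * b, b] f := by
  have h1 : sbt v w f = ∑ m ∈ f.support, coeff m f • (lf v w 0 ^ m 0 * lf v w 1 ^ m 1 * lf v w 2 ^ m 2) := by
    rw [sbt_eq]; simp only [smul_eq_C_mul]
  rw [h1, hev_sum, eval_eq]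
  refine Finset.sum_congr rfl fun m hm => ?_
  congr 1
  rw [Finset.prod_subset (Finset.subset_univ _) (by intro i _ hi; rw [Finsupp.notMem_support_iff.1 hi, pow_zero]),
    Fin.prod_univ_three]
  have hm' := deg_sum hf (mem_support_iff.1 hm)
  rw [← hm', hev_mul ((totalDegree_mul _ _).trans (add_le_add (totalDegree_pow_le' (lf_deg _ _ _) _) (totalDegree_pow_le' (lf_deg _ _ _) _)))
    (totalDegree_pow_le' (lf_deg _ _ _) _),
    hev_mul (totalDegree_pow_le' (lf_deg _ _ _) _) (totalDegree_pow_le' (lf_deg _ _ _) _), hev_pow (lf_deg _ _ _),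
    hev_pow (lf_deg _ _ _), hev_pow (lf_deg _ _ _), hev_lf, hev_lf, hev_lf]

lemma map_sbt {S' : Type*} [CommRing S'] (φ : S →+* S') (v w : S) (f : MvPolynomial (Fin 3) S) :
    map φ (sbt v w f) = sbt (φ v) (φ w) (map φ f) := by
  rw [sbt, sbt, aeval_def, aeval_def, ← coe_eval₂Hom, ← coe_eval₂Hom, map_eval₂Hom, eval₂Hom_map_hom]
  refine eval₂Hom_congr ?_ ?_ rfl
  · ext x; simp
  · ext i : 1
    fin_cases i <;> simp [lf]

lemma coeff_sbt_top (v w : S) {d : ℕ} {f : MvPolynomial (Fin 3) S} (hf : f.IsHomogeneous d) :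
    coeff (mon (0, d)) (sbt v w f) = eval ![v, w, 1] f := by
  have h1 := hev_sbt v w hf 0 1 0
  rw [hev_top] at h1
  simpa using h1

/-- recovering the original polynomial -/
lemma hev_back (v w : S) {d : ℕ} {f : MvPolynomial (Fin 3) S} (hf : f.IsHomogeneous d) :
    hev (map (C : S →+* MvPolynomial (Fin 3) S) (sbt v w f)) d (X 0 - C v * X 2) (X 2) (X 1 - C w * X 2) = f := by
  rw [map_sbt, hev_sbt _ _ (hf.map _)]
  have : (![X 0 - C v * X 2 + C v * X 2, X 1 - C w * X 2 + C w * X 2, X 2] : Fin 3 → MvPolynomial (Fin 3) S) = X := by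
    ext1 i; fin_cases i <;> simp
  rw [this, eval_map, eval₂_eta]

lemma sbt_back (v w : S) (G : MvPolynomial (Fin 2) S) {e : ℕ} (hG : G.totalDegree ≤ e) :
    sbt v w (hev (map (C : S →+* MvPolynomial (Fin 3) S) G) e (X 0 - C v * X 2) (X 2) (X 1 - C w * X 2)) = G := by
  rw [sbt]
  have h1 := hev_map (aeval (lf v w) : MvPolynomial (Fin 3) S →ₐ[S] MvPolynomial (Fin 2) S).toRingHom
    (map (C : S →+* MvPolynomial (Fin 3) S) G) e (X 0 - C v * X 2) (X 2) (X 1 - C w * X 2)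
  have h2 : (aeval (lf v w) : MvPolynomial (Fin 3) S →ₐ[S] MvPolynomial (Fin 2) S).toRingHom.comp (C : S →+* MvPolynomial (Fin 3) S) = C := by
    ext1 x; simp [algebraMap_eq]
  rw [map_map, h2] at h1
  simp only [AlgHom.toRingHom_eq_coe, RingHom.coe_coe] at h1
  rw [h1]
  have h3 : aeval (lf v w) (X 0 - C v * X 2 : MvPolynomial (Fin 3) S) = X 0 := by simp [lf, algebraMap_eq]
  have h4 : aeval (lf v w) (X 1 - C w * X 2 : MvPolynomial (Fin 3) S) = 1 := by simp [lf, algebraMap_eq]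
  have h5 : aeval (lf v w) (X 2 : MvPolynomial (Fin 3) S) = X 1 := by simp [lf]
  rw [h3, h4, h5, hev_one _ (totalDegree_map_le' _ hG)]
  have h6 : (![X 0, X 1] : Fin 2 → MvPolynomial (Fin 2) S) = X := by ext1 i; fin_cases i <;> simp
  rw [h6, eval_map, eval₂_eta]

end

lemma sbt_irred {k : Type*} [Field k] (v w : k) {d : ℕ} (hd1 : 1 ≤ d) {f : MvPolynomial (Fin 3) k} (hf : f.IsHomogeneous d)
    (hirr : Irreducible f) (hc : eval ![v, w, 1] f ≠ 0) : Irreducible (sbt v w f) := by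
  rw [← coeff_sbt_top v w hf] at hc
  have hF0 : sbt v w f ≠ 0 := by intro h; rw [h] at hc; simp at hc
  have hdeg : (sbt v w f).totalDegree = d := by
    refine le_antisymm (sbt_deg v w hf) ?_
    have := le_totalDegree (mem_support_iff.2 hc)
    rw [Finsupp.sum_fintype _ _ (by simp)] at this
    simpa using this
  refine irreducible_iff.2 ⟨?_, ?_⟩
  · intro hu
    have := (isUnit_iff_totalDegree_of_isReduced.1 hu).2
    omega
  · intro G H hGH
    have hG0 : G ≠ 0 := by rintro rfl; simp at hGH; exact hF0 hGH
    have hH0 : H ≠ 0 := by rintro rfl; simp at hGH; exact hF0 hGH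
    have hsum : G.totalDegree + H.totalDegree = d := by
      rw [← totalDegree_mul_of_isDomain hG0 hH0, ← hGH, hdeg]
    have h1 := hev_back v w hf
    rw [hGH, map_mul, ← hsum, hev_mul (totalDegree_map_le' _ le_rfl) (totalDegree_map_le' _ le_rfl)] at h1
    rcases hirr.isUnit_or_isUnit h1.symm with h | h
    · left
      rw [← sbt_back v w G le_rfl]
      exact h.map (aeval (lf v w))
    · right
      rw [← sbt_back v w H le_rfl]
      exact h.map (aeval (lf v w))

lemma sbt_prim (v w : ℤ) {d : ℕ} {f : MvPolynomial (Fin 3) ℤ} (hf : f.IsHomogeneous d)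
    (hg : Finset.gcd f.support f.coeff = 1) (p : ℤ) (hp : Prime p) : ¬ C p ∣ sbt v w f := by
  intro h
  have h1 : (C p : MvPolynomial (Fin 3) ℤ) ∣ f := by
    rw [← hev_back v w hf, hev]
    refine Finset.dvd_sum fun r _ => Dvd.dvd.mul_right ?_ _
    rw [coeff_map]
    exact map_dvd C (C_dvd_iff_dvd_coeff _ _ |>.1 h _)
  have h2 : p ∣ Finset.gcd f.support f.coeff :=
    Finset.dvd_gcd fun m _ => C_dvd_iff_dvd_coeff _ _ |>.1 h1 m
  rw [hg] at h2
  exact hp.not_isUnit (isUnit_of_dvd_one h2)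

end PCB

-- Module M11c
namespace PCB
open MvPolynomial

lemma fiber_eq {d : ℕ} {f : MvPolynomial (Fin 3) ℤ} (hf : f.IsHomogeneous d) {m m' : Fin 3 →₀ ℕ}
    (hm : m ∈ f.support) (hm' : m' ∈ f.support) (h0 : m 0 = m' 0) (h1 : m 1 = m' 1) : m = m' := by
  have e1 := deg_sum hf (mem_support_iff.1 hm)
  have e2 := deg_sum hf (mem_support_iff.1 hm')
  ext i; fin_cases i
  · exact h0
  · exact h1
  · show m 2 = m' 2
    omega

lemma support_card_le {d : ℕ} {f : MvPolynomial (Fin 3) ℤ} (hf : f.IsHomogeneous d) : f.support.card ≤ (d + 1) ^ 2 := by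
  have : f.support.card ≤ (Finset.range (d + 1) ×ˢ Finset.range (d + 1)).card := by
    refine Finset.card_le_card_of_injOn (fun m => (m 0, m 1)) ?_ ?_
    · intro m hm
      have := deg_sum hf (mem_support_iff.1 hm)
      simp; omega
    · intro m hm m' hm' h
      simp only [Prod.mk.injEq] at h
      exact fiber_eq hf hm hm' h.1 h.2
  simpa [sq] using this

lemma eval_grid {d : ℕ} {f : MvPolynomial (Fin 3) ℤ} (hf : f.IsHomogeneous d) :
    ∃ α : ℕ → ℕ → ℝ, (∀ m ∈ f.support, α (m 0) (m 1) = coeff m f) ∧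
      ∀ x y : ℕ, ((eval ![(x : ℤ), (y : ℤ), 1] f : ℤ) : ℝ) =
        ∑ i ∈ Finset.range (d + 1), ∑ j ∈ Finset.range (d + 1), α i j * (x : ℝ) ^ i * (y : ℝ) ^ j := by
  classical
  refine ⟨fun i j => ∑ m ∈ f.support with (m 0, m 1) = (i, j), ((coeff m f : ℤ) : ℝ), ?_, ?_⟩
  · intro m hm
    have : (f.support.filter fun m' => (m' 0, m' 1) = (m 0, m 1)) = {m} := by
      ext m'
      simp only [Finset.mem_filter, Finset.mem_singleton, Prod.mk.injEq]
      constructor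
      · rintro ⟨h, h0, h1⟩; exact fiber_eq hf h hm h0 h1
      · rintro rfl; exact ⟨hm, rfl, rfl⟩
    simp only [this, Finset.sum_singleton]
  · intro x y
    rw [eval_eq]
    push_cast
    rw [← Finset.sum_product' (f := fun i j => (∑ m ∈ f.support with (m 0, m 1) = (i, j), ((coeff m f : ℤ) : ℝ)) * (x : ℝ) ^ i * (y : ℝ) ^ j),
      ← Finset.sum_fiberwise_of_maps_to (g := fun m : Fin 3 →₀ ℕ => (m 0, m 1)) (t := Finset.range (d + 1) ×ˢ Finset.range (d + 1))]
    · refine Finset.sum_congr rfl fun p _ => ?_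
      rw [Finset.sum_mul, Finset.sum_mul]
      refine Finset.sum_congr rfl fun m hm => ?_
      rw [Finset.mem_filter] at hm
      rw [Finset.prod_subset (Finset.subset_univ _) (by intro i _ hi; rw [Finsupp.notMem_support_iff.1 hi, pow_zero]),
        Fin.prod_univ_three, ← (Prod.mk.inj hm.2).1, ← (Prod.mk.inj hm.2).2]
      simp; ring
    · intro m hm
      have := deg_sum hf (mem_support_iff.1 hm)
      simp; omega

lemma choose_v {d : ℕ} {f : MvPolynomial (Fin 3) ℤ} (hf : f.IsHomogeneous d) (hf0 : f ≠ 0) :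
    ∃ v w : ℕ, v ≤ d ∧ w ≤ d ∧ eval ![(v : ℤ), (w : ℤ), 1] f ≠ 0 ∧
      ∀ m, |coeff m f| ≤ ((d + 1 : ℤ) ^ (d + 1)) ^ 2 * |eval ![(v : ℤ), (w : ℤ), 1] f| := by
  classical
  obtain ⟨α, hα, hev'⟩ := eval_grid hf
  obtain ⟨⟨v, w⟩, hvw, hmax⟩ := Finset.exists_max_image (Finset.range (d + 1) ×ˢ Finset.range (d + 1))
    (fun p => |eval ![(p.1 : ℤ), (p.2 : ℤ), 1] f|) ⟨(0, 0), by simp⟩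
  simp only [Finset.mem_product, Finset.mem_range] at hvw
  have hb : ∀ m, |coeff m f| ≤ ((d + 1 : ℤ) ^ (d + 1)) ^ 2 * |eval ![(v : ℤ), (w : ℤ), 1] f| := by
    intro m
    by_cases hm : m ∈ f.support
    · have h1 := interp2 d α |((eval ![(v : ℤ), (w : ℤ), 1] f : ℤ) : ℝ)| (by
        intro x hx y hy
        rw [← hev']
        have := hmax (x, y) (Finset.mem_product.2 ⟨hx, hy⟩)
        simp only at this
        exact_mod_cast this) (m 0) (by have := deg_sum hf (mem_support_iff.1 hm); simp; omega)
        (m 1) (by have := deg_sum hf (mem_support_iff.1 hm); simp; omega)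
      rw [hα m hm] at h1
      exact_mod_cast h1
    · rw [notMem_support_iff.1 hm, abs_zero]; positivity
  refine ⟨v, w, by omega, by omega, ?_, hb⟩
  intro h0
  apply hf0
  ext m
  have := hb m
  rw [h0] at this
  simpa using this

lemma coeff_lin_mul {N e : ℤ} (he : 0 ≤ e) (A B : MvPolynomial (Fin 2) ℤ) (hA : A = X 0 ∨ A = 1) (G : MvPolynomial (Fin 2) ℤ)
    (hB : B = A + C e * X 1)
    (hG : ∀ m, |coeff m G| ≤ N) (m : Fin 2 →₀ ℕ) : |coeff m (B * G)| ≤ (1 + e) * N := by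
  have hN : 0 ≤ N := (abs_nonneg _).trans (hG 0)
  have hX : ∀ i m, |coeff m (X i * G)| ≤ N := by
    intro i m
    rw [coeff_X_mul']
    split_ifs
    · exact hG _
    · simpa
  rw [hB, add_mul, mul_assoc, coeff_add, coeff_C_mul, add_mul, one_mul]
  refine (abs_add_le _ _).trans (add_le_add ?_ ?_)
  · rcases hA with rfl | rfl
    · exact hX _ _
    · rw [one_mul]; exact hG _
  · rw [abs_mul, abs_of_nonneg he]
    exact mul_le_mul_of_nonneg_left (hX _ _) he

lemma coeff_pow_mul {N E : ℤ} (B : MvPolynomial (Fin 2) ℤ)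
    (h : ∀ (N : ℤ) (G : MvPolynomial (Fin 2) ℤ), (∀ m, |coeff m G| ≤ N) → ∀ m, |coeff m (B * G)| ≤ E * N)
    (G : MvPolynomial (Fin 2) ℤ) (hG : ∀ m, |coeff m G| ≤ N) (n : ℕ) (m : Fin 2 →₀ ℕ) :
    |coeff m (B ^ n * G)| ≤ E ^ n * N := by
  induction n generalizing m with
  | zero => simpa using hG m
  | succ n ih =>
    have := h _ _ ih m
    rw [pow_succ', mul_assoc, pow_succ', mul_assoc]
    exact this

lemma sbt_coeff {d : ℕ} {f : MvPolynomial (Fin 3) ℤ} (hf : f.IsHomogeneous d) {v w : ℕ} (hv : v ≤ d) (hw : w ≤ d) {N : ℤ}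
    (hN : ∀ m, |coeff m f| ≤ N) (m : Fin 2 →₀ ℕ) :
    |coeff m (sbt (v : ℤ) (w : ℤ) f)| ≤ (d + 1) ^ 2 * ((d + 1) ^ d * N) := by
  have hN0 : 0 ≤ N := (abs_nonneg _).trans (hN 0)
  rw [sbt_eq, coeff_sum]
  refine (Finset.abs_sum_le_sum_abs _ _).trans ?_
  have hterm : ∀ μ ∈ f.support, |coeff m (C (coeff μ f) * (lf (v : ℤ) (w : ℤ) 0 ^ μ 0 * lf (v : ℤ) (w : ℤ) 1 ^ μ 1 * lf (v : ℤ) (w : ℤ) 2 ^ μ 2))|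
      ≤ (d + 1 : ℤ) ^ d * N := by
    intro μ hμ
    have hdeg := deg_sum hf (mem_support_iff.1 hμ)
    have h2 : ∀ m, |coeff m (lf (v : ℤ) (w : ℤ) 2 ^ μ 2)| ≤ 1 := by
      intro m
      show |coeff m (X 1 ^ μ 2)| ≤ 1
      rw [coeff_X_pow]; split_ifs <;> simp
    have h1 := coeff_pow_mul (N := 1) (E := 1 + w) (lf (v : ℤ) (w : ℤ) 1)
      (fun N G hG m => coeff_lin_mul (by positivity) 1 _ (Or.inr rfl) G rfl hG m) _ h2 (μ 1)
    have h0 := coeff_pow_mul (E := 1 + v) (lf (v : ℤ) (w : ℤ) 0)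
      (fun N G hG m => coeff_lin_mul (by positivity) (X 0) _ (Or.inl rfl) G rfl hG m) _ h1 (μ 0) m
    rw [coeff_C_mul, abs_mul, mul_comm, mul_assoc (lf _ _ 0 ^ _)]
    refine mul_le_mul (h0.trans ?_) (hN μ) (abs_nonneg _) (by positivity)
    have hv' : (1 + v : ℤ) ≤ d + 1 := by omega
    have hw' : (1 + w : ℤ) ≤ d + 1 := by omega
    calc (1 + v : ℤ) ^ μ 0 * ((1 + w) ^ μ 1 * 1) ≤ (d + 1) ^ μ 0 * ((d + 1) ^ μ 1 * 1) := by gcongr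
      _ = (d + 1) ^ (μ 0 + μ 1) := by rw [pow_add]; ring
      _ ≤ _ := pow_le_pow_right₀ (by omega) (by omega)
  refine (Finset.sum_le_card_nsmul _ _ _ hterm).trans ?_
  rw [nsmul_eq_mul]
  have := support_card_le hf
  have h' : (f.support.card : ℤ) ≤ (d + 1) ^ 2 := by exact_mod_cast this
  exact mul_le_mul_of_nonneg_right h' (by positivity)

end PCB

-- Module M12
namespace PCB
open MvPolynomial

/-- proportional primitive vectors give the same projective point -/
lemma mk_eq_of_minors (x y : Fin 3 → ℤ) (hx : (fun i => (x i : ℚ)) ≠ 0) (hy : (fun i => (y i : ℚ)) ≠ 0)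
    (h : ∀ i j, x i * y j = y i * x j) :
    Projectivization.mk ℚ (fun i => (x i : ℚ)) hx = Projectivization.mk ℚ (fun i => (y i : ℚ)) hy := by
  rw [Projectivization.mk_eq_mk_iff']
  obtain ⟨j, hj⟩ := Function.ne_iff.1 hy
  refine ⟨(x j : ℚ) / y j, ?_⟩
  ext i
  have h1 : (x i : ℚ) * y j = y i * x j := by exact_mod_cast h i j
  simp only [Pi.smul_apply, smul_eq_mul]
  simp only [Pi.zero_apply] at hj
  rw [div_mul_eq_mul_div, div_eq_iff hj]
  linarith

theorem main : ∃ c : ℝ, 0 < c ∧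
      ∀ (d : ℕ) (f : MvPolynomial (Fin 3) ℤ) (B : ℝ),
        1 ≤ d → f.IsHomogeneous d →
        Finset.gcd f.support f.coeff = 1 →
        Irreducible (MvPolynomial.map (Int.castRingHom ℚ) f) →
        1 ≤ B →
        (Nproj f B : ℝ) ≤ c * (d : ℝ) ^ 4 * B ^ (2 / (d : ℝ)) := by
  classical
  obtain ⟨K, hK0, hK⟩ := curve_count
  refine ⟨K, hK0, ?_⟩
  intro d f B hd1 hf hg hirr hB
  have hf0 : f ≠ 0 := by rintro rfl; simp at hirr
  obtain ⟨v, w, hv, hw, hc, hcoef⟩ := choose_v hf hf0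
  set c := eval ![(v : ℤ), (w : ℤ), 1] f with hcdef
  set S := {P : Projectivization ℚ (Fin 3 → ℚ) |
    ∃ (v : Fin 3 → ℤ) (hv : (fun i => (v i : ℚ)) ≠ 0),
      Finset.univ.gcd v = 1 ∧
      MvPolynomial.eval v f = 0 ∧ (∀ i, |(v i : ℝ)| ≤ B) ∧
      P = Projectivization.mk ℚ (fun i => (v i : ℚ)) hv} with hS
  show ((S.ncard : ℕ) : ℝ) ≤ _
  rcases S.finite_or_infinite with hfin | hinf
  swap
  · rw [hinf.ncard]; simp; positivity
  have hrep : ∀ P : Projectivization ℚ (Fin 3 → ℚ), ∃ x : Fin 3 → ℤ, P ∈ S → ∃ (hx : (fun i => (x i : ℚ)) ≠ 0),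
      Finset.univ.gcd x = 1 ∧ MvPolynomial.eval x f = 0 ∧ (∀ i, |(x i : ℝ)| ≤ B) ∧
      P = Projectivization.mk ℚ (fun i => (x i : ℚ)) hx := by
    intro P
    by_cases hP : P ∈ S
    · obtain ⟨x, hx⟩ := hP
      exact ⟨x, fun _ => hx⟩
    · exact ⟨0, fun h => absurd h hP⟩
  choose rep hrep using hrep
  let ψ : Projectivization ℚ (Fin 3 → ℚ) → ℤ × ℤ × ℤ := fun P =>
    (rep P 0 - v * rep P 2, rep P 2, rep P 1 - w * rep P 2)
  have hkey : ∀ P ∈ S, ∀ Q ∈ S, (ψ P).1 * (ψ Q).2.1 = (ψ Q).1 * (ψ P).2.1 →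
      (ψ P).1 * (ψ Q).2.2 = (ψ Q).1 * (ψ P).2.2 → (ψ P).2.1 * (ψ Q).2.2 = (ψ Q).2.1 * (ψ P).2.2 → P = Q := by
    intro P hP Q hQ h1 h2 h3
    obtain ⟨hx, -, -, -, hPe⟩ := hrep P hP
    obtain ⟨hy, -, -, -, hQe⟩ := hrep Q hQ
    rw [hPe, hQe]
    simp only [ψ] at h1 h2 h3
    have e02 : rep P 0 * rep Q 2 = rep Q 0 * rep P 2 := by linear_combination h1
    have e12 : rep P 1 * rep Q 2 = rep Q 1 * rep P 2 := by linear_combination -h3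
    have e01 : rep P 0 * rep Q 1 = rep Q 0 * rep P 1 := by
      linear_combination h2 + (w : ℤ) * e02 - (v : ℤ) * e12
    apply mk_eq_of_minors
    intro i j
    fin_cases i <;> fin_cases j <;> simp <;> linarith
  have hinj : Set.InjOn ψ S := by
    intro P hP Q hQ h
    exact hkey P hP Q hQ (by rw [h]) (by rw [h]) (by rw [h])
  set T := hfin.toFinset.image ψ with hT
  have hcard : S.ncard = T.card := by
    rw [hT, Finset.card_image_of_injOn (by simpa using hinj), Set.ncard_eq_toFinset_card S hfin]
  have hmemT : ∀ p ∈ T, ∃ P ∈ S, ψ P = p := by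
    intro p hp
    obtain ⟨P, hP, rfl⟩ := Finset.mem_image.1 hp
    exact ⟨P, hfin.mem_toFinset.1 hP, rfl⟩
  rw [hcard]
  have hc1 := Int.one_le_abs hc
  set N : ℤ := ((d + 1 : ℤ) ^ (d + 1)) ^ 2 * |c| with hN
  have hN0 : 0 < N := by positivity
  set H : ℤ := (d + 1) ^ 2 * ((d + 1) ^ d * N) with hH
  have hH0 : 0 < H := by positivity
  have hHn : ((H.toNat : ℕ) : ℤ) = H := Int.toNat_of_nonneg hH0.le
  have hdr : (1 : ℝ) ≤ d := by exact_mod_cast hd1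
  refine hK d (sbt (v : ℤ) (w : ℤ) f) H.toNat B T hd1 (sbt_deg _ _ hf) ?_ (fun p hp => sbt_prim _ _ hf hg p hp) ?_ ?_ ?_ hB ?_ ?_ ?_ ?_
  · rw [map_sbt]
    refine sbt_irred _ _ hd1 (hf.map _) hirr ?_
    rw [← coeff_sbt_top _ _ (hf.map _), ← map_sbt, coeff_map, coeff_sbt_top _ _ hf]
    simpa using hc
  · rw [coeff_sbt_top _ _ hf]; exact hc
  · intro m
    rw [hHn]
    exact sbt_coeff hf hv hw hcoef m
  · rw [coeff_sbt_top _ _ hf, ← hcdef]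
    have h1 : ((H.toNat : ℕ) : ℝ) = ((d : ℝ) + 1) ^ 2 * (((d : ℝ) + 1) ^ d * ((((d : ℝ) + 1) ^ (d + 1)) ^ 2 * |(c : ℝ)|)) := by
      have : ((H.toNat : ℕ) : ℝ) = ((H : ℤ) : ℝ) := by exact_mod_cast congrArg (fun z : ℤ => (z : ℝ)) hHn
      rw [this, hH, hN]; push_cast; ring
    have hc1' : (1 : ℝ) ≤ |(c : ℝ)| := by exact_mod_cast hc1
    rw [h1, Real.log_mul (by positivity) (by positivity), Real.log_mul (by positivity) (by positivity),
      Real.log_mul (by positivity) (by positivity), Real.log_pow, Real.log_pow, Real.log_pow, Real.log_pow]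
    have hl : Real.log ((d : ℝ) + 1) ≤ d := (Real.log_le_sub_one_of_pos (by linarith)).trans (by linarith)
    push_cast
    have h2 : (3 * (d : ℝ) + 4) * Real.log ((d : ℝ) + 1) ≤ (3 * d + 4) * d := by gcongr
    nlinarith
  · intro p hp
    obtain ⟨P, hP, rfl⟩ := hmemT p hp
    obtain ⟨hx, h1, h2, h3, hPe⟩ := hrep P hP
    rw [hev_sbt _ _ hf]
    simp only [ψ]
    rw [← h2]
    congr 2
    ext i; fin_cases i <;> simp
  · intro p hp r hr hdiv
    obtain ⟨P, hP, rfl⟩ := hmemT p hp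
    obtain ⟨hx, h1, h2, h3, hPe⟩ := hrep P hP
    obtain ⟨ha, hb, hq⟩ := hdiv
    simp only [ψ] at ha hb hq
    have h4 : (r : ℤ) ∣ Finset.univ.gcd (rep P) := by
      refine Finset.dvd_gcd fun i _ => ?_
      fin_cases i
      · simpa using dvd_add ha (Dvd.dvd.mul_left hb (v : ℤ))
      · simpa using dvd_add hq (Dvd.dvd.mul_left hb (w : ℤ))
      · exact hb
    rw [h1] at h4
    exact (Nat.prime_iff_prime_int.1 hr).not_isUnit (isUnit_of_dvd_one h4)
  · intro p hp
    obtain ⟨P, hP, rfl⟩ := hmemT p hp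
    obtain ⟨hx, h1, h2, h3, hPe⟩ := hrep P hP
    have hv' : (v : ℝ) ≤ d := by exact_mod_cast hv
    have hw' : (w : ℝ) ≤ d := by exact_mod_cast hw
    simp only [ψ]
    push_cast
    have hgen : ∀ (u : ℕ) (i : Fin 3), (u : ℝ) ≤ d → |(rep P i : ℝ) - u * rep P 2| ≤ (d + 1) * B := by
      intro u i hu
      refine (abs_sub _ _).trans ?_
      rw [abs_mul, Nat.abs_cast]
      have := mul_le_mul hu (h3 2) (abs_nonneg _) (by positivity)
      linarith [h3 i]
    refine ⟨hgen v 0 hv', ?_, hgen w 1 hw'⟩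
    refine (h3 2).trans ?_
    nlinarith
  · intro p hp p' hp' h1 h2 h3
    obtain ⟨P, hP, rfl⟩ := hmemT p hp
    obtain ⟨Q, hQ, rfl⟩ := hmemT p' hp'
    rw [hkey P hP Q hQ h1 h2 h3]

end PCB

/-- **Projective curves (Walsh-type bound).** There is an absolute constant `c > 0` such
that for every primitive homogeneous polynomial `f ∈ ℤ[x_0,x_1,x_2]` of degree `d ≥ 1`
irreducible over `ℚ` and every `B ≥ 1`, one has `N(f,B) ≤ c · d^4 · B^(2/d)`. -/
theorem projective_curves_bound :
    ∃ c : ℝ, 0 < c ∧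
      ∀ (d : ℕ) (f : MvPolynomial (Fin 3) ℤ) (B : ℝ),
        1 ≤ d → f.IsHomogeneous d →
        Finset.gcd f.support f.coeff = 1 →
        Irreducible (MvPolynomial.map (Int.castRingHom ℚ) f) →
        1 ≤ B →
        (Nproj f B : ℝ) ≤ c * (d : ℝ) ^ 4 * B ^ (2 / (d : ℝ)) := by
  exact PCB.main
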